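/- Given n ≥ 1 and s > 0, there exist constants k♯ and C♯ depending only on n, s such that the following holds. Let E ⊆ ℝⁿ be an arbitrary set (not necessarily finite or closed) and let f : E → [0,∞). Then f extends to a function in F^s(ℝⁿ) (i.e., there exists F ∈ F^s(ℝⁿ) with F = f on E) if and only if sup_{S⊆E, #S≤k♯} ‖f‖_{F^s(S)} < ∞. Moreover, sup_{S⊆E, #S≤k♯} ‖f‖_{F^s(S)} ≤ ‖f‖_{F^s(E)} ≤ C♯ · sup_{S⊆E, #S≤k♯} ‖f‖_{F^s(S)}. -/

import Mathlib

open Set ENNReal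
open scoped NNReal

noncomputable section

/-- The largest integer strictly less than `s` (for `s > 0`). -/
def lowFloor (s : ℝ) : ℕ := ⌈s⌉₊ - 1

variable {E : Type*} [NormedAddCommGroup E] [NormedSpace ℝ E]

/-- `max_{0 ≤ m < s} sup_{x ∈ Ω} |∇^m F(x)|`, valued in `ℝ≥0∞`. -/
def derivSup (s : ℝ) (Ω : Set E) (F : E → ℝ) : ℝ≥0∞ :=
  ⨆ (m : ℕ) (_ : m ≤ lowFloor s) (x : E) (_ : x ∈ Ω),
    (‖iteratedFDerivWithin ℝ m F Ω x‖₊ : ℝ≥0∞)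

/-- The homogeneous Hölder seminorm `‖F‖_{Ċ^s(Ω)}`, valued in `ℝ≥0∞`. -/
def holderSemi (s : ℝ) (Ω : Set E) (F : E → ℝ) : ℝ≥0∞ :=
  ⨆ (x : E) (_ : x ∈ Ω) (y : E) (_ : y ∈ Ω) (_ : x ≠ y),
    (‖iteratedFDerivWithin ℝ (lowFloor s) F Ω x
        - iteratedFDerivWithin ℝ (lowFloor s) F Ω y‖₊ : ℝ≥0∞)
      / ENNReal.ofReal (‖x - y‖ ^ (s - (lowFloor s : ℝ)))

/-- The Hölder norm `‖F‖_{C^s(Ω)}`, valued in `ℝ≥0∞`. -/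
def csNorm (s : ℝ) (Ω : Set E) (F : E → ℝ) : ℝ≥0∞ :=
  derivSup s Ω F + holderSemi s Ω F

/-- Membership in `C^s(Ω)`. -/
def MemCs (s : ℝ) (Ω : Set E) (F : E → ℝ) : Prop :=
  ContDiffOn ℝ (lowFloor s : ℕ∞) F Ω ∧ csNorm s Ω F ≠ ∞

/-- The flat seminorm `‖F‖_{Ḟ^s(Ω)}`, valued in `ℝ≥0∞`.  (In `ℝ≥0∞` one has
`0/0 = 0` and `a/0 = ∞` for `a ≠ 0`, matching the paper's conventions; for
`0 < s < 1` the supremum is empty, hence `0`.) -/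
def flatSemi (s : ℝ) (Ω : Set E) (F : E → ℝ) : ℝ≥0∞ :=
  ⨆ (m : ℕ) (_ : 1 ≤ m) (_ : m ≤ lowFloor s) (x : E) (_ : x ∈ Ω),
    ((‖iteratedFDerivWithin ℝ m F Ω x‖₊ : ℝ≥0∞) ^ s
      / ENNReal.ofReal (F x) ^ (s - (m : ℝ))) ^ (1 / (m : ℝ))

/-- Membership in the cone `F^s(Ω)`. -/
def MemFs (s : ℝ) (Ω : Set E) (F : E → ℝ) : Prop :=
  MemCs s Ω F ∧ (∀ x ∈ Ω, 0 ≤ F x) ∧ flatSemi s Ω F ≠ ∞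

/-- The norm `‖F‖_{F^s(Ω)} = ‖F‖_{C^s(Ω)} + ‖F‖_{Ḟ^s(Ω)}`. -/
def fsNorm (s : ℝ) (Ω : Set E) (F : E → ℝ) : ℝ≥0∞ :=
  csNorm s Ω F + flatSemi s Ω F

/-- `sup_{x ∈ Ω} |F(x)|`, valued in `ℝ≥0∞`. -/
def supNormSet (Ω : Set E) (F : E → ℝ) : ℝ≥0∞ :=
  ⨆ (x : E) (_ : x ∈ Ω), (‖F x‖₊ : ℝ≥0∞)

/-- `P` is (the function given by) a polynomial of degree at most `D`. -/
def IsPolyDeg (D : ℕ) (P : E → ℝ) : Prop :=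
  ContDiff ℝ (⊤ : ℕ∞) P ∧ ∀ x, iteratedFDeriv ℝ (D + 1) P x = 0

/-- The degree-`D` Taylor polynomial (jet) of `F` at `x`, as a function. -/
def jetAt (D : ℕ) (F : E → ℝ) (x : E) : E → ℝ :=
  fun y => ∑ m ∈ Finset.range (D + 1),
    (iteratedFDeriv ℝ m F x fun _ => y - x) / m.factorial

/-- The degree-`D` Taylor polynomial of `F` at `x` using derivatives within `Ω`. -/
def jetWithinAt (D : ℕ) (F : E → ℝ) (Ω : Set E) (x : E) : E → ℝ :=
  fun y => ∑ m ∈ Finset.range (D + 1),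
    (iteratedFDerivWithin ℝ m F Ω x fun _ => y - x) / m.factorial

/-- The pointwise flatness quantity `max_{1≤m<s} (|∇^m P(x)|^s / P(x)^{s-m})^{1/m}`. -/
def jetFlatAt (s : ℝ) (P : E → ℝ) (x : E) : ℝ≥0∞ :=
  ⨆ (m : ℕ) (_ : 1 ≤ m) (_ : m ≤ lowFloor s),
    ((‖iteratedFDeriv ℝ m P x‖₊ : ℝ≥0∞) ^ s
      / ENNReal.ofReal (P x) ^ (s - (m : ℝ))) ^ (1 / (m : ℝ))

/-- The set `Γ(x₀, M)` of flat nonnegative jets. -/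
def Gamma (s : ℝ) (x₀ : E) (M : ℝ) : Set (E → ℝ) :=
  {P | IsPolyDeg (lowFloor s) P ∧ 0 ≤ P x₀ ∧
    (∀ m ≤ lowFloor s, ‖iteratedFDeriv ℝ m P x₀‖ ≤ M) ∧
    jetFlatAt s P x₀ ≤ ENNReal.ofReal M}

/-- `‖P⃗‖_{J C^s(E)}` for a family of jets `P : E → (E → ℝ)`. -/
def jetCNorm (s : ℝ) (Eset : Set E) (P : E → E → ℝ) : ℝ≥0∞ :=
  (⨆ (x : E) (_ : x ∈ Eset) (m : ℕ) (_ : m ≤ lowFloor s),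
      (‖iteratedFDeriv ℝ m (P x) x‖₊ : ℝ≥0∞))
  + ⨆ (x : E) (_ : x ∈ Eset) (y : E) (_ : y ∈ Eset) (_ : x ≠ y)
      (m : ℕ) (_ : m ≤ lowFloor s),
      (‖iteratedFDeriv ℝ m (P x - P y) y‖₊ : ℝ≥0∞)
        / ENNReal.ofReal (‖x - y‖ ^ (s - (m : ℝ)))

/-- `‖P⃗‖_{J Ḟ^s(E)}` for a family of jets. -/
def jetFlatNorm (s : ℝ) (Eset : Set E) (P : E → E → ℝ) : ℝ≥0∞ :=
  ⨆ (x : E) (_ : x ∈ Eset) (m : ℕ) (_ : 1 ≤ m) (_ : m ≤ lowFloor s),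
    ((‖iteratedFDeriv ℝ m (P x) x‖₊ : ℝ≥0∞) ^ s
      / ENNReal.ofReal |P x x| ^ (s - (m : ℝ))) ^ (1 / (m : ℝ))

/-- `‖P⃗‖_{J F^s(E)}`. -/
def jetFsNorm (s : ℝ) (Eset : Set E) (P : E → E → ℝ) : ℝ≥0∞ :=
  jetCNorm s Eset P + jetFlatNorm s Eset P

/-- The trace norm `‖f‖_{F^s(S)}` (with `inf ∅ = ∞`). -/
def traceNorm (s : ℝ) (S : Set E) (f : E → ℝ) : ℝ≥0∞ :=
  ⨅ (F : E → ℝ) (_ : MemFs s (univ : Set E) F ∧ ∀ x ∈ S, F x = f x),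
    fsNorm s (univ : Set E) F

namespace FlatExt

/-- Euclidean space. -/
abbrev Pt (n : ℕ) := EuclideanSpace ℝ (Fin n)

/-- Multi-indices. -/
abbrev MI (n : ℕ) := Fin n →₀ ℕ

/-- Multi-indices of degree at most `D`. -/
def mset (n D : ℕ) : Finset (MI n) := (Finsupp.finite_of_degree_le (σ := Fin n) D).toFinset

lemma mem_mset {n D : ℕ} {α : MI n} : α ∈ mset n D ↔ α.degree ≤ D := by
  simp [mset]

/-- Polynomials of degree at most `D`, given by their coefficients at the origin. -/
abbrev J (n D : ℕ) := mset n D → ℝ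

variable {n D : ℕ}

/-- The polynomial with given coefficients. -/
def toPly : J n D →ₗ[ℝ] MvPolynomial (Fin n) ℝ where
  toFun p := ∑ α : mset n D, MvPolynomial.monomial (α : MI n) (p α)
  map_add' p q := by simp [Finset.sum_add_distrib]
  map_smul' r p := by simp [Finset.smul_sum, MvPolynomial.smul_monomial]

lemma toPly_apply (p : J n D) :
    toPly p = ∑ α : mset n D, MvPolynomial.monomial (α : MI n) (p α) := rfl

lemma coeff_toPly_of_mem (p : J n D) {α : MI n} (h : α ∈ mset n D) :
    (toPly p).coeff α = p ⟨α, h⟩ := by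
  classical
  simp only [toPly_apply, MvPolynomial.coeff_sum, MvPolynomial.coeff_monomial]
  rw [Finset.sum_eq_single ⟨α, h⟩]
  · simp
  · intro b _ hb
    rw [if_neg]
    intro hh; exact hb (Subtype.ext hh)
  · simp

lemma coeff_toPly_of_notMem (p : J n D) {α : MI n} (h : α ∉ mset n D) :
    (toPly p).coeff α = 0 := by
  classical
  simp only [toPly_apply, MvPolynomial.coeff_sum, MvPolynomial.coeff_monomial]
  refine Finset.sum_eq_zero fun b _ => ?_
  rw [if_neg]
  intro hh; exact h (hh ▸ b.2)

/-- Truncation of a polynomial to degree `D`. -/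
def ofPly (P : MvPolynomial (Fin n) ℝ) : J n D := fun α => P.coeff (α : MI n)

lemma toPly_ofPly (P : MvPolynomial (Fin n) ℝ) (h : ∀ α, α ∉ mset n D → P.coeff α = 0) :
    toPly (ofPly (D := D) P) = P := by
  ext α
  by_cases hα : α ∈ mset n D
  · rw [coeff_toPly_of_mem _ hα]; rfl
  · rw [coeff_toPly_of_notMem _ hα, h α hα]

/-- Translation of polynomials. -/
def sh (x : Pt n) : MvPolynomial (Fin n) ℝ →ₐ[ℝ] MvPolynomial (Fin n) ℝ :=
  MvPolynomial.aeval fun i => MvPolynomial.X i + MvPolynomial.C (x i)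

lemma sh_sh (x y : Pt n) (P : MvPolynomial (Fin n) ℝ) : sh x (sh y P) = sh (x + y) P := by
  have : (sh x).comp (sh y) = sh (x + y) := by
    apply MvPolynomial.algHom_ext
    intro i
    simp only [sh, AlgHom.comp_apply, MvPolynomial.aeval_X, map_add, MvPolynomial.aeval_C,
      MvPolynomial.algebraMap_eq, PiLp.add_apply]
    ring
  exact congrArg (fun g => g P) this

lemma sh_zero (P : MvPolynomial (Fin n) ℝ) : sh 0 P = P := by
  have : (sh (0 : Pt n)) = AlgHom.id ℝ _ := by
    apply MvPolynomial.algHom_ext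
    intro i
    simp [sh]
  rw [this]; rfl

/-- Matrix entries of the translation. -/
def tc (α β : MI n) (h : Pt n) : ℝ := ∏ i, ((β i).choose (α i) : ℝ) * h i ^ (β i - α i)

lemma coeff_sh_monomial (α β : MI n) (h : Pt n) (r : ℝ) :
    (sh h (MvPolynomial.monomial β r)).coeff α = r * tc α β h := by
  classical
  have e1 : sh h (MvPolynomial.monomial β r) =
      MvPolynomial.C r * ∏ i, (MvPolynomial.X i + MvPolynomial.C (h i)) ^ (β i) := by
    simp only [sh, MvPolynomial.aeval_monomial, MvPolynomial.algebraMap_eq]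
    rw [Finsupp.prod_fintype]
    simp
  rw [e1, MvPolynomial.coeff_C_mul]
  congr 1
  simp_rw [add_pow]
  rw [Finset.prod_univ_sum]
  rw [MvPolynomial.coeff_sum]
  have e2 : ∀ a : Fin n → ℕ, MvPolynomial.coeff α (∏ i, (MvPolynomial.X i ^ (a i) *
      MvPolynomial.C (h i) ^ (β i - a i) * (((β i).choose (a i) : ℕ) : MvPolynomial (Fin n) ℝ)))
      = if Finsupp.equivFunOnFinite.symm a = α then
        ∏ i, ((β i).choose (a i) : ℝ) * h i ^ (β i - a i) else 0 := by
    intro a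
    have : (∏ i, (MvPolynomial.X i ^ (a i) *
      MvPolynomial.C (h i) ^ (β i - a i) * (((β i).choose (a i) : ℕ) : MvPolynomial (Fin n) ℝ)))
      = MvPolynomial.monomial (Finsupp.equivFunOnFinite.symm a)
        (∏ i, ((β i).choose (a i) : ℝ) * h i ^ (β i - a i)) := by
      rw [MvPolynomial.monomial_eq, Finsupp.prod_fintype _ _ (by simp), map_prod,
        ← Finset.prod_mul_distrib]
      refine Finset.prod_congr rfl fun i _ => ?_
      simp only [map_mul, map_pow, map_natCast, Finsupp.equivFunOnFinite_symm_apply_apply]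
      ring
    rw [this, MvPolynomial.coeff_monomial]
  rw [Finset.sum_congr rfl (fun a _ => e2 a)]
  by_cases hle : ∀ i, α i ≤ β i
  · rw [Finset.sum_eq_single (fun i => α i)]
    · rw [if_pos]
      · rfl
      · ext i; simp
    · intro b _ hb
      rw [if_neg]
      intro hh; apply hb; funext i; rw [← hh]; simp
    · intro hh
      exfalso; apply hh
      simp only [Fintype.mem_piFinset, Finset.mem_range]
      intro i; have := hle i; omega
  · push Not at hle
    obtain ⟨i, hi⟩ := hle
    have : tc α β h = 0 := by
      apply Finset.prod_eq_zero (Finset.mem_univ i)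
      rw [Nat.choose_eq_zero_of_lt hi]; simp
    rw [this]
    refine Finset.sum_eq_zero fun a ha => ?_
    rw [if_neg]
    intro hh
    have h1 := (Fintype.mem_piFinset.1 ha) i
    have h2 : α i = a i := by rw [← hh]; simp
    simp only [Finset.mem_range] at h1
    omega

lemma coeff_sh (α : MI n) (h : Pt n) (P : MvPolynomial (Fin n) ℝ) (S : Finset (MI n))
    (hS : ∀ β, β ∉ S → P.coeff β = 0) :
    (sh h P).coeff α = ∑ β ∈ S, tc α β h * P.coeff β := by
  conv_lhs => rw [← MvPolynomial.support_sum_monomial_coeff P]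
  rw [map_sum, MvPolynomial.coeff_sum]
  simp_rw [coeff_sh_monomial]
  rw [Finset.sum_subset (s₂ := S)]
  · exact Finset.sum_congr rfl fun _ _ => mul_comm _ _
  · intro b hb
    by_contra hb'
    exact (MvPolynomial.mem_support_iff.1 hb) (hS b hb')
  · intro b _ hb
    rw [MvPolynomial.notMem_support_iff.1 hb]; simp

lemma tc_eq_zero {α β : MI n} (h : ¬ α ≤ β) (v : Pt n) : tc α β v = 0 := by
  have : ∃ i, β i < α i := by
    by_contra hh; push Not at hh; exact h hh
  obtain ⟨i, hi⟩ := this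
  apply Finset.prod_eq_zero (Finset.mem_univ i)
  rw [Nat.choose_eq_zero_of_lt hi]; simp

lemma tc_self (α : MI n) (v : Pt n) : tc α α v = 1 := by
  simp [tc]

lemma degree_le_of_le {α β : MI n} (h : α ≤ β) : α.degree ≤ β.degree := by
  rw [Finsupp.degree_eq_sum, Finsupp.degree_eq_sum]
  exact Finset.sum_le_sum fun i _ => h i

lemma eq_of_le_of_degree {α β : MI n} (h : α ≤ β) (hd : β.degree ≤ α.degree) : α = β := by
  rw [Finsupp.degree_eq_sum, Finsupp.degree_eq_sum] at hd
  have := (Finset.sum_eq_sum_iff_of_le (s := Finset.univ) (fun i _ => h i)).1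
    (le_antisymm (Finset.sum_le_sum fun i _ => h i) hd)
  ext i; exact this i (Finset.mem_univ i)

lemma abs_coord_le (v : Pt n) (i : Fin n) : |v i| ≤ ‖v‖ := by
  have := PiLp.norm_apply_le v i
  simpa using this

lemma abs_tc_le (α β : MI n) (v : Pt n) :
    |tc α β v| ≤ 2 ^ β.degree * ‖v‖ ^ (β.degree - α.degree) := by
  by_cases h : α ≤ β
  · have e : β.degree - α.degree = ∑ i, (β i - α i) := by
      rw [Finsupp.degree_eq_sum, Finsupp.degree_eq_sum]
      have : ∑ i, β i = ∑ i, (β i - α i) + ∑ i, α i := by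
        rw [← Finset.sum_add_distrib]
        exact Finset.sum_congr rfl fun i _ => by have := h i; omega
      omega
    rw [e, Finsupp.degree_eq_sum, ← Finset.prod_pow_eq_pow_sum, ← Finset.prod_pow_eq_pow_sum,
      ← Finset.prod_mul_distrib, tc, Finset.abs_prod]
    refine Finset.prod_le_prod (fun _ _ => abs_nonneg _) fun i _ => ?_
    rw [abs_mul, abs_pow, Nat.abs_cast]
    have h1 : ((β i).choose (α i) : ℝ) ≤ 2 ^ (β i) := by
      exact_mod_cast Nat.choose_le_two_pow _ _
    have h2 : |v i| ^ (β i - α i) ≤ ‖v‖ ^ (β i - α i) :=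
      pow_le_pow_left₀ (abs_nonneg _) (abs_coord_le v i) _
    exact mul_le_mul h1 h2 (by positivity) (by positivity)
  · rw [tc_eq_zero h]; simp

lemma degree_add_single (α : MI n) (i : Fin n) :
    (α + Finsupp.single i 1).degree = α.degree + 1 := by
  simp [map_add]

lemma tc_add_single (α : MI n) (i : Fin n) (v : Pt n) :
    tc α (α + Finsupp.single i 1) v = (α i + 1) * v i := by
  classical
  rw [tc, Finset.prod_eq_single i]
  · simp
  · intro j _ hj
    simp [Finsupp.single_apply, Ne.symm hj]
  · simp

lemma exists_add_single {α β : MI n} (h : α ≤ β) (hd : β.degree = α.degree + 1) :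
    ∃ i, β = α + Finsupp.single i 1 := by
  classical
  obtain ⟨γ, rfl⟩ := exists_add_of_le h
  have hγ : γ.degree = 1 := by rw [map_add] at hd; omega
  have h0 : γ ≠ 0 := by rintro rfl; simp at hγ
  obtain ⟨i, hi⟩ := Finsupp.ne_iff.1 h0
  refine ⟨i, ?_⟩
  congr 1
  symm
  apply eq_of_le_of_degree
  · rw [Finsupp.single_le_iff]; simp at hi; omega
  · rw [hγ]; simp

/-- The Taylor coefficient of index `α` at `x`. -/
def co (x : Pt n) (α : MI n) : J n D →ₗ[ℝ] ℝ :=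
  (MvPolynomial.lcoeff ℝ α).comp ((sh x).toLinearMap.comp toPly)

lemma co_def (x : Pt n) (α : MI n) (p : J n D) : co x α p = (sh x (toPly p)).coeff α := rfl

lemma co_eq_zero (x : Pt n) {α : MI n} (h : D < α.degree) (p : J n D) : co x α p = 0 := by
  rw [co_def, coeff_sh α x _ (mset n D) (fun β => coeff_toPly_of_notMem p)]
  refine Finset.sum_eq_zero fun β hβ => ?_
  rw [tc_eq_zero, zero_mul]
  intro hle
  have := degree_le_of_le hle
  have := mem_mset.1 hβ
  omega

lemma co_shift (x y : Pt n) (α : MI n) (p : J n D) :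
    co y α p = ∑ β ∈ mset n D, tc α β (y - x) * co x β p := by
  rw [co_def]
  have : sh y (toPly p) = sh (y - x) (sh x (toPly p)) := by rw [sh_sh]; simp
  rw [this, coeff_sh α _ _ (mset n D)]
  · rfl
  · intro β hβ
    have := co_eq_zero x (D := D) (α := β) (by rw [mem_mset] at hβ; omega) p
    rwa [co_def] at this

/-- The polynomial with given Taylor coefficients at `x`. -/
def ofCo (x : Pt n) (a : MI n → ℝ) : J n D := ofPly (sh (-x) (toPly (D := D) fun α => a α))

lemma co_ofCo (x : Pt n) (a : MI n → ℝ) {α : MI n} (h : α.degree ≤ D) :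
    co x α (ofCo (D := D) x a) = a α := by
  rw [co_def, ofCo, toPly_ofPly, sh_sh, add_neg_cancel, sh_zero,
    coeff_toPly_of_mem _ (mem_mset.2 h)]
  intro β hβ
  have := co_eq_zero (-x) (D := D) (α := β) (by rw [mem_mset] at hβ; omega) fun α => a α
  rwa [co_def] at this

lemma J_ext {p q : J n D} (x : Pt n) (h : ∀ α : MI n, α.degree ≤ D → co x α p = co x α q) :
    p = q := by
  have h0 : ∀ α, co 0 α p = co 0 α q := by
    intro α
    rw [co_shift x, co_shift x (p := q)]
    exact Finset.sum_congr rfl fun β hβ => by rw [h β (mem_mset.1 hβ)]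
  funext α
  have := h0 α
  rwa [co_def, co_def, sh_zero, sh_zero, coeff_toPly_of_mem _ α.2, coeff_toPly_of_mem _ α.2] at this

/-- Taylor coefficients at `x` of the product of two polynomials. -/
def mulCo (x : Pt n) (p q : J n D) (α : MI n) : ℝ :=
  ∑ βγ ∈ Finset.HasAntidiagonal.antidiagonal α, co x βγ.1 p * co x βγ.2 q

/-- The product truncated at `x`. -/
def jmul (x : Pt n) (p q : J n D) : J n D := ofCo x (mulCo x p q)

lemma co_jmul (x : Pt n) (p q : J n D) {α : MI n} (h : α.degree ≤ D) :
    co x α (jmul x p q) = mulCo x p q α := co_ofCo x _ h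

lemma mulCo_eq (x : Pt n) (p q : J n D) (α : MI n) :
    mulCo x p q α = (sh x (toPly p * toPly q)).coeff α := by
  classical
  rw [map_mul, MvPolynomial.coeff_mul]; rfl

lemma mulCo_eq_zero (x : Pt n) (p q : J n D) {α : MI n} (h : 2 * D < α.degree) :
    mulCo x p q α = 0 := by
  refine Finset.sum_eq_zero fun βγ hh => ?_
  have e := Finset.HasAntidiagonal.mem_antidiagonal.1 hh
  have : βγ.1.degree + βγ.2.degree = α.degree := by rw [← map_add, e]
  by_cases h1 : D < βγ.1.degree
  · rw [co_eq_zero x h1, zero_mul]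
  · rw [co_eq_zero x (α := βγ.2) (by omega), mul_zero]

lemma mset_mono {D' : ℕ} (h : D ≤ D') : mset n D ⊆ mset n D' := by
  intro α hα; rw [mem_mset] at *; omega

lemma co_jmul_sub_jmul (z w : Pt n) (p q : J n D) {α : MI n} (h : α.degree ≤ D) :
    co z α (jmul z p q - jmul w p q) =
      ∑ γ ∈ mset n (2 * D) \ mset n D, tc α γ (z - w) * mulCo w p q γ := by
  rw [map_sub, co_jmul z p q h, co_shift w z α (jmul w p q)]
  have e1 : mulCo z p q α = ∑ γ ∈ mset n (2 * D), tc α γ (z - w) * mulCo w p q γ := by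
    rw [mulCo_eq]
    have : sh z (toPly p * toPly q) = sh (z - w) (sh w (toPly p * toPly q)) := by rw [sh_sh]; simp
    rw [this, coeff_sh α _ _ (mset n (2 * D))]
    · exact Finset.sum_congr rfl fun γ _ => by rw [mulCo_eq]
    · intro β hβ
      rw [← mulCo_eq]
      exact mulCo_eq_zero w p q (by rw [mem_mset] at hβ; omega)
  rw [e1, ← Finset.sum_sdiff (mset_mono (n := n) (show D ≤ 2 * D by omega)), add_sub_assoc]
  rw [← Finset.sum_sub_distrib, add_eq_left]
  refine Finset.sum_eq_zero fun γ hγ => ?_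
  rw [co_jmul w p q (mem_mset.1 hγ), sub_self]

lemma jmul_add_right (x : Pt n) (p q r : J n D) : jmul x p (q + r) = jmul x p q + jmul x p r := by
  apply J_ext x; intro α h
  rw [map_add, co_jmul x _ _ h, co_jmul x _ _ h, co_jmul x _ _ h]
  simp [mulCo, mul_add, Finset.sum_add_distrib]

lemma jmul_comm (x : Pt n) (p q : J n D) : jmul x p q = jmul x q p := by
  apply J_ext x; intro α h
  rw [co_jmul x _ _ h, co_jmul x _ _ h, mulCo_eq, mulCo_eq, mul_comm]

lemma jmul_smul_right (x : Pt n) (a : ℝ) (p q : J n D) : jmul x p (a • q) = a • jmul x p q := by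
  apply J_ext x; intro α h
  rw [map_smul, co_jmul x _ _ h, co_jmul x _ _ h]
  simp [mulCo, Finset.mul_sum, mul_left_comm]

lemma jmul_smul_left (x : Pt n) (a : ℝ) (p q : J n D) : jmul x (a • p) q = a • jmul x p q := by
  rw [jmul_comm, jmul_smul_right, jmul_comm]

lemma jmul_sub_right (x : Pt n) (p q r : J n D) : jmul x p (q - r) = jmul x p q - jmul x p r := by
  rw [sub_eq_add_neg, jmul_add_right, ← neg_one_smul ℝ r, jmul_smul_right, neg_one_smul,
    sub_eq_add_neg]

lemma jmul_sub_left (x : Pt n) (p q r : J n D) : jmul x (p - q) r = jmul x p r - jmul x q r := by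
  rw [jmul_comm, jmul_sub_right, jmul_comm x r, jmul_comm x r]

lemma jmul_zero_left (x : Pt n) (p : J n D) : jmul x 0 p = 0 := by
  have := jmul_smul_left x 0 0 p
  simpa using this

/-- The constant polynomial `1`. -/
def jone : J n D := ofPly 1

lemma toPly_jone : toPly (jone : J n D) = 1 := by
  classical
  apply toPly_ofPly
  intro α hα
  rw [MvPolynomial.coeff_one, if_neg]
  rintro rfl
  apply hα; rw [mem_mset]; simp

lemma jmul_one_left (x : Pt n) (p : J n D) : jmul x jone p = p := by
  apply J_ext x; intro α h
  rw [co_jmul x _ _ h, mulCo_eq, toPly_jone, one_mul, co_def]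

lemma co_jone (x : Pt n) (α : MI n) : co x α (jone : J n D) = if α = 0 then 1 else 0 := by
  classical
  rw [co_def, toPly_jone, map_one, MvPolynomial.coeff_one]
  simp [eq_comm]

lemma co_zero_jmul (x : Pt n) (p q : J n D) : co x 0 (jmul x p q) = co x 0 p * co x 0 q := by
  rw [co_jmul x _ _ (by simp)]
  simp [mulCo]

variable {s : ℝ}

/-- `D` is the largest integer strictly below `s`. -/
class Ord (D : ℕ) (s : ℝ) : Prop where
  lt : (D : ℝ) < s
  le : s ≤ D + 1

lemma Ord.pos (D : ℕ) (s : ℝ) [Ord D s] : 0 < s := lt_of_le_of_lt (Nat.cast_nonneg D) Ord.lt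

lemma sub_degree_pos [Ord D s] {k : ℕ} (h : k ≤ D) : 0 < s - k := by
  have h1 : (D : ℝ) < s := Ord.lt
  have h2 : (k : ℝ) ≤ D := by exact_mod_cast h
  linarith

lemma rpow_mul_pow_eq {δ a b : ℝ} (hδ : 0 ≤ δ) (k : ℕ) (hb : b ≠ 0) (h : a + k = b) :
    δ ^ a * δ ^ k = δ ^ b := by
  rw [← h] at hb ⊢
  rw [Real.rpow_add_natCast' hδ hb]

/-- A combinatorial constant. -/
def K0 (n D : ℕ) : ℝ := (mset n (2 * D)).card * 4 ^ D

lemma one_le_card_mset (n D : ℕ) : 1 ≤ (mset n D).card :=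
  Finset.card_pos.2 ⟨0, mem_mset.2 (by simp)⟩

lemma card_mset_le (n D : ℕ) : ((mset n D).card : ℝ) ≤ (mset n (2 * D)).card := by
  exact_mod_cast Finset.card_le_card (mset_mono (by omega))

lemma one_le_K0 (n D : ℕ) : 1 ≤ K0 n D := by
  have h1 : (1 : ℝ) ≤ (mset n (2 * D)).card := by exact_mod_cast one_le_card_mset n (2 * D)
  have h2 : (1 : ℝ) ≤ 4 ^ D := one_le_pow₀ (by norm_num)
  unfold K0; nlinarith

lemma K0_pos (n D : ℕ) : 0 < K0 n D := lt_of_lt_of_le one_pos (one_le_K0 n D)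

/-- `p` has size at most `M` at scale `δ` around `x`. -/
def Bd (s M : ℝ) (x : Pt n) (δ : ℝ) (p : J n D) : Prop :=
  ∀ α : MI n, α.degree ≤ D → |co x α p| ≤ M * δ ^ (s - α.degree)

lemma Bd.zero {M δ : ℝ} (hM : 0 ≤ M) (hδ : 0 ≤ δ) (x : Pt n) : Bd s M x δ (0 : J n D) := by
  intro α _; rw [map_zero, abs_zero]; positivity

lemma Bd.add {M M' δ : ℝ} {x : Pt n} {p q : J n D} (hp : Bd s M x δ p) (hq : Bd s M' x δ q) :
    Bd s (M + M') x δ (p + q) := by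
  intro α h
  rw [map_add, add_mul]
  exact (abs_add_le _ _).trans (add_le_add (hp α h) (hq α h))

lemma Bd.smul {M δ : ℝ} {x : Pt n} {p : J n D} (hp : Bd s M x δ p) (a : ℝ) :
    Bd s (|a| * M) x δ (a • p) := by
  intro α h
  rw [map_smul, smul_eq_mul, abs_mul, mul_assoc]
  exact mul_le_mul_of_nonneg_left (hp α h) (abs_nonneg _)

lemma Bd.neg {M δ : ℝ} {x : Pt n} {p : J n D} (hp : Bd s M x δ p) : Bd s M x δ (-p) := by
  intro α h
  rw [map_neg, abs_neg]; exact hp α h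

lemma Bd.sub {M M' δ : ℝ} {x : Pt n} {p q : J n D} (hp : Bd s M x δ p) (hq : Bd s M' x δ q) :
    Bd s (M + M') x δ (p - q) := by
  rw [sub_eq_add_neg]; exact hp.add hq.neg

lemma Bd.symm {M δ : ℝ} {x : Pt n} {p q : J n D} (hp : Bd s M x δ (p - q)) :
    Bd s M x δ (q - p) := by
  rw [← neg_sub]; exact hp.neg

lemma Bd.mono {M M' δ : ℝ} {x : Pt n} {p : J n D} (hp : Bd s M x δ p) (hδ : 0 ≤ δ) (h : M ≤ M') :
    Bd s M' x δ p := fun α hα =>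
  (hp α hα).trans (mul_le_mul_of_nonneg_right h (by positivity))

lemma Bd.mono_scale [Ord D s] {M δ δ' : ℝ} {x : Pt n} {p : J n D} (hp : Bd s M x δ p)
    (hM : 0 ≤ M) (hδ : 0 ≤ δ) (h : δ ≤ δ') : Bd s M x δ' p := fun α hα =>
  (hp α hα).trans (mul_le_mul_of_nonneg_left
    (Real.rpow_le_rpow hδ h (sub_degree_pos (s := s) hα).le) hM)

lemma Bd.sum {ι : Type*} (t : Finset ι) {M : ι → ℝ} {δ : ℝ} {x : Pt n} {p : ι → J n D}
    (h : ∀ i ∈ t, Bd s (M i) x δ (p i)) : Bd s (∑ i ∈ t, M i) x δ (∑ i ∈ t, p i) := by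
  intro α hα
  rw [map_sum, Finset.sum_mul]
  exact (Finset.abs_sum_le_sum_abs _ _).trans (Finset.sum_le_sum fun i hi => h i hi α hα)

lemma Bd.of_mul_scale [Ord D s] {M K δ : ℝ} {x : Pt n} {p : J n D} (hp : Bd s M x (K * δ) p)
    (hM : 0 ≤ M) (hK : 1 ≤ K) (hδ : 0 ≤ δ) : Bd s (M * K ^ s) x δ p := fun α hα => by
  refine (hp α hα).trans ?_
  rw [Real.mul_rpow (by linarith) hδ, mul_assoc]
  refine mul_le_mul_of_nonneg_left (mul_le_mul_of_nonneg_right ?_ (by positivity)) hM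
  exact Real.rpow_le_rpow_of_exponent_le hK (by linarith [Nat.cast_nonneg (α := ℝ) α.degree])

lemma Bd.shrink [Ord D s] {M η δ : ℝ} {x : Pt n} {p : J n D} (hp : Bd s M x (η * δ) p)
    (hM : 0 ≤ M) (hη : 0 < η) (hη1 : η ≤ 1) (hδ : 0 ≤ δ) :
    Bd s (M * η ^ (s - D)) x δ p := fun α hα => by
  refine (hp α hα).trans ?_
  rw [Real.mul_rpow hη.le hδ, mul_assoc]
  refine mul_le_mul_of_nonneg_left (mul_le_mul_of_nonneg_right ?_ (by positivity)) hM
  refine Real.rpow_le_rpow_of_exponent_ge hη hη1 ?_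
  have : (α.degree : ℝ) ≤ D := by exact_mod_cast hα
  linarith

lemma Bd.eq_zero [Ord D s] {M : ℝ} {x : Pt n} {p : J n D} (hp : Bd s M x 0 p) : p = 0 := by
  apply J_ext x
  intro α hα
  have := hp α hα
  rw [Real.zero_rpow (sub_degree_pos (s := s) hα).ne', mul_zero] at this
  rw [map_zero]
  exact abs_nonpos_iff.1 this

lemma abs_tc_mul_le [Ord D s] {M η δ : ℝ} {x y : Pt n} {p : J n D} (hp : Bd s M x δ p)
    (hM : 0 ≤ M) (hδ : 0 ≤ δ) (h : dist y x ≤ η * δ) {α β : MI n} (hβ : β.degree ≤ D)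
    (hle : α ≤ β) :
    |tc α β (y - x) * co x β p| ≤
      2 ^ D * η ^ (β.degree - α.degree) * (M * δ ^ (s - α.degree)) := by
  have h1 := abs_tc_le α β (y - x)
  have h2 := hp β hβ
  have hd : dist y x = ‖y - x‖ := dist_eq_norm _ _
  rw [← hd] at h1
  have hαβ := degree_le_of_le hle
  have h3 : (2 : ℝ) ^ β.degree ≤ 2 ^ D := pow_le_pow_right₀ (by norm_num) hβ
  have h4 : dist y x ^ (β.degree - α.degree) ≤ (η * δ) ^ (β.degree - α.degree) :=
    pow_le_pow_left₀ dist_nonneg h _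
  have h5 : |tc α β (y - x)| ≤ 2 ^ D * (η * δ) ^ (β.degree - α.degree) :=
    h1.trans (mul_le_mul h3 h4 (by positivity) (by positivity))
  rw [abs_mul]
  refine (mul_le_mul h5 h2 (abs_nonneg _) ((abs_nonneg _).trans h5)).trans (le_of_eq ?_)
  have e : δ ^ (s - β.degree) * δ ^ (β.degree - α.degree) = δ ^ (s - (α.degree : ℝ)) := by
    apply rpow_mul_pow_eq hδ _ (sub_degree_pos (s := s) (hαβ.trans hβ)).ne'
    rw [Nat.cast_sub hαβ]; ring
  rw [mul_pow, ← e]; ring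

lemma Bd.shift [Ord D s] {M K δ : ℝ} {x y : Pt n} {p : J n D} (hp : Bd s M x δ p)
    (hM : 0 ≤ M) (hδ : 0 ≤ δ) (hK : 1 ≤ K) (h : dist x y ≤ K * δ) :
    Bd s (K0 n D * K ^ D * M) y δ p := by
  intro α hα
  rw [co_shift x y α p]
  rw [dist_comm] at h
  have hb : 0 ≤ M * δ ^ (s - (α.degree : ℝ)) := by positivity
  have hKD : 1 ≤ K ^ D := one_le_pow₀ hK
  calc |∑ β ∈ mset n D, tc α β (y - x) * co x β p|
      ≤ ∑ β ∈ mset n D, |tc α β (y - x) * co x β p| := Finset.abs_sum_le_sum_abs _ _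
    _ ≤ ∑ β ∈ mset n D, 4 ^ D * K ^ D * (M * δ ^ (s - (α.degree : ℝ))) := by
        refine Finset.sum_le_sum fun β hβ => ?_
        have hβ := mem_mset.1 hβ
        by_cases hle : α ≤ β
        · refine (abs_tc_mul_le hp hM hδ h hβ hle).trans (mul_le_mul_of_nonneg_right ?_ hb)
          refine mul_le_mul (pow_le_pow_left₀ (by norm_num) (by norm_num) _)
            (pow_le_pow_right₀ hK (by omega)) (by positivity) (by positivity)
        · rw [tc_eq_zero hle, zero_mul, abs_zero]; positivity
    _ = (mset n D).card * (4 ^ D * K ^ D * (M * δ ^ (s - (α.degree : ℝ)))) := by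
        rw [Finset.sum_const, nsmul_eq_mul]
    _ ≤ (mset n (2 * D)).card * (4 ^ D * K ^ D * (M * δ ^ (s - (α.degree : ℝ)))) :=
        mul_le_mul_of_nonneg_right (card_mset_le n D) (by positivity)
    _ = _ := by rw [K0]; ring

lemma Bd.abs_co_sub_le [Ord D s] {M η δ : ℝ} {x y : Pt n} {p : J n D} (hp : Bd s M x δ p)
    (hM : 0 ≤ M) (hδ : 0 ≤ δ) (hη : η ≤ 1) (h : dist x y ≤ η * δ) (hη0 : 0 ≤ η)
    {α : MI n} (hα : α.degree ≤ D) :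
    |co y α p - co x α p| ≤ K0 n D * η * M * δ ^ (s - (α.degree : ℝ)) := by
  rw [co_shift x y α p]
  rw [dist_comm] at h
  have hb : 0 ≤ M * δ ^ (s - (α.degree : ℝ)) := by positivity
  have e : ∑ β ∈ mset n D, tc α β (y - x) * co x β p - co x α p =
      ∑ β ∈ (mset n D).erase α, tc α β (y - x) * co x β p := by
    rw [← Finset.add_sum_erase _ _ (mem_mset.2 hα), tc_self]; ring
  rw [e]
  calc |∑ β ∈ (mset n D).erase α, tc α β (y - x) * co x β p|
      ≤ ∑ β ∈ (mset n D).erase α, |tc α β (y - x) * co x β p| := Finset.abs_sum_le_sum_abs _ _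
    _ ≤ ∑ β ∈ (mset n D).erase α, 4 ^ D * η * (M * δ ^ (s - (α.degree : ℝ))) := by
        refine Finset.sum_le_sum fun β hβ => ?_
        obtain ⟨hne, hβ⟩ := Finset.mem_erase.1 hβ
        have hβ := mem_mset.1 hβ
        by_cases hle : α ≤ β
        · refine (abs_tc_mul_le hp hM hδ h hβ hle).trans (mul_le_mul_of_nonneg_right ?_ hb)
          have hlt : α.degree < β.degree := by
            by_contra hh
            exact hne (eq_of_le_of_degree hle (by omega)).symm
          refine mul_le_mul (pow_le_pow_left₀ (by norm_num) (by norm_num) _)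
            ?_ (by positivity) (by positivity)
          calc η ^ (β.degree - α.degree) ≤ η ^ 1 := pow_le_pow_of_le_one hη0 hη (by omega)
            _ = η := pow_one _
        · rw [tc_eq_zero hle, zero_mul, abs_zero]; positivity
    _ = ((mset n D).erase α).card * (4 ^ D * η * (M * δ ^ (s - (α.degree : ℝ)))) := by
        rw [Finset.sum_const, nsmul_eq_mul]
    _ ≤ (mset n (2 * D)).card * (4 ^ D * η * (M * δ ^ (s - (α.degree : ℝ)))) := by
        refine mul_le_mul_of_nonneg_right ?_ (by positivity)
        refine le_trans ?_ (card_mset_le n D)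
        exact_mod_cast Finset.card_le_card (Finset.erase_subset _ _)
    _ = _ := by rw [K0]; ring

lemma card_antidiagonal_le {γ : MI n} (h : γ.degree ≤ 2 * D) :
    ((Finset.HasAntidiagonal.antidiagonal γ).card : ℝ) ≤ (mset n (2 * D)).card := by
  have : (Finset.HasAntidiagonal.antidiagonal γ).card ≤ (mset n (2 * D)).card := by
    apply Finset.card_le_card_of_injOn Prod.fst
    · intro b hb
      have e := Finset.HasAntidiagonal.mem_antidiagonal.1 (Finset.mem_coe.1 hb)
      have : b.1.degree + b.2.degree = γ.degree := by rw [← map_add, e]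
      exact Finset.mem_coe.2 (mem_mset.2 (by omega))
    · intro a ha b hb hab
      have e1 := Finset.HasAntidiagonal.mem_antidiagonal.1 (Finset.mem_coe.1 ha)
      have e2 := Finset.HasAntidiagonal.mem_antidiagonal.1 (Finset.mem_coe.1 hb)
      refine Prod.ext hab ?_
      rw [← e2, hab] at e1
      exact add_left_cancel e1
  exact_mod_cast this

lemma card_le_K0 (n D : ℕ) : ((mset n (2 * D)).card : ℝ) ≤ K0 n D := by
  have h2 : (1 : ℝ) ≤ 4 ^ D := one_le_pow₀ (by norm_num)
  unfold K0; nlinarith [Nat.cast_nonneg (α := ℝ) (mset n (2 * D)).card]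

lemma Bd.jmul [Ord D s] {M M' r ρ : ℝ} {x : Pt n} {p q : J n D} (hp : Bd s M x ρ p)
    (hq : Bd s M' x r q) (hM : 0 ≤ M) (hM' : 0 ≤ M') (hr : 0 ≤ r) (hρ : r ≤ ρ) :
    Bd s (K0 n D * M * M' * ρ ^ s) x r (jmul x p q) := by
  intro α hα
  rw [co_jmul x _ _ hα, mulCo]
  have hρ0 : 0 ≤ ρ := hr.trans hρ
  have hs := Ord.pos D s
  calc |∑ βγ ∈ Finset.HasAntidiagonal.antidiagonal α, co x βγ.1 p * co x βγ.2 q|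
      ≤ ∑ βγ ∈ Finset.HasAntidiagonal.antidiagonal α, |co x βγ.1 p * co x βγ.2 q| :=
        Finset.abs_sum_le_sum_abs _ _
    _ ≤ ∑ βγ ∈ Finset.HasAntidiagonal.antidiagonal α, M * M' * ρ ^ s * r ^ (s - (α.degree : ℝ)) := by
        refine Finset.sum_le_sum fun βγ hh => ?_
        obtain ⟨β, γ⟩ := βγ
        have e := Finset.HasAntidiagonal.mem_antidiagonal.1 hh
        have hd : β.degree + γ.degree = α.degree := by rw [← map_add, e]
        have h1 := hp β (by omega)
        have h2 := hq γ (by omega)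
        rw [abs_mul]
        refine (mul_le_mul h1 h2 (abs_nonneg _) (by positivity)).trans ?_
        have e1 : r ^ (s - (α.degree : ℝ)) * r ^ β.degree = r ^ (s - (γ.degree : ℝ)) := by
          apply rpow_mul_pow_eq hr _ (sub_degree_pos (D := D) (s := s) (by omega)).ne'
          rw [← hd]; push_cast; ring
        have e2 : ρ ^ (s - (β.degree : ℝ)) * ρ ^ β.degree = ρ ^ s :=
          rpow_mul_pow_eq hρ0 _ hs.ne' (by ring)
        rw [← e1, ← e2]
        have h3 : r ^ β.degree ≤ ρ ^ β.degree := pow_le_pow_left₀ hr hρ _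
        calc M * ρ ^ (s - (β.degree : ℝ)) * (M' * (r ^ (s - (α.degree : ℝ)) * r ^ β.degree))
            = (M * M' * ρ ^ (s - (β.degree : ℝ)) * r ^ (s - (α.degree : ℝ))) * r ^ β.degree := by
              ring
          _ ≤ (M * M' * ρ ^ (s - (β.degree : ℝ)) * r ^ (s - (α.degree : ℝ))) * ρ ^ β.degree :=
              mul_le_mul_of_nonneg_left h3 (by positivity)
          _ = _ := by ring
    _ = (Finset.HasAntidiagonal.antidiagonal α).card *
          (M * M' * ρ ^ s * r ^ (s - (α.degree : ℝ))) := by rw [Finset.sum_const, nsmul_eq_mul]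
    _ ≤ K0 n D * (M * M' * ρ ^ s * r ^ (s - (α.degree : ℝ))) := by
        refine mul_le_mul_of_nonneg_right ?_ (by positivity)
        exact (card_antidiagonal_le (by omega)).trans (card_le_K0 n D)
    _ = _ := by ring

lemma Bd.jmul_sub_jmul [Ord D s] {M M' ρ : ℝ} {z w : Pt n} {p q : J n D} (hp : Bd s M w ρ p)
    (hq : Bd s M' w ρ q) (hM : 0 ≤ M) (hM' : 0 ≤ M') (hρ : dist z w ≤ ρ) :
    Bd s (K0 n D * K0 n D * M * M' * ρ ^ s) z (dist z w) (FlatExt.jmul z p q - FlatExt.jmul w p q) := by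
  intro α hα
  rw [co_jmul_sub_jmul z w p q hα]
  set d := dist z w with hd
  have hd0 : 0 ≤ d := dist_nonneg
  have hρ0 : 0 ≤ ρ := hd0.trans hρ
  have hs := Ord.pos D s
  have hK := K0_pos n D
  rcases hd0.eq_or_lt with h0 | hdpos
  · have hzw : z - w = 0 := by rw [sub_eq_zero]; exact dist_eq_zero.1 (hd ▸ h0.symm)
    rw [Finset.sum_eq_zero]
    · rw [abs_zero]; positivity
    · intro γ hγ
      have h1 := abs_tc_le α γ (z - w)
      obtain ⟨_, hγ2⟩ := Finset.mem_sdiff.1 hγ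
      rw [mem_mset] at hγ2
      rw [hzw, norm_zero, zero_pow (by omega), mul_zero] at h1
      rw [hzw, abs_nonpos_iff.1 h1, zero_mul]
  have hρpos : 0 < ρ := hdpos.trans_le hρ
  have key : ∀ γ ∈ mset n (2 * D) \ mset n D, |tc α γ (z - w) * mulCo w p q γ| ≤
      4 ^ D * (K0 n D * M * M' * ρ ^ s * d ^ (s - (α.degree : ℝ))) := by
    intro γ hγ
    obtain ⟨hγ1, hγ2⟩ := Finset.mem_sdiff.1 hγ
    rw [mem_mset] at hγ1 hγ2
    have h1 := abs_tc_le α γ (z - w)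
    rw [← dist_eq_norm, ← hd] at h1
    have h2 : |mulCo w p q γ| ≤ K0 n D * (M * M' * ρ ^ (2 * s - γ.degree)) := by
      calc |mulCo w p q γ| ≤ ∑ βγ ∈ Finset.HasAntidiagonal.antidiagonal γ,
            |co w βγ.1 p * co w βγ.2 q| := Finset.abs_sum_le_sum_abs _ _
        _ ≤ ∑ βγ ∈ Finset.HasAntidiagonal.antidiagonal γ, M * M' * ρ ^ (2 * s - γ.degree) := by
          refine Finset.sum_le_sum fun βγ hh => ?_
          obtain ⟨β, β'⟩ := βγ
          have e := Finset.HasAntidiagonal.mem_antidiagonal.1 hh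
          have hdeg : β.degree + β'.degree = γ.degree := by rw [← map_add, e]
          dsimp only
          by_cases hb1 : D < β.degree
          · rw [co_eq_zero w hb1, zero_mul, abs_zero]; positivity
          by_cases hb2 : D < β'.degree
          · rw [co_eq_zero w hb2, mul_zero, abs_zero]; positivity
          rw [abs_mul]
          refine (mul_le_mul (hp β (by omega)) (hq β' (by omega)) (abs_nonneg _)
            (by positivity)).trans (le_of_eq ?_)
          have : ρ ^ (2 * s - (γ.degree : ℝ)) = ρ ^ (s - (β.degree : ℝ)) * ρ ^ (s - (β'.degree : ℝ)) := by
            rw [← Real.rpow_add hρpos, ← hdeg]; congr 1; push_cast; ring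
          rw [this]; ring
        _ = (Finset.HasAntidiagonal.antidiagonal γ).card * (M * M' * ρ ^ (2 * s - γ.degree)) := by
          rw [Finset.sum_const, nsmul_eq_mul]
        _ ≤ _ := mul_le_mul_of_nonneg_right ((card_antidiagonal_le hγ1).trans (card_le_K0 n D))
          (by positivity)
    have h3 : (2 : ℝ) ^ γ.degree ≤ 4 ^ D := by
      calc (2 : ℝ) ^ γ.degree ≤ 2 ^ (2 * D) := pow_le_pow_right₀ (by norm_num) hγ1
        _ = 4 ^ D := by rw [pow_mul]; norm_num
    have h4 : d ^ (γ.degree - α.degree) * ρ ^ (2 * s - γ.degree) ≤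
        ρ ^ s * d ^ (s - (α.degree : ℝ)) := by
      have hsγ : s ≤ γ.degree := by
        have : s ≤ (D : ℝ) + 1 := Ord.le
        have h' : ((D + 1 : ℕ) : ℝ) ≤ γ.degree := by exact_mod_cast (by omega)
        push_cast at h'; linarith
      have e1 : d ^ (γ.degree - α.degree) = d ^ (s - (α.degree : ℝ)) * d ^ ((γ.degree : ℝ) - s) := by
        rw [← Real.rpow_add hdpos, ← Real.rpow_natCast, Nat.cast_sub (by omega)]
        congr 1; ring
      have e2 : ρ ^ s = ρ ^ ((γ.degree : ℝ) - s) * ρ ^ (2 * s - γ.degree) := by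
        rw [← Real.rpow_add hρpos]; congr 1; ring
      rw [e1, e2]
      have : d ^ ((γ.degree : ℝ) - s) ≤ ρ ^ ((γ.degree : ℝ) - s) :=
        Real.rpow_le_rpow hd0 hρ (by linarith)
      calc _ = (d ^ (s - (α.degree : ℝ)) * ρ ^ (2 * s - γ.degree)) * d ^ ((γ.degree : ℝ) - s) := by
            ring
        _ ≤ (d ^ (s - (α.degree : ℝ)) * ρ ^ (2 * s - γ.degree)) * ρ ^ ((γ.degree : ℝ) - s) :=
            mul_le_mul_of_nonneg_left this (by positivity)
        _ = _ := by ring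
    rw [abs_mul]
    calc |tc α γ (z - w)| * |mulCo w p q γ|
        ≤ (2 ^ γ.degree * d ^ (γ.degree - α.degree)) *
            (K0 n D * (M * M' * ρ ^ (2 * s - γ.degree))) :=
          mul_le_mul h1 h2 (abs_nonneg _) (by positivity)
      _ = 2 ^ γ.degree * (K0 n D * M * M') * (d ^ (γ.degree - α.degree) * ρ ^ (2 * s - γ.degree)) := by
          ring
      _ ≤ 4 ^ D * (K0 n D * M * M') * (ρ ^ s * d ^ (s - (α.degree : ℝ))) := by
          refine mul_le_mul (mul_le_mul_of_nonneg_right h3 (by positivity)) h4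
            (by positivity) (by positivity)
      _ = _ := by ring
  calc _ ≤ ∑ γ ∈ mset n (2 * D) \ mset n D, |tc α γ (z - w) * mulCo w p q γ| :=
        Finset.abs_sum_le_sum_abs _ _
    _ ≤ ∑ γ ∈ mset n (2 * D) \ mset n D,
          4 ^ D * (K0 n D * M * M' * ρ ^ s * d ^ (s - (α.degree : ℝ))) := Finset.sum_le_sum key
    _ = (mset n (2 * D) \ mset n D).card *
          (4 ^ D * (K0 n D * M * M' * ρ ^ s * d ^ (s - (α.degree : ℝ)))) := by
        rw [Finset.sum_const, nsmul_eq_mul]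
    _ ≤ (mset n (2 * D)).card *
          (4 ^ D * (K0 n D * M * M' * ρ ^ s * d ^ (s - (α.degree : ℝ)))) := by
        refine mul_le_mul_of_nonneg_right ?_ (by positivity)
        exact_mod_cast Finset.card_le_card Finset.sdiff_subset
    _ = _ := by rw [K0]; ring

/-- A bounded field of polynomials at scale `ρ`. -/
def BF (s M ρ : ℝ) (S : Set (Pt n)) (P : Pt n → J n D) : Prop :=
  (∀ x ∈ S, Bd s M x ρ (P x)) ∧ ∀ x ∈ S, ∀ y ∈ S, Bd s M x (dist x y) (P x - P y)

lemma BF.mono {M M' ρ : ℝ} {S T : Set (Pt n)} {P : Pt n → J n D} (h : BF s M ρ S P)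
    (hρ : 0 ≤ ρ) (hM : M ≤ M') (hT : T ⊆ S) : BF s M' ρ T P :=
  ⟨fun x hx => (h.1 x (hT hx)).mono hρ hM,
    fun x hx y hy => (h.2 x (hT hx) y (hT hy)).mono dist_nonneg hM⟩

lemma BF.add {M M' ρ : ℝ} {S : Set (Pt n)} {P Q : Pt n → J n D} (h : BF s M ρ S P)
    (h' : BF s M' ρ S Q) : BF s (M + M') ρ S (fun x => P x + Q x) :=
  ⟨fun x hx => (h.1 x hx).add (h'.1 x hx), fun x hx y hy => by
    have := (h.2 x hx y hy).add (h'.2 x hx y hy)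
    rwa [show P x - P y + (Q x - Q y) = P x + Q x - (P y + Q y) by abel] at this⟩

lemma BF.smul {M ρ : ℝ} {S : Set (Pt n)} {P : Pt n → J n D} (h : BF s M ρ S P) (a : ℝ) :
    BF s (|a| * M) ρ S (fun x => a • P x) :=
  ⟨fun x hx => (h.1 x hx).smul a, fun x hx y hy => by
    have := (h.2 x hx y hy).smul a
    rwa [smul_sub] at this⟩

/-- A constant for products of bounded fields. -/
def K1 (n D : ℕ) : ℝ := 4 * K0 n D * K0 n D

lemma one_le_K1 (n D : ℕ) : 1 ≤ K1 n D := by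
  have := one_le_K0 n D
  unfold K1; nlinarith

lemma BF.jmul [Ord D s] {M M' ρ : ℝ} {S : Set (Pt n)} {P Q : Pt n → J n D} (h : BF s M ρ S P)
    (h' : BF s M' ρ S Q) (hM : 0 ≤ M) (hM' : 0 ≤ M') (hρ : 0 ≤ ρ) :
    BF s (K1 n D * M * M' * ρ ^ s) ρ S (fun x => FlatExt.jmul x (P x) (Q x)) := by
  have hK := one_le_K0 n D
  have hK2 : K0 n D ≤ K0 n D * K0 n D := by nlinarith
  have hX : 0 ≤ M * M' * ρ ^ s := by positivity
  have hb : ∀ x ∈ S, Bd s (K0 n D * M * M' * ρ ^ s) x ρ (FlatExt.jmul x (P x) (Q x)) :=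
    fun x hx => (h.1 x hx).jmul (h'.1 x hx) hM hM' hρ le_rfl
  refine ⟨fun x hx => (hb x hx).mono hρ ?_, fun x hx y hy => ?_⟩
  · unfold K1; nlinarith
  have hd0 : 0 ≤ dist x y := dist_nonneg
  by_cases hd : ρ ≤ dist x y
  · have h1 := (hb x hx).mono_scale (by positivity) hρ hd
    have h2 := ((hb y hy).mono_scale (by positivity) hρ hd).shift (K := 1) (y := x) (by positivity) hd0
      le_rfl (by rw [dist_comm]; linarith)
    refine (h1.sub h2).mono hd0 ?_
    unfold K1; rw [one_pow]; nlinarith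
  · push Not at hd
    have h1 := (h'.1 x hx).jmul (h.2 x hx y hy) hM' hM hd0 hd.le
    have h3 : Bd s (K0 n D * M) x ρ (P y) := by
      simpa using (h.1 y hy).shift (K := 1) (y := x) hM hρ le_rfl (by rw [dist_comm]; linarith)
    have h2 := h3.jmul (h'.2 x hx y hy) (by positivity) hM' hd0 hd.le
    have h4 := (h.1 y hy).jmul_sub_jmul (z := x) (h'.1 y hy) hM hM' hd.le
    have hh := ((h1.add h2).add h4).mono (M' := K1 n D * M * M' * ρ ^ s) hd0 (by
      have := mul_le_mul_of_nonneg_right hK2 hX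
      unfold K1; nlinarith)
    · have e : FlatExt.jmul x (Q x) (P x - P y) + FlatExt.jmul x (P y) (Q x - Q y) +
          (FlatExt.jmul x (P y) (Q y) - FlatExt.jmul y (P y) (Q y)) =
          FlatExt.jmul x (P x) (Q x) - FlatExt.jmul y (P y) (Q y) := by
        rw [jmul_comm x (Q x), jmul_sub_left, jmul_sub_right]; abel
      rwa [e] at hh

/-- Standard basis vectors. -/
def ev (i : Fin n) : Pt n := EuclideanSpace.single i 1

/-- Coordinate functionals. -/
def prj (i : Fin n) : Pt n →L[ℝ] ℝ := EuclideanSpace.proj i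

lemma prj_apply (i : Fin n) (v : Pt n) : prj i v = v i := rfl

lemma norm_ev (i : Fin n) : ‖ev i‖ = 1 := by simp [ev]

lemma norm_prj_le (i : Fin n) : ‖(prj i : Pt n →L[ℝ] ℝ)‖ ≤ 1 := by
  refine ContinuousLinearMap.opNorm_le_bound _ zero_le_one fun v => ?_
  rw [one_mul, prj_apply, Real.norm_eq_abs]; exact abs_coord_le v i

lemma sum_coord_smul_ev (v : Pt n) : ∑ i, v i • ev i = v := by
  ext j
  simp only [ev, WithLp.ofLp_sum, WithLp.ofLp_smul, EuclideanSpace.single, Finset.sum_apply, Pi.smul_apply,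
    smul_eq_mul]
  simp [Pi.single_apply]

lemma clm_eq_sum (L : Pt n →L[ℝ] ℝ) : L = ∑ i, L (ev i) • prj i := by
  ext v
  conv_lhs => rw [← sum_coord_smul_ev v]
  simp [prj_apply, mul_comm]

/-- A system of functions which are formally the Taylor coefficients of a single function. -/
def IsJS (D : ℕ) (a : MI n → Pt n → ℝ) : Prop :=
  ∀ α : MI n, α.degree < D → ∀ x,
    HasFDerivAt (a α) (∑ i, ((α i + 1 : ℝ) * a (α + Finsupp.single i 1) x) • prj i) x

lemma hasFDerivAt_tc_sub (α β : MI n) (z : Pt n) :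
    HasFDerivAt (fun y => tc α β (y - z))
      (∑ i, (if β = α + Finsupp.single i 1 then (α i + 1 : ℝ) else 0) • prj i) z := by
  classical
  by_cases hle : α ≤ β
  · rcases lt_trichotomy β.degree (α.degree + 1) with h | h | h
    · have := eq_of_le_of_degree hle (by omega)
      subst this
      simp only [tc_self]
      rw [Finset.sum_eq_zero]
      · exact hasFDerivAt_const _ _
      · intro i _
        rw [if_neg, zero_smul]
        intro hh
        have := congrArg Finsupp.degree hh
        rw [degree_add_single] at this; omega
    · obtain ⟨i, rfl⟩ := exists_add_single hle h
      simp only [tc_add_single]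
      have e : (∑ j, (if α + Finsupp.single i 1 = α + Finsupp.single j 1 then (α j + 1 : ℝ) else 0) •
          (prj j : Pt n →L[ℝ] ℝ)) = (α i + 1 : ℝ) • prj i := by
        rw [Finset.sum_eq_single i]
        · simp
        · intro j _ hj
          rw [if_neg, zero_smul]
          intro hh
          have := add_left_cancel hh
          exact hj ((Finsupp.single_left_inj one_ne_zero).1 this).symm
        · simp
      rw [e]
      have h1 : HasFDerivAt (fun y : Pt n => (y - z) i) (prj i) z :=
        (prj i).hasFDerivAt.comp z ((hasFDerivAt_id z).sub_const z)
      exact h1.const_mul _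
    · rw [Finset.sum_eq_zero]
      · rw [hasFDerivAt_iff_isLittleO_nhds_zero]
        have h0 : tc α β (z - z) = 0 := by
          have := abs_tc_le α β (z - z)
          rw [sub_self, norm_zero, zero_pow (by omega), mul_zero] at this
          rw [sub_self]; exact abs_nonpos_iff.1 this
        simp only [h0, sub_zero, add_sub_cancel_left, zero_apply]
        have h1 : (fun v : Pt n => tc α β v) =O[nhds 0] fun v => ‖v‖ ^ (β.degree - α.degree) := by
          refine Asymptotics.IsBigO.of_bound (2 ^ β.degree) (Filter.Eventually.of_forall fun v => ?_)
          rw [Real.norm_eq_abs, norm_pow, norm_norm]; exact abs_tc_le α β v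
        refine h1.trans_isLittleO ?_
        exact Asymptotics.isLittleO_norm_pow_id (by omega)
      · intro i _
        rw [if_neg, zero_smul]
        intro hh
        have := congrArg Finsupp.degree hh
        rw [degree_add_single] at this; omega
  · simp only [tc_eq_zero hle]
    rw [Finset.sum_eq_zero]
    · exact hasFDerivAt_const _ _
    · intro i _
      rw [if_neg, zero_smul]
      rintro rfl
      exact hle le_self_add

/-- The Taylor coefficients of a polynomial form a jet system. -/
lemma isJS_co (p : J n D) : IsJS D (fun α x => co x α p) := by
  classical
  intro α hα z
  have h1 : HasFDerivAt (fun y => ∑ β ∈ mset n D, tc α β (y - z) * co z β p)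
      (∑ β ∈ mset n D, co z β p •
        (∑ i, (if β = α + Finsupp.single i 1 then (α i + 1 : ℝ) else 0) • (prj i : Pt n →L[ℝ] ℝ))) z :=
    HasFDerivAt.fun_sum fun β _ => (hasFDerivAt_tc_sub α β z).mul_const _
  have e : (fun y => ∑ β ∈ mset n D, tc α β (y - z) * co z β p) = fun y => co y α p := by
    funext y; rw [co_shift z y]
  rw [e] at h1
  convert! h1 using 1
  simp_rw [Finset.smul_sum]
  rw [Finset.sum_comm]
  refine Finset.sum_congr rfl fun i _ => ?_
  rw [Finset.sum_eq_single (α + Finsupp.single i 1)]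
  · rw [if_pos rfl, smul_smul, mul_comm]
  · intro β _ hβ
    rw [if_neg hβ, zero_smul, smul_zero]
  · intro hh
    exfalso; apply hh; rw [mem_mset, degree_add_single]; omega

/-- The field of Taylor polynomials of a jet system. -/
def jsField (D : ℕ) (a : MI n → Pt n → ℝ) (x : Pt n) : J n D := ofCo x (fun α => a α x)

lemma co_jsField (a : MI n → Pt n → ℝ) (x : Pt n) {α : MI n} (h : α.degree ≤ D) :
    co x α (jsField D a x) = a α x := co_ofCo x _ h

/-- A constant in Taylor's theorem. -/
def KT (n D : ℕ) : ℝ := n * (D + 1) + 1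

lemma one_le_KT (n D : ℕ) : 1 ≤ KT n D := by unfold KT; nlinarith [Nat.cast_nonneg (α := ℝ) n, Nat.cast_nonneg (α := ℝ) D]

/-- Taylor's theorem for jet systems. -/
lemma IsJS.bd_sub [Ord D s] {a : MI n → Pt n → ℝ} (ha : IsJS D a) {H : ℝ} (hH : 0 ≤ H)
    (htop : ∀ α : MI n, α.degree = D → ∀ x y, |a α x - a α y| ≤ H * dist x y ^ (s - D))
    (x y : Pt n) : Bd s (KT n D ^ D * H) x (dist x y) (jsField D a x - jsField D a y) := by
  classical
  have hT := one_le_KT n D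
  have main : ∀ j : ℕ, ∀ α : MI n, α.degree + j = D → ∀ z,
      |a α z - co z α (jsField D a y)| ≤ KT n D ^ j * H * dist z y ^ (s - (α.degree : ℝ)) := by
    intro j
    induction j with
    | zero =>
      intro α hα z
      have e : co z α (jsField D a y) = a α y := by
        rw [co_shift y z, Finset.sum_eq_single α, tc_self, co_jsField _ _ (by omega), one_mul]
        · intro β hβ hne
          rw [tc_eq_zero, zero_mul]
          intro hle
          exact hne (eq_of_le_of_degree hle (by have := mem_mset.1 hβ; omega)).symm
        · intro hh; exact absurd (mem_mset.2 (by omega)) hh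
      rw [e, pow_zero, one_mul]
      have : α.degree = D := by omega
      rw [this]; exact htop α this z y
    | succ j ih =>
      intro α hα z
      set d := dist z y with hd
      have hd0 : 0 ≤ d := dist_nonneg
      let g : Pt n → ℝ := fun w => a α w - co w α (jsField D a y)
      let g' : Pt n → Pt n →L[ℝ] ℝ := fun w => ∑ i, ((α i + 1 : ℝ) *
        (a (α + Finsupp.single i 1) w - co w (α + Finsupp.single i 1) (jsField D a y))) • prj i
      have hg : ∀ w, HasFDerivAt g (g' w) w := by
        intro w
        have := (ha α (by omega) w).sub (isJS_co (jsField D a y) α (by omega) w)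
        convert! this using 1
        rw [← Finset.sum_sub_distrib]
        exact Finset.sum_congr rfl fun i _ => by rw [← sub_smul, mul_sub]
      have hsub : 0 ≤ s - ((α.degree + 1 : ℕ) : ℝ) := (sub_degree_pos (D := D) (s := s) (by omega)).le
      have hbound : ∀ w ∈ Metric.closedBall y d, ‖g' w‖ ≤
          (n * (D + 1)) * (KT n D ^ j * H * d ^ (s - ((α.degree + 1 : ℕ) : ℝ))) := by
        intro w hw
        have hb : ∀ i : Fin n, ‖((α i + 1 : ℝ) * (a (α + Finsupp.single i 1) w -
            co w (α + Finsupp.single i 1) (jsField D a y))) • (prj i : Pt n →L[ℝ] ℝ)‖ ≤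
            (D + 1) * (KT n D ^ j * H * d ^ (s - ((α.degree + 1 : ℕ) : ℝ))) := by
          intro i
          rw [norm_smul, norm_mul, Real.norm_eq_abs, Real.norm_eq_abs]
          have h1 := ih (α + Finsupp.single i 1) (by rw [degree_add_single]; omega) w
          rw [degree_add_single] at h1
          have h2 : dist w y ^ (s - ((α.degree + 1 : ℕ) : ℝ)) ≤ d ^ (s - ((α.degree + 1 : ℕ) : ℝ)) :=
            Real.rpow_le_rpow dist_nonneg (Metric.mem_closedBall.1 hw) hsub
          have h3 := h1.trans (mul_le_mul_of_nonneg_left h2 (by positivity))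
          have h4 : |(α i + 1 : ℝ)| ≤ D + 1 := by
            rw [abs_of_nonneg (by positivity)]
            have : α i ≤ D := (Finsupp.le_degree i α).trans (by omega)
            have : (α i : ℝ) ≤ D := by exact_mod_cast this
            linarith
          calc _ ≤ ((D + 1 : ℝ) * (KT n D ^ j * H * d ^ (s - ((α.degree + 1 : ℕ) : ℝ)))) * 1 := by
                refine mul_le_mul (mul_le_mul h4 h3 (abs_nonneg _) (by positivity))
                  (norm_prj_le i) (norm_nonneg _) (by positivity)
            _ = _ := mul_one _
        refine (norm_sum_le _ _).trans ((Finset.sum_le_sum fun i _ => hb i).trans (le_of_eq ?_))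
        rw [Finset.sum_const, nsmul_eq_mul, Finset.card_univ, Fintype.card_fin]; ring
      have hmv := Convex.norm_image_sub_le_of_norm_hasFDerivWithin_le (𝕜 := ℝ) (s := Metric.closedBall y d)
        (fun w _ => (hg w).hasFDerivWithinAt) hbound (convex_closedBall y d)
        (Metric.mem_closedBall_self hd0) (Metric.mem_closedBall.2 (le_of_eq hd.symm))
      have hgy : g y = 0 := by
        change a α y - co y α (jsField D a y) = 0
        rw [co_jsField _ _ (by omega), sub_self]
      rw [hgy, sub_zero, Real.norm_eq_abs, ← dist_eq_norm, ← hd] at hmv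
      refine hmv.trans ?_
      have e : d ^ (s - ((α.degree + 1 : ℕ) : ℝ)) * d = d ^ (s - (α.degree : ℝ)) := by
        have := rpow_mul_pow_eq (a := s - ((α.degree + 1 : ℕ) : ℝ)) (b := s - (α.degree : ℝ)) hd0 1
          (sub_degree_pos (D := D) (s := s) (by omega)).ne' (by push_cast; ring)
        rwa [pow_one] at this
      rw [← e, pow_succ]
      have hp : 0 ≤ KT n D ^ j * H * (d ^ (s - ((α.degree + 1 : ℕ) : ℝ)) * d) := by positivity
      have h5 : (n * (D + 1) : ℝ) ≤ KT n D := by unfold KT; linarith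
      calc _ = (n * (D + 1) : ℝ) * (KT n D ^ j * H * (d ^ (s - ((α.degree + 1 : ℕ) : ℝ)) * d)) := by ring
        _ ≤ KT n D * (KT n D ^ j * H * (d ^ (s - ((α.degree + 1 : ℕ) : ℝ)) * d)) :=
            mul_le_mul_of_nonneg_right h5 hp
        _ = _ := by ring
  intro α hα
  rw [map_sub, co_jsField _ _ hα]
  refine (main (D - α.degree) α (by omega) x).trans ?_
  refine mul_le_mul_of_nonneg_right (mul_le_mul_of_nonneg_right ?_ hH) (by positivity)
  exact pow_le_pow_right₀ hT (by omega)

lemma IsJS.bf [Ord D s] {a : MI n → Pt n → ℝ} (ha : IsJS D a) {H ρ : ℝ} (hH : 0 ≤ H) (hρ : 0 ≤ ρ)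
    (hb : ∀ α : MI n, α.degree ≤ D → ∀ x, |a α x| ≤ H * ρ ^ (s - α.degree))
    (htop : ∀ α : MI n, α.degree = D → ∀ x y, |a α x - a α y| ≤ H * dist x y ^ (s - D)) :
    BF s (KT n D ^ D * H) ρ univ (jsField D a) := by
  refine ⟨fun x _ α hα => ?_, fun x _ y _ => ha.bd_sub hH htop x y⟩
  rw [co_jsField _ _ hα]
  refine (hb α hα x).trans (mul_le_mul_of_nonneg_right ?_ (by positivity))
  have := one_le_pow₀ (one_le_KT n D) (n := D)
  nlinarith

/-- Iterated partial derivatives. -/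
def pd : List (Fin n) → (Pt n → ℝ) → Pt n → ℝ
  | [], F => F
  | i :: w, F => fun x => fderiv ℝ (pd w F) x (ev i)

lemma contDiff_pd (F : Pt n → ℝ) (w : List (Fin n)) :
    ∀ k : ℕ, ContDiff ℝ ((k + w.length : ℕ) : ℕ∞) F → ContDiff ℝ (k : ℕ∞) (pd w F) := by
  induction w with
  | nil => intro k h; exact h
  | cons i w ih =>
    intro k h
    have h1 : ContDiff ℝ ((k + 1 : ℕ) : ℕ∞) (pd w F) := by
      apply ih
      have e : k + 1 + w.length = k + (i :: w).length := by simp only [List.length_cons]; omega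
      rw [e]; exact h
    have h2 : ContDiff ℝ (k : ℕ∞) (fderiv ℝ (pd w F)) := by
      apply h1.fderiv_right
      push_cast; exact le_rfl
    exact h2.clm_apply contDiff_const

lemma pd_perm (F : Pt n → ℝ) {w w' : List (Fin n)} (h : w.Perm w')
    (hF : ContDiff ℝ (w.length : ℕ∞) F) : pd w F = pd w' F := by
  induction h with
  | nil => rfl
  | cons i h ih =>
    have := ih (hF.of_le (by simp))
    simp only [pd, this]
  | @swap i j l =>
    have h2 : ContDiff ℝ ((2 : ℕ) : ℕ∞) (pd l F) := by
      apply contDiff_pd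
      convert hF using 4
      simp; ring
    funext x
    simp only [pd]
    have hsym := (h2.contDiffAt (x := x)).isSymmSndFDerivAt (by simp)
    have hd : DifferentiableAt ℝ (fderiv ℝ (pd l F)) x := by
      have : ContDiff ℝ ((1 : ℕ) : ℕ∞) (fderiv ℝ (pd l F)) := h2.fderiv_right (by norm_cast)
      exact (this.differentiable (by simp)).differentiableAt
    have e : ∀ k : Fin n, fderiv ℝ (fun x => fderiv ℝ (pd l F) x (ev k)) x =
        (fderiv ℝ (fderiv ℝ (pd l F)) x).flip (ev k) := by
      intro k
      ext v
      rw [fderiv_clm_apply hd (differentiableAt_const _)]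
      simp
    rw [e, e]
    exact hsym _ _
  | trans h1 h2 ih1 ih2 =>
    rw [ih1 hF, ih2 (by rw [← h1.length_eq]; exact hF)]

lemma iteratedFDeriv_ev (F : Pt n → ℝ) : ∀ (m : ℕ) (w : Fin m → Fin n),
    ContDiff ℝ (m : ℕ∞) F → ∀ x,
    iteratedFDeriv ℝ m F x (fun k => ev (w k)) = pd (List.ofFn w) F x := by
  intro m
  induction m with
  | zero => intro w _ x; simp [pd]
  | succ m ih =>
    intro w hF x
    rw [iteratedFDeriv_succ_apply_left, List.ofFn_succ]
    simp only [pd]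
    have e : pd (List.ofFn fun i => w i.succ) F = fun y => iteratedFDeriv ℝ m F y
        (fun k => ev (w k.succ)) := by
      funext y
      rw [ih (fun k => w k.succ) (hF.of_le (by norm_cast; omega)) y]
    have hd : DifferentiableAt ℝ (iteratedFDeriv ℝ m F) x := by
      apply (hF.differentiable_iteratedFDeriv (by norm_cast; omega)).differentiableAt
    rw [e, fderiv_continuousMultilinear_apply_const hd]
    rfl

/-- Multi-index factorial. -/
def fac (α : MI n) : ℝ := ∏ i, ((α i).factorial : ℝ)

lemma one_le_fac (α : MI n) : 1 ≤ fac α := by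
  have : (1 : ℝ) = ∏ _i : Fin n, 1 := by simp
  rw [fac, this]
  exact Finset.prod_le_prod (fun _ _ => zero_le_one)
    fun i _ => by exact_mod_cast Nat.factorial_pos _

lemma fac_add_single (α : MI n) (i : Fin n) :
    fac (α + Finsupp.single i 1) = (α i + 1) * fac α := by
  classical
  rw [fac, fac, ← Finset.mul_prod_erase _ _ (Finset.mem_univ i),
    ← Finset.mul_prod_erase _ (fun j => ((α j).factorial : ℝ)) (Finset.mem_univ i), ← mul_assoc]
  congr 1
  · simp [Nat.factorial_succ]
  · refine Finset.prod_congr rfl fun j hj => ?_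
    have := Finset.ne_of_mem_erase hj
    simp [Ne.symm this]

/-- The word of a multi-index. -/
def wd (α : MI n) : List (Fin n) := (Finsupp.toMultiset α).toList

lemma length_wd (α : MI n) : (wd α).length = α.degree := by
  simp [wd, Finsupp.card_toMultiset, Finsupp.degree_eq_sum, Finsupp.sum_fintype]

lemma wd_add_single (α : MI n) (i : Fin n) : (wd (α + Finsupp.single i 1)).Perm (i :: wd α) := by
  rw [← Multiset.coe_eq_coe, ← Multiset.cons_coe]
  simp only [wd, Multiset.coe_toList]
  rw [map_add, Finsupp.toMultiset_single, one_smul, add_comm, Multiset.singleton_add]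

/-- The jet system of a function. -/
def jsOf (F : Pt n → ℝ) (α : MI n) (x : Pt n) : ℝ := pd (wd α) F x / fac α

lemma wd_zero : wd (0 : MI n) = [] := by simp [wd]

lemma jsOf_zero (F : Pt n → ℝ) (x : Pt n) : jsOf F 0 x = F x := by
  simp [jsOf, fac, wd_zero, pd]

lemma isJS_jsOf {F : Pt n → ℝ} (hF : ContDiff ℝ (D : ℕ∞) F) : IsJS D (jsOf F) := by
  intro α hα x
  have h1 : ContDiff ℝ ((1 : ℕ) : ℕ∞) (pd (wd α) F) :=
    contDiff_pd F _ 1 (hF.of_le (by rw [length_wd]; norm_cast; omega))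
  have h2 : DifferentiableAt ℝ (pd (wd α) F) x := (h1.differentiable (by simp)).differentiableAt
  have hf := one_le_fac α
  have h3 := h2.hasFDerivAt.mul_const (fac α)⁻¹
  convert! h3 using 1
  rw [clm_eq_sum (fderiv ℝ (pd (wd α) F) x), Finset.smul_sum]
  refine Finset.sum_congr rfl fun i _ => ?_
  rw [smul_smul]
  congr 1
  rw [jsOf, fac_add_single, pd_perm F (wd_add_single α i)]
  · simp only [pd]
    have : (α i + 1 : ℝ) ≠ 0 := by positivity
    field_simp
  · refine hF.of_le ?_
    rw [length_wd, degree_add_single]; norm_cast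

lemma abs_pd_le (F : Pt n → ℝ) (w : List (Fin n)) (hF : ContDiff ℝ (w.length : ℕ∞) F) (x : Pt n) :
    |pd w F x| ≤ ‖iteratedFDeriv ℝ w.length F x‖ := by
  have := iteratedFDeriv_ev F w.length w.get hF x
  rw [List.ofFn_get] at this
  rw [← this, ← Real.norm_eq_abs]
  refine (ContinuousMultilinearMap.le_opNorm _ _).trans (le_of_eq ?_)
  simp [norm_ev]

lemma abs_jsOf_le {F : Pt n → ℝ} (α : MI n) (hF : ContDiff ℝ (α.degree : ℕ∞) F) (x : Pt n) :
    |jsOf F α x| ≤ ‖iteratedFDeriv ℝ α.degree F x‖ := by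
  have h1 := abs_pd_le F (wd α) (by rwa [length_wd]) x
  rw [length_wd] at h1
  have hf := one_le_fac α
  rw [jsOf, abs_div, abs_of_pos (by linarith : 0 < fac α)]
  exact (div_le_self (abs_nonneg _) hf).trans h1

lemma abs_jsOf_sub_le {F : Pt n → ℝ} (α : MI n) (hF : ContDiff ℝ (α.degree : ℕ∞) F) (x y : Pt n) :
    |jsOf F α x - jsOf F α y| ≤
      ‖iteratedFDeriv ℝ α.degree F x - iteratedFDeriv ℝ α.degree F y‖ := by
  have key : |pd (wd α) F x - pd (wd α) F y| ≤
      ‖iteratedFDeriv ℝ (wd α).length F x - iteratedFDeriv ℝ (wd α).length F y‖ := by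
    have hF' : ContDiff ℝ ((wd α).length : ℕ∞) F := by rwa [length_wd]
    have h1 := iteratedFDeriv_ev F (wd α).length (wd α).get hF'
    rw [List.ofFn_get] at h1
    rw [← h1, ← h1, ← Real.norm_eq_abs, ← sub_apply]
    refine (ContinuousMultilinearMap.le_opNorm _ _).trans (le_of_eq ?_)
    simp [norm_ev]
  rw [length_wd] at key
  have hf := one_le_fac α
  rw [jsOf, jsOf, ← sub_div, abs_div, abs_of_pos (by linarith : 0 < fac α)]
  exact (div_le_self (abs_nonneg _) hf).trans key

lemma co_top (x y : Pt n) {α : MI n} (hα : α.degree = D) (p : J n D) : co y α p = co x α p := by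
  rw [co_shift x y, Finset.sum_eq_single α, tc_self, one_mul]
  · intro β hβ hne
    rw [tc_eq_zero, zero_mul]
    intro hle
    exact hne (eq_of_le_of_degree hle (by have := mem_mset.1 hβ; omega)).symm
  · intro hh; exact absurd (mem_mset.2 (by omega)) hh

lemma abs_co_sub_le_of_field {M : ℝ} {P : Pt n → J n D}
    (h : ∀ x y, Bd s M x (dist x y) (P x - P y)) {α : MI n} (hα : α.degree = D) (x y : Pt n) :
    |co x α (P x) - co y α (P y)| ≤ M * dist x y ^ (s - D) := by
  have := h x y α hα.le
  rwa [map_sub, co_top y x hα (P y), hα] at this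

lemma isJS_of_field [Ord D s] {M : ℝ} {P : Pt n → J n D}
    (h : ∀ x y, Bd s M x (dist x y) (P x - P y)) : IsJS D (fun α x => co x α (P x)) := by
  intro α hα x
  have h1 := isJS_co (P x) α hα x
  have h2 : HasFDerivAt (fun y => co y α (P y - P x)) (0 : Pt n →L[ℝ] ℝ) x := by
    rw [hasFDerivAt_iff_isLittleO]
    have hO : (fun y => co y α (P y - P x)) =O[nhds x] fun y => ‖y - x‖ ^ (s - (α.degree : ℝ)) := by
      refine Asymptotics.IsBigO.of_bound M (Filter.Eventually.of_forall fun y => ?_)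
      rw [Real.norm_eq_abs, Real.norm_eq_abs, abs_of_nonneg (by positivity : 0 ≤ ‖y - x‖ ^ (s - (α.degree : ℝ))),
        ← dist_eq_norm]
      exact h y x α hα.le
    have hpos : 0 < s - (α.degree : ℝ) - 1 := by
      have := sub_degree_pos (D := D) (s := s) (k := α.degree + 1) (by omega)
      push_cast at this; linarith
    have ho : (fun y : Pt n => ‖y - x‖ ^ (s - (α.degree : ℝ))) =o[nhds x] fun y => y - x := by
      have e : ∀ y : Pt n, ‖y - x‖ ^ (s - (α.degree : ℝ)) = ‖y - x‖ ^ (s - (α.degree : ℝ) - 1) * ‖y - x‖ := by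
        intro y
        have := rpow_mul_pow_eq (a := s - (α.degree : ℝ) - 1) (b := s - (α.degree : ℝ)) (norm_nonneg (y - x)) 1
          (by linarith) (by push_cast; ring)
        rw [pow_one] at this; exact this.symm
      simp_rw [e]
      rw [← Asymptotics.isLittleO_norm_right]
      have : (fun y : Pt n => ‖y - x‖ ^ (s - (α.degree : ℝ) - 1)) =o[nhds x] fun _ => (1 : ℝ) := by
        rw [Asymptotics.isLittleO_one_iff]
        have hc : ContinuousAt (fun y : Pt n => ‖y - x‖ ^ (s - (α.degree : ℝ) - 1)) x := by
          apply ContinuousAt.rpow_const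
          · fun_prop
          · right; exact hpos.le
        have := hc.tendsto
        simpa [Real.zero_rpow hpos.ne'] using this
      simpa using this.mul_isBigO (Asymptotics.isBigO_refl (fun y : Pt n => ‖y - x‖) (nhds x))
    simpa using hO.trans_isLittleO ho
  have h3 := h1.add h2
  rw [add_zero] at h3
  convert! h3 using 1
  funext y
  simp

lemma IsJS.contDiff {a : MI n → Pt n → ℝ} (ha : IsJS D a)
    (hc : ∀ α : MI n, α.degree = D → Continuous (a α)) :
    ∀ (j : ℕ) (α : MI n), α.degree + j = D → ContDiff ℝ (j : ℕ∞) (a α) := by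
  intro j
  induction j with
  | zero => intro α hα; exact contDiff_zero.2 (hc α (by omega))
  | succ j ih =>
    intro α hα
    have := (contDiff_succ_iff_hasFDerivAt (𝕜 := ℝ) (f := a α) (n := j)).2
      ⟨_, ?_, fun x => ha α (by omega) x⟩
    · exact_mod_cast this
    · refine ContDiff.sum fun i _ => ?_
      have h1 : ContDiff ℝ (j : ℕ∞) (a (α + Finsupp.single i 1)) :=
        ih _ (by rw [degree_add_single]; omega)
      exact (contDiff_const.mul h1).smul contDiff_const

/-- The multi-index of a word. -/
def cnt : List (Fin n) → MI n
  | [] => 0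
  | i :: w => cnt w + Finsupp.single i 1

lemma degree_cnt (w : List (Fin n)) : (cnt w).degree = w.length := by
  induction w with
  | nil => simp [cnt]
  | cons i w ih => rw [cnt, degree_add_single, ih]; rfl

lemma IsJS.pd_eq {a : MI n → Pt n → ℝ} (ha : IsJS D a) (w : List (Fin n)) (hw : w.length ≤ D) :
    pd w (a 0) = fun x => fac (cnt w) * a (cnt w) x := by
  induction w with
  | nil => funext x; simp [pd, cnt, fac]
  | cons i w ih =>
    simp only [List.length_cons] at hw
    funext x
    rw [pd, ih (by omega)]
    have h1 := (ha (cnt w) (by rw [degree_cnt]; omega) x).const_mul (fac (cnt w))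
    beta_reduce
    rw [h1.fderiv, cnt, fac_add_single]
    simp only [smul_apply, sum_apply, prj_apply, ev,
      smul_eq_mul]
    rw [Finset.sum_eq_single i]
    · simp; ring
    · intro j _ hj; simp [hj]
    · simp

lemma norm_multilinear_le (m : ℕ) (G : ContinuousMultilinearMap ℝ (fun _ : Fin m => Pt n) ℝ) :
    ‖G‖ ≤ ∑ w : Fin m → Fin n, |G fun k => ev (w k)| := by
  refine ContinuousMultilinearMap.opNorm_le_bound (by positivity) fun v => ?_
  have e : G v = ∑ w : Fin m → Fin n, (∏ k, v k (w k)) * G fun k => ev (w k) := by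
    conv_lhs => rw [show v = fun k => ∑ i, v k i • ev i from funext fun k => (sum_coord_smul_ev (v k)).symm]
    rw [ContinuousMultilinearMap.map_sum]
    refine Finset.sum_congr rfl fun w _ => ?_
    exact G.map_smul_univ (fun k => v k (w k)) (fun k => ev (w k))
  rw [e, Finset.sum_mul, Real.norm_eq_abs]
  refine (Finset.abs_sum_le_sum_abs _ _).trans (Finset.sum_le_sum fun w _ => ?_)
  rw [abs_mul, mul_comm, Finset.abs_prod]
  exact mul_le_mul_of_nonneg_left (Finset.prod_le_prod (fun _ _ => abs_nonneg _)
    fun k _ => abs_coord_le _ _) (abs_nonneg _)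

/-- A constant comparing derivatives with Taylor coefficients. -/
def KD (n D : ℕ) : ℝ := (n + 1) ^ D * (D.factorial : ℝ) ^ n

lemma KD_pos (n D : ℕ) : 0 < KD n D := by unfold KD; positivity

lemma fac_le {α : MI n} (h : α.degree ≤ D) : fac α ≤ (D.factorial : ℝ) ^ n := by
  have : (D.factorial : ℝ) ^ n = ∏ _i : Fin n, (D.factorial : ℝ) := by simp
  rw [this]
  refine Finset.prod_le_prod (fun _ _ => by positivity) fun i _ => ?_
  exact_mod_cast Nat.factorial_le ((Finsupp.le_degree i α).trans h)

lemma sum_words_le (m : ℕ) (hm : m ≤ D) (b : MI n → ℝ) {B : ℝ}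
    (hB0 : 0 ≤ B) (hB : ∀ α : MI n, α.degree = m → |b α| ≤ B) :
    ∑ w : Fin m → Fin n, |fac (cnt (List.ofFn w)) * b (cnt (List.ofFn w))| ≤ KD n D * B := by
  calc _ ≤ ∑ w : Fin m → Fin n, (D.factorial : ℝ) ^ n * B := by
        refine Finset.sum_le_sum fun w _ => ?_
        have hd : (cnt (List.ofFn w)).degree = m := by rw [degree_cnt]; simp
        rw [abs_mul, abs_of_nonneg (by linarith [one_le_fac (cnt (List.ofFn w))])]
        exact mul_le_mul (fac_le (by omega)) (hB _ hd) (abs_nonneg _) (by positivity)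
    _ = (n : ℝ) ^ m * ((D.factorial : ℝ) ^ n * B) := by
        rw [Finset.sum_const, nsmul_eq_mul, Finset.card_univ]; simp
    _ ≤ (n + 1 : ℝ) ^ D * ((D.factorial : ℝ) ^ n * B) := by
        refine mul_le_mul_of_nonneg_right ?_ (by positivity)
        calc (n : ℝ) ^ m ≤ (n + 1 : ℝ) ^ m := pow_le_pow_left₀ (by positivity) (by linarith) _
          _ ≤ _ := pow_le_pow_right₀ (by linarith [Nat.cast_nonneg (α := ℝ) n]) hm
    _ = _ := by rw [KD]; ring

lemma IsJS.iteratedFDeriv_ev {a : MI n → Pt n → ℝ} (ha : IsJS D a)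
    (hc : ContDiff ℝ (D : ℕ∞) (a 0)) {m : ℕ} (hm : m ≤ D) (x : Pt n) (w : Fin m → Fin n) :
    iteratedFDeriv ℝ m (a 0) x (fun k => ev (w k)) =
      fac (cnt (List.ofFn w)) * a (cnt (List.ofFn w)) x := by
  rw [FlatExt.iteratedFDeriv_ev (a 0) m w (hc.of_le (by exact_mod_cast hm)) x,
    ha.pd_eq _ (by simpa using hm)]

lemma IsJS.norm_iteratedFDeriv_le {a : MI n → Pt n → ℝ} (ha : IsJS D a)
    (hc : ContDiff ℝ (D : ℕ∞) (a 0)) {m : ℕ} (hm : m ≤ D) (x : Pt n) {B : ℝ} (hB0 : 0 ≤ B)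
    (hB : ∀ α : MI n, α.degree = m → |a α x| ≤ B) :
    ‖iteratedFDeriv ℝ m (a 0) x‖ ≤ KD n D * B := by
  refine (norm_multilinear_le m _).trans ?_
  simp_rw [ha.iteratedFDeriv_ev hc hm]
  exact sum_words_le m hm (fun α => a α x) hB0 hB

lemma IsJS.norm_iteratedFDeriv_sub_le {a : MI n → Pt n → ℝ} (ha : IsJS D a)
    (hc : ContDiff ℝ (D : ℕ∞) (a 0)) {m : ℕ} (hm : m ≤ D) (x y : Pt n) {B : ℝ} (hB0 : 0 ≤ B)
    (hB : ∀ α : MI n, α.degree = m → |a α x - a α y| ≤ B) :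
    ‖iteratedFDeriv ℝ m (a 0) x - iteratedFDeriv ℝ m (a 0) y‖ ≤ KD n D * B := by
  refine (norm_multilinear_le m _).trans ?_
  simp_rw [sub_apply, ha.iteratedFDeriv_ev hc hm, ← mul_sub]
  exact sum_words_le m hm (fun α => a α x - a α y) hB0 hB

lemma pd_congr {F G : Pt n → ℝ} {x : Pt n} (h : F =ᶠ[nhds x] G) (w : List (Fin n)) :
    pd w F =ᶠ[nhds x] pd w G := by
  induction w with
  | nil => exact h
  | cons i w ih =>
    filter_upwards [ih.fderiv (𝕜 := ℝ)] with y hy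
    simp only [pd, hy]

lemma pd_const (c : ℝ) (w : List (Fin n)) :
    pd w (fun _ => c) = fun _ => if w = [] then c else 0 := by
  induction w with
  | nil => simp [pd]
  | cons i w ih => funext x; simp only [pd, ih]; simp

lemma jsOf_of_eventually_const {F : Pt n → ℝ} {x : Pt n} {c : ℝ} (h : F =ᶠ[nhds x] fun _ => c)
    (α : MI n) : jsOf F α x = if α = 0 then c else 0 := by
  rw [jsOf, (pd_congr h _).self_of_nhds, pd_const]
  by_cases hα : α = 0
  · subst hα; simp [wd_zero, fac]
  · rw [if_neg, if_neg hα, zero_div]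
    intro hh
    have := length_wd α
    rw [hh] at this
    exact hα ((Finsupp.degree_eq_zero_iff α).1 (by simpa using this.symm))

lemma IsJS.scale {a : MI n → Pt n → ℝ} (ha : IsJS D a) (z : Pt n) (t : ℝ) :
    IsJS D (fun α x => t ^ α.degree * a α (t • (x - z))) := by
  intro α hα x
  have h1 := ha α hα (t • (x - z))
  have h2 : HasFDerivAt (fun y : Pt n => t • (y - z)) (t • ContinuousLinearMap.id ℝ (Pt n)) x :=
    ((hasFDerivAt_id x).sub_const z).const_smul t
  have h3 := (h1.comp x h2).const_mul (t ^ α.degree)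
  convert! h3 using 1
  rw [ContinuousLinearMap.comp_smul, ContinuousLinearMap.comp_id, Finset.smul_sum, Finset.smul_sum]
  refine Finset.sum_congr rfl fun i _ => ?_
  rw [smul_smul, smul_smul]
  dsimp only
  rw [degree_add_single]
  congr 1; ring

/-- Cut-off fields at scale `ρ`. -/
lemma exists_bump (n D : ℕ) (s : ℝ) [Ord D s] : ∃ C : ℝ, 1 ≤ C ∧ ∀ (z : Pt n) (ρ : ℝ), 0 < ρ →
    ∃ b : Pt n → J n D, BF s (C * ρ ^ (-s)) ρ univ b ∧ (∀ x, dist x z ≤ 2 * ρ → b x = jone) ∧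
      (∀ x, 3 * ρ ≤ dist x z → b x = 0) ∧ ∀ x, 0 ≤ co x 0 (b x) ∧ co x 0 (b x) ≤ 1 := by
  let χ : ContDiffBump (0 : Pt n) := ⟨9 / 4, 11 / 4, by norm_num, by norm_num⟩
  have hsm : ∀ m : ℕ, ContDiff ℝ (m : ℕ∞) χ := fun m => χ.contDiff
  have hbd : ∀ m : ℕ, ∃ H : ℝ, ∀ x, ‖iteratedFDeriv ℝ m χ x‖ ≤ H := by
    intro m
    have h1 : HasCompactSupport (iteratedFDeriv ℝ m χ) := χ.hasCompactSupport.iteratedFDeriv m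
    have h2 : Continuous (iteratedFDeriv ℝ m χ) := (hsm m).continuous_iteratedFDeriv (by simp)
    exact h1.exists_bound_of_continuous h2
  choose H hH using hbd
  set H0 : ℝ := 1 + ∑ m ∈ Finset.range (D + 2), |H m| with hH0
  have hH0pos : 1 ≤ H0 := by
    have : 0 ≤ ∑ m ∈ Finset.range (D + 2), |H m| := Finset.sum_nonneg fun _ _ => abs_nonneg _
    linarith
  have hbd : ∀ m ≤ D + 1, ∀ x, ‖iteratedFDeriv ℝ m χ x‖ ≤ H0 := by
    intro m hm x
    have : |H m| ≤ ∑ m ∈ Finset.range (D + 2), |H m| :=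
      Finset.single_le_sum (f := fun m => |H m|) (fun _ _ => abs_nonneg _) (Finset.mem_range.2 (by omega))
    linarith [hH m x, le_abs_self (H m)]
  have hlip : ∀ x y, ‖iteratedFDeriv ℝ D χ x - iteratedFDeriv ℝ D χ y‖ ≤ H0 * dist x y := by
    intro x y
    rw [dist_eq_norm]
    refine Convex.norm_image_sub_le_of_norm_fderiv_le (𝕜 := ℝ) (s := univ) (fun w _ => ?_) (fun w _ => ?_)
      convex_univ (mem_univ _) (mem_univ _)
    · exact ((hsm (D + 1)).differentiable_iteratedFDeriv (by norm_cast; omega)).differentiableAt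
    · rw [norm_fderiv_iteratedFDeriv]; exact hbd _ le_rfl w
  have hθ : 0 < s - D := sub_degree_pos le_rfl
  have hθ1 : s - D ≤ 1 := by have : s ≤ (D : ℝ) + 1 := Ord.le; linarith
  have htop : ∀ α : MI n, α.degree = D → ∀ x y,
      |jsOf χ α x - jsOf χ α y| ≤ 2 * H0 * dist x y ^ (s - D) := by
    intro α hα x y
    have h1 := abs_jsOf_sub_le (F := χ) α (hsm _) x y
    rw [hα] at h1
    by_cases hd : dist x y ≤ 1
    · refine h1.trans ((hlip x y).trans ?_)
      have : dist x y ≤ dist x y ^ (s - D) := by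
        rcases (dist_nonneg (x := x) (y := y)).eq_or_lt with h | h
        · rw [← h, Real.zero_rpow hθ.ne']
        · calc dist x y = dist x y ^ (1 : ℝ) := (Real.rpow_one _).symm
            _ ≤ _ := Real.rpow_le_rpow_of_exponent_ge h hd hθ1
      have h0 := dist_nonneg (x := x) (y := y)
      nlinarith
    · push Not at hd
      have : 1 ≤ dist x y ^ (s - D) := Real.one_le_rpow hd.le hθ.le
      have h2 := norm_sub_le (iteratedFDeriv ℝ D χ x) (iteratedFDeriv ℝ D χ y)
      have h3 := hbd D (by omega) x
      have h4 := hbd D (by omega) y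
      nlinarith
  refine ⟨KT n D ^ D * (2 * H0), ?_, fun z ρ hρ => ?_⟩
  · have := one_le_pow₀ (one_le_KT n D) (n := D)
    nlinarith
  let a : MI n → Pt n → ℝ := fun α x => ρ⁻¹ ^ α.degree * jsOf χ α (ρ⁻¹ • (x - z))
  have ha : IsJS D a := (isJS_jsOf (D := D) (hsm D)).scale z ρ⁻¹
  have hdist : ∀ x, ‖ρ⁻¹ • (x - z)‖ = dist x z / ρ := by
    intro x
    rw [norm_smul, norm_inv, Real.norm_of_nonneg hρ.le, dist_eq_norm]; field_simp
  have hco0 : ∀ x, co x 0 (jsField D a x) = χ (ρ⁻¹ • (x - z)) := by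
    intro x
    rw [co_jsField _ _ (by simp)]
    simp [a, jsOf_zero]
  refine ⟨jsField D a, ?_, fun x hx => ?_, fun x hx => ?_, fun x => ?_⟩
  · have hbf : BF s (KT n D ^ D * (2 * H0 * ρ ^ (-s))) ρ univ (jsField D a) := by
      refine ha.bf (by positivity) hρ.le (fun α hα x => ?_) (fun α hα x y => ?_)
      · have e : ρ ^ (-s) * ρ ^ (s - (α.degree : ℝ)) = ρ⁻¹ ^ α.degree := by
          rw [← Real.rpow_add hρ, inv_pow, ← Real.rpow_natCast, ← Real.rpow_neg hρ.le]
          congr 1; ring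
        rw [mul_assoc, e, abs_mul, abs_of_nonneg (by positivity : 0 ≤ ρ⁻¹ ^ α.degree), mul_comm]
        refine mul_le_mul_of_nonneg_right ?_ (by positivity)
        refine (abs_jsOf_le α (hsm _) _).trans ((hbd _ (by omega) _).trans (by linarith))
      · have h1 := htop α hα (ρ⁻¹ • (x - z)) (ρ⁻¹ • (y - z))
        have e1 : dist (ρ⁻¹ • (x - z)) (ρ⁻¹ • (y - z)) = ρ⁻¹ * dist x y := by
          rw [dist_smul₀, Real.norm_of_nonneg (by positivity), dist_sub_right]
        have e : ρ ^ (-s) = ρ⁻¹ ^ D * ρ⁻¹ ^ (s - (D : ℝ)) := by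
          rw [Real.inv_rpow hρ.le, ← Real.rpow_neg hρ.le, inv_pow, ← Real.rpow_natCast,
            ← Real.rpow_neg hρ.le, ← Real.rpow_add hρ]
          congr 1; ring
        rw [e1, Real.mul_rpow (by positivity) dist_nonneg] at h1
        change |ρ⁻¹ ^ α.degree * _ - ρ⁻¹ ^ α.degree * _| ≤ _
        rw [← mul_sub, abs_mul, abs_of_nonneg (by positivity : 0 ≤ ρ⁻¹ ^ α.degree), hα, e]
        calc _ ≤ ρ⁻¹ ^ D * (2 * H0 * (ρ⁻¹ ^ (s - ↑D) * dist x y ^ (s - ↑D))) :=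
              mul_le_mul_of_nonneg_left h1 (by positivity)
          _ = _ := by ring
    convert hbf using 1; ring
  · apply J_ext x
    intro α hα
    rw [co_jsField _ _ hα, co_jone]
    have hev : (χ : Pt n → ℝ) =ᶠ[nhds (ρ⁻¹ • (x - z))] fun _ => 1 := by
      apply χ.eventuallyEq_one_of_mem_ball
      rw [mem_ball_zero_iff, hdist, div_lt_iff₀ hρ]
      change _ < 9 / 4 * ρ
      linarith
    change ρ⁻¹ ^ α.degree * _ = _
    rw [jsOf_of_eventually_const hev]
    by_cases h : α = 0
    · simp [h]
    · simp [h]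
  · apply J_ext x
    intro α hα
    rw [co_jsField _ _ hα, map_zero]
    have hev : (χ : Pt n → ℝ) =ᶠ[nhds (ρ⁻¹ • (x - z))] fun _ => 0 := by
      have hopen : IsOpen {y : Pt n | 11 / 4 < ‖y‖} := isOpen_lt continuous_const continuous_norm
      have hmem : ρ⁻¹ • (x - z) ∈ {y : Pt n | 11 / 4 < ‖y‖} := by
        change 11 / 4 < ‖ρ⁻¹ • (x - z)‖
        rw [hdist, lt_div_iff₀ hρ]; linarith
      filter_upwards [hopen.mem_nhds hmem] with y hy
      apply χ.zero_of_le_dist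
      rw [dist_zero_right]; exact le_of_lt hy
    change ρ⁻¹ ^ α.degree * _ = _
    rw [jsOf_of_eventually_const hev]
    simp
  · rw [hco0]; exact ⟨χ.nonneg, χ.le_one⟩

/-- Interpolation data: the finite set of nodes, the nodes carrying values, and the flatness
radius. -/
structure Dat (n : ℕ) where
  X : Finset (Pt n)
  E : Set (Pt n)
  r : Pt n → ℝ
  r_nonneg : ∀ z, 0 ≤ r z

/-- `P` is an admissible Whitney field on `S` with values `f` and constant `M`. -/
def IsField (s : ℝ) (d : Dat n) (S : Set (Pt n)) (f : Pt n → ℝ) (M : ℝ) (P : Pt n → J n D) : Prop :=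
  (∀ z ∈ S, Bd s M z (d.r z) (P z)) ∧ (∀ z ∈ S, z ∈ d.E → co z 0 (P z) = f z) ∧
    ∀ z ∈ S, ∀ w ∈ S, Bd s M z (dist z w) (P z - P w)

lemma IsField.mono {d : Dat n} {S T : Set (Pt n)} {f : Pt n → ℝ} {M M' : ℝ} {P : Pt n → J n D}
    (h : IsField s d S f M P) (hT : T ⊆ S) (hM : M ≤ M') : IsField s d T f M' P :=
  ⟨fun z hz => (h.1 z (hT hz)).mono (d.r_nonneg z) hM, fun z hz => h.2.1 z (hT hz),
    fun z hz w hw => (h.2.2 z (hT hz) w (hT hw)).mono dist_nonneg hM⟩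

lemma IsField.add {d : Dat n} {S : Set (Pt n)} {f g : Pt n → ℝ} {M M' : ℝ} {P Q : Pt n → J n D}
    (h : IsField s d S f M P) (h' : IsField s d S g M' Q) :
    IsField s d S (f + g) (M + M') (P + Q) := by
  refine ⟨fun z hz => (h.1 z hz).add (h'.1 z hz), fun z hz hE => ?_, fun z hz w hw => ?_⟩
  · simp [h.2.1 z hz hE, h'.2.1 z hz hE]
  · have := (h.2.2 z hz w hw).add (h'.2.2 z hz w hw)
    rwa [sub_add_sub_comm] at this

lemma IsField.smul {d : Dat n} {S : Set (Pt n)} {f : Pt n → ℝ} {M : ℝ} {P : Pt n → J n D}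
    (h : IsField s d S f M P) (a : ℝ) : IsField s d S (a • f) (|a| * M) (a • P) := by
  refine ⟨fun z hz => (h.1 z hz).smul a, fun z hz hE => ?_, fun z hz w hw => ?_⟩
  · simp [h.2.1 z hz hE]
  · have := (h.2.2 z hz w hw).smul a
    rwa [smul_sub] at this

lemma IsField.convexComb {d : Dat n} {S : Set (Pt n)} {f : Pt n → ℝ} {M : ℝ} {P Q : Pt n → J n D}
    (h : IsField s d S f M P) (h' : IsField s d S f M Q) {a b : ℝ} (ha : 0 ≤ a) (hb : 0 ≤ b)
    (hab : a + b = 1) : IsField s d S f M (a • P + b • Q) := by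
  have := (h.smul a).add (h'.smul b)
  rwa [← add_smul, abs_of_nonneg ha, abs_of_nonneg hb, ← add_mul, hab, one_smul, one_mul] at this

/-- Polynomials at `x` which extend to admissible fields on `x` and any `k` nodes. -/
def Gam (s : ℝ) (d : Dat n) (k : ℕ) (f : Pt n → ℝ) (x : Pt n) (M : ℝ)
    (p : J n D) : Prop :=
  ∀ S : Finset (Pt n), S ⊆ d.X → S.card ≤ k →
    ∃ P : Pt n → J n D, IsField s d (insert x (S : Set (Pt n))) f M P ∧ P x = p

lemma Gam.mono {d : Dat n} {k k' : ℕ} {f : Pt n → ℝ} {x : Pt n} {M M' : ℝ} {p : J n D}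
    (h : Gam s d k f x M p) (hk : k' ≤ k) (hM : M ≤ M') : Gam s d k' f x M' p := by
  intro S hS hc
  obtain ⟨P, hP, e⟩ := h S hS (hc.trans hk)
  exact ⟨P, hP.mono subset_rfl hM, e⟩

lemma Gam.add {d : Dat n} {k : ℕ} {f g : Pt n → ℝ} {x : Pt n} {M M' : ℝ} {p q : J n D}
    (h : Gam s d k f x M p) (h' : Gam s d k g x M' q) :
    Gam s d k (f + g) x (M + M') (p + q) := by
  intro S hS hc
  obtain ⟨P, hP, e⟩ := h S hS hc
  obtain ⟨Q, hQ, e'⟩ := h' S hS hc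
  exact ⟨P + Q, hP.add hQ, by simp [e, e']⟩

lemma Gam.smul {d : Dat n} {k : ℕ} {f : Pt n → ℝ} {x : Pt n} {M : ℝ} {p : J n D}
    (h : Gam s d k f x M p) (a : ℝ) : Gam s d k (a • f) x (|a| * M) (a • p) := by
  intro S hS hc
  obtain ⟨P, hP, e⟩ := h S hS hc
  exact ⟨a • P, hP.smul a, by simp [e]⟩

lemma Gam.add_sig {d : Dat n} {k : ℕ} {f : Pt n → ℝ} {x : Pt n} {M M' : ℝ} {p q : J n D}
    (h : Gam s d k f x M p) (h' : Gam s d k 0 x M' q) :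
    Gam s d k f x (M + M') (p + q) := by
  simpa using Gam.add h h'

lemma Gam.smul_sig {d : Dat n} {k : ℕ} {x : Pt n} {M : ℝ} {p : J n D}
    (h : Gam s d k 0 x M p) (a : ℝ) : Gam s d k 0 x (|a| * M) (a • p) := by
  simpa using Gam.smul h a

lemma Gam.sub {d : Dat n} {k : ℕ} {f g : Pt n → ℝ} {x : Pt n} {M M' : ℝ} {p q : J n D}
    (h : Gam s d k f x M p) (h' : Gam s d k g x M' q) :
    Gam s d k (f - g) x (M + M') (p - q) := by
  have := Gam.add h (Gam.smul h' (-1))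
  simpa [sub_eq_add_neg] using this

lemma Gam.sub_same {d : Dat n} {k : ℕ} {f : Pt n → ℝ} {x : Pt n} {M M' : ℝ} {p q : J n D}
    (h : Gam s d k f x M p) (h' : Gam s d k f x M' q) :
    Gam s d k 0 x (M + M') (p - q) := by
  simpa using Gam.sub h h'

lemma Gam.zero (d : Dat n) (k : ℕ) (x : Pt n) {M : ℝ} (hM : 0 ≤ M) :
    Gam s d k 0 x M (0 : J n D) := by
  intro S hS hc
  refine ⟨0, ⟨fun z _ => Bd.zero hM (d.r_nonneg z) z, by simp, fun z _ w _ => ?_⟩, rfl⟩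
  simpa using Bd.zero hM dist_nonneg z

lemma Gam.sum {ι : Type*} (t : Finset ι) {d : Dat n} {k : ℕ} {x : Pt n} {M : ι → ℝ}
    {p : ι → J n D} (h : ∀ i ∈ t, Gam s d k 0 x (M i) (p i)) :
    Gam s d k 0 x (∑ i ∈ t, M i) (∑ i ∈ t, p i) := by
  classical
  induction t using Finset.induction_on with
  | empty => simpa using Gam.zero d k x le_rfl
  | insert i t hi ih =>
    rw [Finset.sum_insert hi, Finset.sum_insert hi]
    exact Gam.add_sig (h i (by simp)) (ih fun j hj => h j (by simp [hj]))

/-- Helly's theorem for antitone families of convex sets indexed by finite sets. -/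
lemma exists_of_helly (X : Finset (Pt n)) (k : ℕ) (K : Finset (Pt n) → Set (J n D))
    (hK : ∀ S, Convex ℝ (K S)) (hanti : ∀ S T, S ⊆ T → K T ⊆ K S)
    (hne : ∀ S ⊆ X, S.card ≤ (Module.finrank ℝ (J n D) + 1) * k → (K S).Nonempty) :
    ∃ q, ∀ S ⊆ X, S.card ≤ k → q ∈ K S := by
  classical
  obtain ⟨q, hq⟩ := Convex.helly_theorem' (𝕜 := ℝ) (F := K)
    (s := X.powerset.filter fun S => S.card ≤ k) (fun S _ => hK S) (by
      intro I hI hc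
      have h1 : ∀ S ∈ I, S ⊆ X ∧ S.card ≤ k := fun S hS => by simpa using hI hS
      obtain ⟨q, hq⟩ := hne (I.biUnion id)
        (Finset.biUnion_subset.2 fun S hS => (h1 S hS).1)
        ((Finset.card_biUnion_le_card_mul I id k fun S hS => (h1 S hS).2).trans
          (Nat.mul_le_mul_right k hc))
      refine ⟨q, ?_⟩
      simp only [mem_iInter]
      exact fun S hS => hanti _ _ (Finset.subset_biUnion_of_mem id hS) hq)
  simp only [mem_iInter, Finset.mem_filter, Finset.mem_powerset] at hq
  exact ⟨q, fun S hS hc => hq S ⟨hS, hc⟩⟩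

/-- Number of nodes needed to transport an element of `Gam` of level `k`. -/
def lev (n D k : ℕ) : ℕ := (Module.finrank ℝ (J n D) + 1) * k + 1

lemma le_lev (n D k : ℕ) : k ≤ lev n D k := by unfold lev; nlinarith

lemma Gam.transport {d : Dat n} {k : ℕ} {f : Pt n → ℝ} {x y : Pt n} {M : ℝ} {p : J n D}
    (h : Gam s d (lev n D k) f x M p) (hy : y ∈ d.X) :
    ∃ q, Gam s d k f y M q ∧ Bd s M x (dist x y) (p - q) ∧ Bd s M y (dist x y) (p - q) := by
  classical
  let K : Finset (Pt n) → Set (J n D) := fun S =>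
    {q | ∃ P : Pt n → J n D, IsField s d (insert x (insert y (S : Set (Pt n)))) f M P ∧
      P x = p ∧ P y = q}
  obtain ⟨q, hq⟩ := exists_of_helly d.X k K (by
      rintro S q ⟨P, hP, e1, e2⟩ q' ⟨P', hP', e1', e2'⟩ a b ha hb hab
      refine ⟨a • P + b • P', hP.convexComb hP' ha hb hab, ?_, ?_⟩
      · simp [e1, e1', ← add_smul, hab]
      · simp [e2, e2']) (by
      rintro S T hST q ⟨P, hP, e⟩
      exact ⟨P, hP.mono (insert_subset_insert (insert_subset_insert
        (Finset.coe_subset.2 hST))) le_rfl, e⟩) (by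
      intro S hS hc
      obtain ⟨P, hP, e⟩ := h (insert y S) (Finset.insert_subset hy hS)
        ((Finset.card_insert_le _ _).trans (by unfold lev; omega))
      exact ⟨P y, P, by simpa using hP, e, rfl⟩)
  refine ⟨q, fun S hS hc => ?_, ?_⟩
  · obtain ⟨P, hP, e1, e2⟩ := hq S hS hc
    exact ⟨P, hP.mono (subset_insert _ _) le_rfl, e2⟩
  · obtain ⟨P, hP, e1, e2⟩ := hq ∅ (by simp) (by simp)
    have h1 := hP.2.2 x (by simp) y (by simp)
    have h2 := hP.2.2 y (by simp) x (by simp)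
    rw [e1, e2] at h1 h2
    rw [dist_comm y x] at h2
    exact ⟨h1, h2.symm⟩

lemma Gam.nonempty_of_fields {d : Dat n} {k : ℕ} {f : Pt n → ℝ} {x : Pt n} {M : ℝ} (hx : x ∈ d.X)
    (h : ∀ S ⊆ d.X, S.card ≤ lev n D k → ∃ P : Pt n → J n D, IsField s d S f M P) :
    ∃ p : J n D, Gam s d k f x M p := by
  classical
  obtain ⟨q, hq⟩ := exists_of_helly d.X k (fun S => {q : J n D | ∃ P : Pt n → J n D,
      IsField s d (insert x (S : Set (Pt n))) f M P ∧ P x = q}) (by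
      rintro S q ⟨P, hP, e⟩ q' ⟨P', hP', e'⟩ a b ha hb hab
      exact ⟨a • P + b • P', hP.convexComb hP' ha hb hab, by simp [e, e']⟩) (by
      rintro S T hST q ⟨P, hP, e⟩
      exact ⟨P, hP.mono (insert_subset_insert (Finset.coe_subset.2 hST)) le_rfl, e⟩) (by
      intro S hS hc
      obtain ⟨P, hP⟩ := h (insert x S) (Finset.insert_subset hx hS)
        ((Finset.card_insert_le _ _).trans (by unfold lev; omega))
      exact ⟨P x, P, by simpa using hP, rfl⟩)
  exact ⟨q, hq⟩

/-- Multiplication of a homogeneous field by a compactly supported multiplier. -/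
lemma IsField.multiply [Ord D s] {A : ℝ} (hA : 0 ≤ A) : ∃ C' : ℝ, 1 ≤ C' ∧
    ∀ (d : Dat n) (S : Set (Pt n)) (C ρ : ℝ) (x : Pt n) (m P : Pt n → J n D), 0 ≤ C → 0 < ρ →
      BF s (A * ρ ^ (-s)) ρ (Metric.closedBall x (4 * ρ)) m → (∀ y, 3 * ρ ≤ dist y x → m y = 0) →
      IsField s d S 0 C P → x ∈ S → Bd s C x ρ (P x) →
      IsField s d S 0 (C' * C) (fun y => jmul y (m y) (P y)) := by
  have hs := Ord.pos D s
  set C1 : ℝ := 4 ^ s + K0 n D * 4 ^ D with hC1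
  have hC1p : 0 ≤ C1 := by have := K0_pos n D; positivity
  have hK0 := one_le_K0 n D
  have hK1 := one_le_K1 n D
  set B : ℝ := K1 n D * A * C1 with hB
  have hBp : 0 ≤ B := by positivity
  refine ⟨1 + K0 n D * B + K0 n D * A, by nlinarith [mul_nonneg (K0_pos n D).le hBp, mul_nonneg (K0_pos n D).le hA], ?_⟩
  intro d S C ρ x m P hC hρ hm hm0 hP hxS hPx
  have hρs : ρ ^ (-s) * ρ ^ s = 1 := by rw [← Real.rpow_add hρ]; simp
  have hρp : 0 < ρ ^ (-s) := Real.rpow_pos_of_pos hρ _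
  have hPB : BF s (C1 * C) ρ (S ∩ Metric.closedBall x (4 * ρ)) P := by
    refine ⟨fun y hy => ?_, fun y hy z hz => (hP.2.2 y hy.1 z hz.1).mono dist_nonneg ?_⟩
    · have hd : dist y x ≤ 4 * ρ := hy.2
      have h1 := ((hP.2.2 y hy.1 x hxS).mono_scale hC dist_nonneg hd).of_mul_scale hC
        (by norm_num) hρ.le
      have h2 := hPx.shift (K := 4) hC hρ.le (by norm_num) (by rwa [dist_comm])
      have h3 := h1.add h2
      rw [sub_add_cancel] at h3
      exact h3.mono hρ.le (by rw [hC1]; nlinarith)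
    · have h4 : (1 : ℝ) ≤ 4 ^ s := Real.one_le_rpow (by norm_num) hs.le
      have h5 : 0 ≤ K0 n D * 4 ^ D := by have := K0_pos n D; positivity
      nlinarith
  have hQ : BF s (B * C) ρ (S ∩ Metric.closedBall x (4 * ρ)) (fun y => jmul y (m y) (P y)) := by
    have := (hm.mono hρ.le le_rfl inter_subset_right).jmul hPB (by positivity) (by positivity) hρ.le
    refine this.mono hρ.le (le_of_eq ?_) subset_rfl
    calc K1 n D * (A * ρ ^ (-s)) * (C1 * C) * ρ ^ s
        = K1 n D * A * C1 * C * (ρ ^ (-s) * ρ ^ s) := by ring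
      _ = B * C := by rw [hρs, hB]; ring
  have hzero : ∀ y, 3 * ρ ≤ dist y x → jmul y (m y) (P y) = 0 := fun y hy => by
    rw [hm0 y hy, jmul_zero_left]
  have hBC : 0 ≤ B * C := by positivity
  have hle1 : B * C ≤ (1 + K0 n D * B + K0 n D * A) * C := by
    have : B ≤ K0 n D * B := by nlinarith
    have : 0 ≤ K0 n D * A := by positivity
    nlinarith
  have hle2 : K0 n D * B * C ≤ (1 + K0 n D * B + K0 n D * A) * C := by
    have : 0 ≤ K0 n D * A := by positivity
    nlinarith
  have hle3 : K0 n D * A * C ≤ (1 + K0 n D * B + K0 n D * A) * C := by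
    have : 0 ≤ K0 n D * B := by positivity
    nlinarith
  have hle0 : 0 ≤ (1 + K0 n D * B + K0 n D * A) * C := hBC.trans hle1
  refine ⟨fun y hy => ?_, fun y hy hE => ?_, fun y hy z hz => ?_⟩
  · beta_reduce
    rcases le_or_gt (3 * ρ) (dist y x) with h | h
    · rw [hzero y h]; exact Bd.zero hle0 (d.r_nonneg y) y
    · have hyb : y ∈ Metric.closedBall x (4 * ρ) := by
        rw [Metric.mem_closedBall]; linarith
      rcases le_or_gt (d.r y) ρ with hr | hr
      · have := (hm.1 y hyb).jmul (hP.1 y hy) (by positivity) hC (d.r_nonneg y) hr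
        refine this.mono (d.r_nonneg y) (le_trans (le_of_eq ?_) hle3)
        calc K0 n D * (A * ρ ^ (-s)) * C * ρ ^ s = K0 n D * A * C * (ρ ^ (-s) * ρ ^ s) := by ring
          _ = _ := by rw [hρs]; ring
      · exact ((hQ.1 y ⟨hy, hyb⟩).mono_scale hBC hρ.le hr.le).mono (d.r_nonneg y) hle1
  · rw [co_zero_jmul, hP.2.1 y hy hE]; simp
  · rcases le_or_gt (dist y x) (4 * ρ) with h | h <;> rcases le_or_gt (dist z x) (4 * ρ) with h' | h'
    · exact (hQ.2 y ⟨hy, h⟩ z ⟨hz, h'⟩).mono dist_nonneg hle1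
    · beta_reduce
      rw [hzero z (by linarith), sub_zero]
      rcases le_or_gt (3 * ρ) (dist y x) with h3 | h3
      · rw [hzero y h3]; exact Bd.zero hle0 dist_nonneg y
      · refine ((hQ.1 y ⟨hy, h⟩).mono_scale hBC hρ.le ?_).mono dist_nonneg hle1
        have := dist_triangle z y x
        rw [dist_comm y z]; linarith
    · beta_reduce
      rw [hzero y (by linarith), zero_sub]
      refine Bd.neg ?_
      rcases le_or_gt (3 * ρ) (dist z x) with h3 | h3
      · rw [hzero z h3]; exact Bd.zero hle0 dist_nonneg y
      · have h5 : ρ ≤ dist y z := by have := dist_triangle y z x; linarith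
        have h4 := (hQ.1 z ⟨hz, h'⟩).mono_scale hBC hρ.le h5
        have := h4.shift (K := 1) (y := y) hBC dist_nonneg le_rfl (by rw [dist_comm z y, one_mul])
        refine this.mono dist_nonneg ?_
        rw [one_pow, mul_one]; linarith
    · beta_reduce
      rw [hzero y (by linarith), hzero z (by linarith), sub_zero]
      exact Bd.zero hle0 dist_nonneg y

/-- The monomial of exponent `γ` centred at `x`, normalised at scale `δ`. -/
def nmon (D : ℕ) (x : Pt n) (δ : ℝ) (γ : MI n) : J n D :=
  ofCo x fun α => if α = γ then (δ ^ γ.degree)⁻¹ else 0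

lemma co_nmon (x : Pt n) (δ : ℝ) (γ : MI n) {α : MI n} (h : α.degree ≤ D) :
    co x α (nmon D x δ γ) = if α = γ then (δ ^ γ.degree)⁻¹ else 0 := by
  rw [nmon, co_ofCo x _ h]

lemma bd_nmon [Ord D s] (x : Pt n) {δ : ℝ} (hδ : 0 < δ) (γ : MI n) :
    Bd s (δ ^ (-s)) x δ (nmon D x δ γ) := by
  intro α hα
  rw [co_nmon x δ γ hα, ← Real.rpow_add hδ]
  split_ifs with h
  · subst h
    rw [abs_of_nonneg (by positivity), show -s + (s - (α.degree : ℝ)) = -(α.degree : ℝ) by ring,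
      Real.rpow_neg hδ.le, Real.rpow_natCast]
  · simp; positivity

lemma Gam.mul_nmon [Ord D s] : ∃ C' : ℝ, 1 ≤ C' ∧
    ∀ (d : Dat n) (k : ℕ) (C δ : ℝ) (x : Pt n) (γ : MI n) (p : J n D), 0 ≤ C → 0 < δ →
      Gam s d k 0 x C p → Bd s C x δ p →
      Gam s d k 0 x (C' * C) (jmul x (nmon D x δ γ) p) ∧
      Bd s (C' * C) x δ (jmul x (nmon D x δ γ) p) := by
  obtain ⟨Cb, hCb, hb⟩ := exists_bump n D s
  have hK0 := one_le_K0 n D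
  have hK1 := one_le_K1 n D
  set A : ℝ := K1 n D * Cb * (K0 n D * 4 ^ D) with hAdef
  have hA : 0 ≤ A := by positivity
  obtain ⟨C1, hC1, h1⟩ := IsField.multiply (n := n) (D := D) (s := s) hA
  refine ⟨C1 + K0 n D, by linarith, ?_⟩
  intro d k C δ x γ p hC hδ hp hpB
  have hρs : δ ^ (-s) * δ ^ s = 1 := by rw [← Real.rpow_add hδ]; simp
  have hρp : 0 < δ ^ (-s) := Real.rpow_pos_of_pos hδ _
  obtain ⟨b, hbB, hb1, hb0, -⟩ := hb x δ hδ
  set q := nmon D x δ γ with hq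
  have hqB : Bd s (δ ^ (-s)) x δ q := bd_nmon x hδ γ
  have hqF : BF s (K0 n D * 4 ^ D * δ ^ (-s)) δ (Metric.closedBall x (4 * δ)) (fun _ => q) := by
    refine ⟨fun y hy => hqB.shift (K := 4) hρp.le hδ.le (by norm_num)
      (by rw [dist_comm]; exact hy), fun y _ z _ => ?_⟩
    rw [sub_self]; exact Bd.zero (by positivity) dist_nonneg y
  have hm : BF s (A * δ ^ (-s)) δ (Metric.closedBall x (4 * δ)) (fun y => jmul y (b y) q) := by
    have := (hbB.mono hδ.le le_rfl (subset_univ _)).jmul hqF (by positivity) (by positivity) hδ.le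
    refine this.mono hδ.le (le_of_eq ?_) subset_rfl
    calc K1 n D * (Cb * δ ^ (-s)) * (K0 n D * 4 ^ D * δ ^ (-s)) * δ ^ s
        = A * δ ^ (-s) * (δ ^ (-s) * δ ^ s) := by rw [hAdef]; ring
      _ = _ := by rw [hρs, mul_one]
  constructor
  · intro S hS hc
    obtain ⟨P, hP, e⟩ := hp S hS hc
    have hP1 : Bd s C x δ (P x) := by rw [e]; exact hpB
    have hm0 : ∀ y, 3 * δ ≤ dist y x → jmul y (b y) q = 0 := fun y hy => by
      rw [hb0 y hy, jmul_zero_left]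
    have h2 := h1 d _ C δ x (fun y => jmul y (b y) q) P hC hδ hm hm0 hP (mem_insert _ _) hP1
    refine ⟨_, h2.mono subset_rfl (by nlinarith), ?_⟩
    beta_reduce
    rw [hb1 x (by rw [dist_self]; positivity), jmul_one_left, e]
  · have := hqB.jmul hpB hρp.le hC hδ.le le_rfl
    refine this.mono hδ.le ?_
    calc K0 n D * δ ^ (-s) * C * δ ^ s = K0 n D * C * (δ ^ (-s) * δ ^ s) := by ring
      _ ≤ _ := by rw [hρs]; nlinarith

/-- Coefficients normalised at scale `δ`. -/
def nc (s : ℝ) (x : Pt n) (δ : ℝ) (β : MI n) : J n D →ₗ[ℝ] ℝ := δ ^ ((β.degree : ℝ) - s) • co x β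

lemma nc_apply (x : Pt n) (δ : ℝ) (β : MI n) (p : J n D) :
    nc s x δ β p = δ ^ ((β.degree : ℝ) - s) * co x β p := rfl

lemma co_eq_nc (x : Pt n) {δ : ℝ} (hδ : 0 < δ) (β : MI n) (p : J n D) :
    co x β p = δ ^ (s - (β.degree : ℝ)) * nc s x δ β p := by
  rw [nc_apply, ← mul_assoc, ← Real.rpow_add hδ]; simp

lemma abs_nc_le_iff (x : Pt n) {δ : ℝ} (hδ : 0 < δ) (β : MI n) (p : J n D) (M : ℝ) :
    |nc s x δ β p| ≤ M ↔ |co x β p| ≤ M * δ ^ (s - (β.degree : ℝ)) := by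
  rw [co_eq_nc (s := s) x hδ, abs_mul, abs_of_pos (Real.rpow_pos_of_pos hδ _), mul_comm M]
  exact (mul_le_mul_iff_right₀ (Real.rpow_pos_of_pos hδ _)).symm

lemma bd_iff_nc (x : Pt n) {δ : ℝ} (hδ : 0 < δ) (p : J n D) (M : ℝ) :
    Bd s M x δ p ↔ ∀ β : MI n, β.degree ≤ D → |nc s x δ β p| ≤ M :=
  forall₂_congr fun β _ => (abs_nc_le_iff x hδ β p M).symm

lemma nc_eq_zero_iff (x : Pt n) {δ : ℝ} (hδ : 0 < δ) (β : MI n) (p : J n D) :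
    nc s x δ β p = 0 ↔ co x β p = 0 := by
  rw [nc_apply, mul_eq_zero]
  exact or_iff_right (Real.rpow_pos_of_pos hδ _).ne'

lemma nc_rescale (x : Pt n) {δ δ' : ℝ} (hδ : 0 < δ) (hδ' : 0 < δ') (β : MI n) (p : J n D) :
    nc s x δ' β p = (δ / δ') ^ (s - (β.degree : ℝ)) * nc s x δ β p := by
  rw [nc_apply, nc_apply, Real.div_rpow hδ.le hδ'.le, ← mul_assoc, div_mul_eq_mul_div,
    ← Real.rpow_add hδ, sub_add_sub_cancel', sub_self, Real.rpow_zero, one_div,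
    ← Real.rpow_neg hδ'.le, neg_sub]

/-- Homogeneous jets at `x` of size `C` at scale `δ`. -/
def Sg (s : ℝ) (d : Dat n) (k : ℕ) (x : Pt n) (δ C : ℝ) (p : J n D) : Prop :=
  Gam s d k 0 x C p ∧ Bd s C x δ p

section Sg
variable {d : Dat n} {k : ℕ} {x : Pt n} {δ : ℝ}

lemma Sg.mono {k' : ℕ} {C C' : ℝ} {p : J n D} (h : Sg s d k x δ C p) (hδ : 0 ≤ δ) (hk : k' ≤ k)
    (hC : C ≤ C') : Sg s d k' x δ C' p := ⟨h.1.mono hk hC, h.2.mono hδ hC⟩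

lemma Sg.smul {C : ℝ} {p : J n D} (h : Sg s d k x δ C p) (a : ℝ) :
    Sg s d k x δ (|a| * C) (a • p) := ⟨h.1.smul_sig a, h.2.smul a⟩

lemma Sg.smul_le {C b : ℝ} {p : J n D} (h : Sg s d k x δ C p) (hδ : 0 ≤ δ) (hC : 0 ≤ C) {a : ℝ}
    (ha : |a| ≤ b) : Sg s d k x δ (b * C) (a • p) :=
  (h.smul a).mono hδ le_rfl (mul_le_mul_of_nonneg_right ha hC)

lemma Sg.sub {C C' : ℝ} {p q : J n D} (h : Sg s d k x δ C p) (h' : Sg s d k x δ C' q) :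
    Sg s d k x δ (C + C') (p - q) := ⟨h.1.sub_same h'.1, h.2.sub h'.2⟩

lemma Sg.sum {ι : Type*} (t : Finset ι) {C : ι → ℝ} {p : ι → J n D}
    (h : ∀ i ∈ t, Sg s d k x δ (C i) (p i)) : Sg s d k x δ (∑ i ∈ t, C i) (∑ i ∈ t, p i) :=
  ⟨Gam.sum t fun i hi => (h i hi).1, Bd.sum t fun i hi => (h i hi).2⟩

lemma Sg.sum_le {ι : Type*} (t : Finset ι) {C N : ℝ} (hC : 0 ≤ C) (hδ : 0 ≤ δ) {p : ι → J n D}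
    (h : ∀ i ∈ t, Sg s d k x δ C (p i)) (ht : (t.card : ℝ) ≤ N) :
    Sg s d k x δ (N * C) (∑ i ∈ t, p i) :=
  (Sg.sum t h).mono hδ le_rfl (by
    rw [Finset.sum_const, nsmul_eq_mul]; exact mul_le_mul_of_nonneg_right ht hC)

lemma Sg.abs_nc_le {C : ℝ} {p : J n D} (h : Sg s d k x δ C p) (hδ : 0 < δ) {β : MI n}
    (hβ : β.degree ≤ D) : |nc s x δ β p| ≤ C := (bd_iff_nc x hδ p C).1 h.2 β hβ

end Sg

/-- `R` is a system of homogeneous jets dual to the coefficients in `A`. -/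
def IsDual (s : ℝ) (d : Dat n) (k : ℕ) (x : Pt n) (δ : ℝ) (A : Finset (MI n)) (C : ℝ)
    (R : MI n → J n D) : Prop :=
  ∀ α ∈ A, Sg s d k x δ C (R α) ∧ ∀ β ∈ A, nc s x δ β (R α) = if β = α then 1 else 0

/-- Existence of a dual system. -/
def IsBasis (D : ℕ) (s : ℝ) (d : Dat n) (k : ℕ) (x : Pt n) (δ : ℝ) (A : Finset (MI n)) (C : ℝ) :
    Prop := ∃ R : MI n → J n D, IsDual s d k x δ A C R

lemma IsBasis.mono {d : Dat n} {k k' : ℕ} {x : Pt n} {δ : ℝ} {A : Finset (MI n)} {C C' : ℝ}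
    (h : IsBasis D s d k x δ A C) (hδ : 0 ≤ δ) (hk : k' ≤ k) (hC : C ≤ C') :
    IsBasis D s d k' x δ A C' := by
  obtain ⟨R, hR⟩ := h
  exact ⟨R, fun α hα => ⟨(hR α hα).1.mono hδ hk hC, (hR α hα).2⟩⟩

lemma IsDual.add {d : Dat n} {k : ℕ} {x : Pt n} {δ : ℝ} {A : Finset (MI n)} {C C' ε : ℝ}
    {R : MI n → J n D} (hR : IsDual s d k x δ A C R) (hδ : 0 < δ) (hC : 0 ≤ C) (hC' : 0 ≤ C')
    (hε : 0 < ε) {φ : MI n} (hφD : φ.degree ≤ D) (hφ : φ ∉ A) {p : J n D}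
    (hp : Sg s d k x δ C' p) (hpA : ∀ β ∈ A, nc s x δ β p = 0) (hpε : ε ≤ |nc s x δ φ p|) :
    IsBasis D s d k x δ (insert φ A) (C + C * (C' / ε) + C' / ε) := by
  classical
  set t := nc s x δ φ p with ht
  have htp : 0 < |t| := hε.trans_le hpε
  have ht0 : t ≠ 0 := abs_pos.1 htp
  have hq : Sg s d k x δ (C' / ε) (t⁻¹ • p) := by
    refine (hp.smul_le hδ.le hC' (b := ε⁻¹) ?_).mono hδ.le le_rfl (by rw [div_eq_inv_mul])
    rw [abs_inv]; exact inv_anti₀ hε hpε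
  have hCε : 0 ≤ C' / ε := by positivity
  refine ⟨fun α => if α = φ then t⁻¹ • p else R α - nc s x δ φ (R α) • t⁻¹ • p, ?_⟩
  intro α hα
  by_cases h : α = φ
  · subst h
    simp only [if_true]
    refine ⟨hq.mono hδ.le le_rfl (by nlinarith [mul_nonneg hC hCε]), fun β hβ => ?_⟩
    rw [map_smul, smul_eq_mul]
    rcases Finset.mem_insert.1 hβ with rfl | hβ
    · rw [← ht]; simp [ht0]
    · rw [hpA β hβ, if_neg (fun e : β = α => hφ (e ▸ hβ)), mul_zero]
  · have hα : α ∈ A := (Finset.mem_insert.1 hα).resolve_left h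
    simp only [if_neg h]
    refine ⟨((hR α hα).1.sub (hq.smul_le hδ.le hCε ((hR α hα).1.abs_nc_le hδ hφD))).mono hδ.le le_rfl
      (by linarith), fun β hβ => ?_⟩
    rw [map_sub, map_smul, map_smul, smul_eq_mul, smul_eq_mul]
    rcases Finset.mem_insert.1 hβ with rfl | hβ
    · rw [← ht, inv_mul_cancel₀ ht0, if_neg (Ne.symm h)]; ring
    · rw [hpA β hβ, (hR α hα).2 β hβ]; simp

lemma IsDual.swap {d : Dat n} {k : ℕ} {x : Pt n} {δ : ℝ} {A : Finset (MI n)} {C ε : ℝ}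
    {R : MI n → J n D} (hR : IsDual s d k x δ A C R) (hδ : 0 < δ) (hC : 0 ≤ C)
    (hε : 0 < ε) {α φ : MI n} (hα : α ∈ A) (hφD : φ.degree ≤ D) (hφ : φ ∉ A)
    (hpε : ε ≤ |nc s x δ φ (R α)|) :
    IsBasis D s d k x δ (insert φ (A.erase α)) (C + C * (C / ε) + C / ε) := by
  have h1 : IsDual s d k x δ (A.erase α) C R := fun β hβ =>
    ⟨(hR β (Finset.mem_of_mem_erase hβ)).1, fun γ hγ =>
      (hR β (Finset.mem_of_mem_erase hβ)).2 γ (Finset.mem_of_mem_erase hγ)⟩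
  refine h1.add hδ hC hC hε hφD (fun h => hφ (Finset.mem_of_mem_erase h)) (hR α hα).1
    (fun β hβ => ?_) hpε
  rw [(hR α hα).2 β (Finset.mem_of_mem_erase hβ), if_neg (Finset.ne_of_mem_erase hβ)]

/-- Weight of a multi-index: lower indices have more weight. -/
def ew (D : ℕ) (α : MI n) : ℕ := ((mset n D).filter fun γ => toDegLex α ≤ toDegLex γ).card

/-- Weight of a set of multi-indices. -/
def ews (D : ℕ) (A : Finset (MI n)) : ℕ := ∑ α ∈ A, ew D α

lemma ew_pos {α : MI n} (h : α.degree ≤ D) : 0 < ew D α :=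
  Finset.card_pos.2 ⟨α, by simp [mem_mset, h]⟩

lemma ew_lt {α β : MI n} (hβ : β.degree ≤ D) (h : toDegLex β < toDegLex α) : ew D α < ew D β := by
  refine Finset.card_lt_card ⟨fun γ hγ => ?_, fun hh => ?_⟩
  · simp only [Finset.mem_filter] at hγ ⊢
    exact ⟨hγ.1, h.le.trans hγ.2⟩
  · have := hh (x := β) (by simp [mem_mset, hβ])
    simp only [Finset.mem_filter] at this
    exact absurd h this.2.not_gt

lemma toDegLex_lt_of_degree_lt {α β : MI n} (h : β.degree < α.degree) :
    toDegLex β < toDegLex α := Finsupp.DegLex.lt_iff.2 (Or.inl h)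

lemma ews_insert {A : Finset (MI n)} {φ : MI n} (hφ : φ ∉ A) (hφD : φ.degree ≤ D) :
    ews D A < ews D (insert φ A) := by
  rw [ews, ews, Finset.sum_insert hφ]
  have := ew_pos hφD; omega

lemma ews_swap {A : Finset (MI n)} {α φ : MI n} (hα : α ∈ A) (hφ : φ ∉ A) (hφD : φ.degree ≤ D)
    (h : toDegLex φ < toDegLex α) : ews D A < ews D (insert φ (A.erase α)) := by
  have h1 := ew_lt hφD h
  rw [ews, ews, Finset.sum_insert (fun h => hφ (Finset.mem_of_mem_erase h)),
    ← Finset.add_sum_erase A _ hα]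
  omega

lemma ews_le {A : Finset (MI n)} (hA : A ⊆ mset n D) : ews D A ≤ ews D (mset n D) :=
  Finset.sum_le_sum_of_subset hA

lemma nc_jmul_nmon (x : Pt n) {δ : ℝ} (hδ : 0 < δ) (β γ : MI n) (h : (β + γ).degree ≤ D)
    (p : J n D) : nc s x δ (β + γ) (jmul x (nmon D x δ γ) p) = nc s x δ β p := by
  have hγ : γ.degree ≤ D := le_trans (by rw [map_add]; omega) h
  rw [nc_apply, co_jmul x _ _ h, mulCo, Finset.sum_eq_single (γ, β)]
  · dsimp only
    rw [co_nmon x δ γ hγ, if_pos rfl, nc_apply, ← mul_assoc]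
    congr 1
    rw [← Real.rpow_natCast, ← Real.rpow_neg hδ.le, ← Real.rpow_add hδ, map_add]
    push_cast; congr 1; ring
  · rintro ⟨a, b⟩ hab hne
    rw [Finset.HasAntidiagonal.mem_antidiagonal] at hab
    dsimp only at hab ⊢
    have ha : a.degree ≤ D := le_trans (by rw [← hab, map_add]; omega) h
    rw [co_nmon x δ γ ha, if_neg, zero_mul]
    rintro rfl
    apply hne
    rw [add_comm β a] at hab
    rw [add_left_cancel hab]
  · intro h; exact absurd (Finset.HasAntidiagonal.mem_antidiagonal.2 (add_comm γ β)) h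

lemma nc_jmul_nmon_eq_zero (x : Pt n) {δ : ℝ} (β γ : MI n) (h : β.degree ≤ D) (hn : ¬ γ ≤ β)
    (p : J n D) : nc s x δ β (jmul x (nmon D x δ γ) p) = 0 := by
  rw [nc_apply, co_jmul x _ _ h, mulCo, Finset.sum_eq_zero, mul_zero]
  rintro ⟨a, b⟩ hab
  rw [Finset.HasAntidiagonal.mem_antidiagonal] at hab
  dsimp only at hab ⊢
  have ha : a.degree ≤ D := le_trans (by rw [← hab, map_add]; omega) h
  rw [co_nmon x δ γ ha, if_neg, zero_mul]
  rintro rfl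
  exact hn (hab ▸ le_self_add)

/-- Increasing closure property of sets of multi-indices. -/
def IsUp (D : ℕ) (A : Finset (MI n)) : Prop :=
  ∀ α ∈ A, ∀ γ : MI n, (α + γ).degree ≤ D → α + γ ∈ A

lemma IsUp.co_eq_zero {A : Finset (MI n)} (hA : IsUp D A) {x : Pt n} {p : J n D}
    (h : ∀ α ∈ A, co x α p = 0) (y : Pt n) : ∀ α ∈ A, co y α p = 0 := by
  intro α hα
  rw [co_shift x y]
  refine Finset.sum_eq_zero fun β hβ => ?_
  by_cases hle : α ≤ β
  · obtain ⟨γ, rfl⟩ := exists_add_of_le hle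
    rw [h _ (hA α hα γ (mem_mset.1 hβ)), mul_zero]
  · rw [tc_eq_zero hle, zero_mul]

/-- Correction of a homogeneous jet by a dual system. -/
lemma IsDual.correct [Ord D s] {d : Dat n} {k : ℕ} {x : Pt n} {δ : ℝ} {A : Finset (MI n)}
    {C : ℝ} {R : MI n → J n D} (hR : IsDual s d k x δ A C R) (hA : A ⊆ mset n D) (hδ : 0 < δ)
    (hC : 0 ≤ C) {q : J n D} {B : ℝ} (hq : Bd s B x δ q) (hB : 0 ≤ B) :
    Sg s d k x δ (K0 n D * (B * C)) (∑ α ∈ A, nc s x δ α q • R α) ∧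
    ∀ α ∈ A, nc s x δ α (q - ∑ α ∈ A, nc s x δ α q • R α) = 0 := by
  constructor
  · refine Sg.sum_le A (by positivity) hδ.le (fun α hα => ?_) ?_
    · exact (hR α hα).1.smul_le hδ.le hC ((bd_iff_nc x hδ q B).1 hq α (mem_mset.1 (hA hα)))
    · refine le_trans ?_ (card_le_K0 n D)
      refine le_trans ?_ (card_mset_le n D)
      exact_mod_cast Finset.card_le_card hA
  · intro α hα
    rw [map_sub, map_sum, Finset.sum_eq_single α]
    · rw [map_smul, (hR α hα).2 α hα]; simp
    · intro β hβ hne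
      rw [map_smul, (hR β hβ).2 α hα, if_neg (Ne.symm hne), smul_zero]
    · exact fun h => absurd hα h

lemma exists_better_labels [Ord D s] {C : ℝ} (hC : 1 ≤ C) : ∃ C' : ℝ, 1 ≤ C' ∧
    ∀ (d : Dat n) (k : ℕ) (x : Pt n) (δ : ℝ) (A : Finset (MI n)), 0 < δ → A ⊆ mset n D →
      IsBasis D s d k x δ A C → ¬ IsUp D A →
      ∃ A' ⊆ mset n D, ews D A < ews D A' ∧ IsBasis D s d k x δ A' C' := by
  obtain ⟨Cw, hCw, hw⟩ := Gam.mul_nmon (n := n) (D := D) (s := s)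
  have hK0 := one_le_K0 n D
  have hC0 : 0 ≤ C := by linarith
  set C1 : ℝ := Cw * C + K0 n D * (Cw * C * C) with hC1
  have hC1p : 0 ≤ C1 := by positivity
  set ε : ℝ := (2 * K0 n D * C)⁻¹ with hε
  have hεp : 0 < ε := by positivity
  set Ca := C + C * (C1 / (1 / 2)) + C1 / (1 / 2)
  set Cb := C + C * (C / ε) + C / ε
  have hCa : 0 ≤ Ca := by positivity
  have hCb : 0 ≤ Cb := by positivity
  refine ⟨1 + Ca + Cb, by linarith, ?_⟩
  intro d k x δ A hδ hA ⟨R, hR⟩ hup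
  simp only [IsUp] at hup
  push Not at hup
  obtain ⟨α, hα, γ, hγ, hγA⟩ := hup
  set Q := jmul x (nmon D x δ γ) (R α) with hQ
  have hQS : Sg s d k x δ (Cw * C) Q := hw d k C δ x γ (R α) hC0 hδ (hR α hα).1.1 (hR α hα).1.2
  obtain ⟨h1, h2⟩ := hR.correct hA hδ hC0 hQS.2 (by positivity)
  have hQ1 : nc s x δ (α + γ) Q = 1 := by
    rw [hQ, nc_jmul_nmon x hδ α γ hγ, (hR α hα).2 α hα, if_pos rfl]
  have hγm : α + γ ∈ mset n D := mem_mset.2 hγ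
  by_cases hbig : 1 / 2 ≤ |nc s x δ (α + γ) (Q - ∑ α ∈ A, nc s x δ α Q • R α)|
  · refine ⟨insert (α + γ) A, Finset.insert_subset hγm hA, ews_insert hγA hγ, ?_⟩
    have := hR.add hδ hC0 hC1p (by norm_num) hγ hγA (hQS.sub h1) h2 hbig
    exact this.mono hδ.le le_rfl (show Ca ≤ _ by linarith)
  · push Not at hbig
    rw [map_sub, hQ1, map_sum] at hbig
    have hsum : 1 / 2 < |∑ β ∈ A, nc s x δ (α + γ) (nc s x δ β Q • R β)| := by
      have := abs_sub_abs_le_abs_sub (1 : ℝ) (∑ β ∈ A, nc s x δ (α + γ) (nc s x δ β Q • R β))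
      rw [abs_one] at this; linarith
    have hex : ∃ β ∈ A, (2 * K0 n D)⁻¹ ≤ |nc s x δ (α + γ) (nc s x δ β Q • R β)| := by
      by_contra hcon
      push Not at hcon
      have h3 := (Finset.abs_sum_le_sum_abs _ _).trans
        (Finset.sum_le_card_nsmul A (fun β => |nc s x δ (α + γ) (nc s x δ β Q • R β)|) _
          fun β hβ => (hcon β hβ).le)
      rw [nsmul_eq_mul] at h3
      have h4 : (A.card : ℝ) ≤ K0 n D := by
        refine le_trans ?_ (card_le_K0 n D)
        refine le_trans ?_ (card_mset_le n D)
        exact_mod_cast Finset.card_le_card hA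
      have h5 : (A.card : ℝ) * (2 * K0 n D)⁻¹ ≤ K0 n D * (2 * K0 n D)⁻¹ :=
        mul_le_mul_of_nonneg_right h4 (by positivity)
      have h6 : K0 n D * (2 * K0 n D)⁻¹ = 1 / 2 := by field_simp
      linarith
    obtain ⟨β', hβ', hβl⟩ := hex
    rw [map_smul, smul_eq_mul, abs_mul] at hβl
    have hβ'D : β'.degree ≤ D := mem_mset.1 (hA hβ')
    have hle : γ ≤ β' := by
      by_contra hn
      rw [hQ, nc_jmul_nmon_eq_zero x β' γ hβ'D hn, abs_zero, zero_mul] at hβl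
      exact absurd hβl (not_le.2 (by positivity))
    obtain ⟨β, rfl⟩ := exists_add_of_le hle
    rw [add_comm γ β] at *
    rw [hQ, nc_jmul_nmon x hδ β γ hβ'D] at hβl
    have hβD : β.degree ≤ D := le_trans (by rw [map_add]; omega) hβ'D
    have hb1 := (hR α hα).1.abs_nc_le hδ hβD
    have hb2 := (hR _ hβ').1.abs_nc_le hδ hγ
    have hεC : ε * C = (2 * K0 n D)⁻¹ := by rw [hε]; field_simp
    have hlow1 : ε ≤ |nc s x δ β (R α)| := by
      have : |nc s x δ β (R α)| * |nc s x δ (α + γ) (R (β + γ))| ≤ |nc s x δ β (R α)| * C :=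
        mul_le_mul_of_nonneg_left hb2 (abs_nonneg _)
      exact le_of_mul_le_mul_right (by linarith) (by linarith : 0 < C)
    have hlow2 : ε ≤ |nc s x δ (α + γ) (R (β + γ))| := by
      have : |nc s x δ β (R α)| * |nc s x δ (α + γ) (R (β + γ))| ≤
          C * |nc s x δ (α + γ) (R (β + γ))| := mul_le_mul_of_nonneg_right hb1 (abs_nonneg _)
      exact le_of_mul_le_mul_left (by linarith) (by linarith : 0 < C)
    have hne : β ≠ α := by rintro rfl; exact hγA hβ'
    have hβA : β ∉ A := by
      intro h
      rw [(hR α hα).2 β h, if_neg hne, abs_zero] at hlow1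
      linarith
    rcases lt_or_gt_of_ne (fun h => hne (toDegLex_inj.1 h) : toDegLex β ≠ toDegLex α) with h | h
    · refine ⟨insert β (A.erase α), Finset.insert_subset (mem_mset.2 hβD)
        ((Finset.erase_subset _ _).trans hA), ews_swap hα hβA hβD h, ?_⟩
      exact (hR.swap hδ hC0 hεp hα hβD hβA hlow1).mono hδ.le le_rfl (by linarith)
    · refine ⟨insert (α + γ) (A.erase (β + γ)), Finset.insert_subset hγm
        ((Finset.erase_subset _ _).trans hA), ews_swap hβ' hγA hγ ?_, ?_⟩
      · rw [toDegLex_add, toDegLex_add]; exact add_lt_add_left h _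
      · exact (hR.swap hδ hC0 hεp hβ' hγ hγA hlow2).mono hδ.le le_rfl (by linarith)

/-- Matrices close to the identity have bounded inverses. -/
lemma exists_left_inverse {ι : Type*} [Fintype ι] [DecidableEq ι] (G : Matrix ι ι ℝ) {ε : ℝ}
    (h : ∀ i j, |G i j - (1 : Matrix ι ι ℝ) i j| ≤ ε) (hε : (Fintype.card ι : ℝ) * ε ≤ 1 / 2) :
    ∃ H : Matrix ι ι ℝ, H * G = 1 ∧ ∀ i j, |H i j| ≤ 2 := by
  have hdet : G.det ≠ 0 := by
    refine det_ne_zero_of_sum_row_lt_diag fun k => ?_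
    have h1 : ∑ j ∈ Finset.univ.erase k, ‖G k j‖ ≤ ∑ j ∈ Finset.univ.erase k, ε := by
      refine Finset.sum_le_sum fun j hj => ?_
      have := h k j
      rwa [Matrix.one_apply_ne (Finset.ne_of_mem_erase hj).symm, sub_zero] at this
    have h2 := h k k
    rw [Matrix.one_apply_eq] at h2
    have h3 := (abs_le.1 h2).1
    have h4 : ∑ j ∈ Finset.univ.erase k, ε + ε = (Fintype.card ι : ℝ) * ε := by
      rw [Finset.sum_erase_add _ _ (Finset.mem_univ k)]; simp
    have h5 : G k k ≤ ‖G k k‖ := le_abs_self _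
    linarith
  refine ⟨G⁻¹, Matrix.nonsing_inv_mul G (isUnit_iff_ne_zero.2 hdet), fun i j => ?_⟩
  set H := G⁻¹
  have hH : H * G = 1 := Matrix.nonsing_inv_mul G (isUnit_iff_ne_zero.2 hdet)
  obtain ⟨⟨i0, j0⟩, -, hmax⟩ := Finset.exists_max_image (Finset.univ : Finset (ι × ι))
    (fun q => |H q.1 q.2|) ⟨(i, j), by simp⟩
  set m := |H i0 j0| with hm
  have hmax' : ∀ i j, |H i j| ≤ m := fun i j => hmax (i, j) (by simp)
  have e : H i0 j0 = (1 : Matrix ι ι ℝ) i0 j0 - ∑ k, H i0 k * (G k j0 - (1 : Matrix ι ι ℝ) k j0) := by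
    have : H = 1 - H * (G - 1) := by rw [mul_sub, hH]; simp
    conv_lhs => rw [this]
    rw [Matrix.sub_apply, Matrix.mul_apply]; rfl
  have h1 : m ≤ 1 + (Fintype.card ι : ℝ) * ε * m := by
    rw [hm, e]
    refine (abs_sub _ _).trans (add_le_add ?_ ?_)
    · rw [Matrix.one_apply]; split_ifs <;> simp
    · refine (Finset.abs_sum_le_sum_abs _ _).trans ?_
      have : ∀ k ∈ Finset.univ, |H i0 k * (G k j0 - (1 : Matrix ι ι ℝ) k j0)| ≤ m * ε := fun k _ => by
        rw [abs_mul]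
        exact mul_le_mul (hmax' _ _) (h _ _) (abs_nonneg _) (abs_nonneg _)
      refine (Finset.sum_le_card_nsmul _ _ _ this).trans (le_of_eq ?_)
      rw [nsmul_eq_mul, ← e, Finset.card_univ]; ring
  have hm0 : 0 ≤ m := abs_nonneg _
  have := hmax' i j
  nlinarith [mul_le_mul_of_nonneg_right hε hm0]

lemma IsBasis.transport [Ord D s] {C : ℝ} (hC : 1 ≤ C) : ∃ C' η : ℝ, 1 ≤ C' ∧ 0 < η ∧ η ≤ 1 ∧
    ∀ (d : Dat n) (k : ℕ) (x y : Pt n) (δ : ℝ) (A : Finset (MI n)), 0 < δ → A ⊆ mset n D →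
      IsBasis D s d (lev n D k) x δ A C → y ∈ d.X → dist x y ≤ η * δ →
      IsBasis D s d k y δ A C' := by
  classical
  have hK0 := one_le_K0 n D
  have hC0 : 0 ≤ C := by linarith
  have hsD : 0 < s - D := sub_pos.2 (Ord.lt)
  obtain ⟨η, hη0, hη1, hη⟩ : ∃ η : ℝ, 0 < η ∧ η ≤ 1 ∧
      K0 n D * (C * η ^ (s - D) + K0 n D * η * C) ≤ 1 / 2 := by
    have hcont : Continuous fun η : ℝ => K0 n D * (C * η ^ (s - D) + K0 n D * η * C) := by
      have : Continuous fun η : ℝ => η ^ (s - D) := Real.continuous_rpow_const hsD.le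
      fun_prop
    have h0 := hcont.tendsto 0
    simp only [Real.zero_rpow hsD.ne', mul_zero, zero_mul, add_zero] at h0
    have h1 := (h0.eventually (ge_mem_nhds (by norm_num : (0 : ℝ) < 1 / 2)))
    obtain ⟨e, he, hh⟩ := Metric.eventually_nhds_iff.1 h1
    refine ⟨min (e / 2) 1, by positivity, min_le_right _ _, hh ?_⟩
    rw [Real.dist_eq, sub_zero, abs_of_pos (by positivity)]
    exact lt_of_le_of_lt (min_le_left _ _) (by linarith)
  set ε := C * η ^ (s - D) + K0 n D * η * C with hε
  have hεp : 0 ≤ ε := by positivity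
  refine ⟨K0 n D * (2 * (K0 n D * C + C)), η, by nlinarith [mul_le_mul hK0 hC zero_le_one (by linarith)], hη0, hη1, ?_⟩
  intro d k x y δ A hδ hA ⟨R, hR⟩ hy hxy
  have hδη : 0 ≤ η * δ := by positivity
  have hq : ∀ α ∈ A, ∃ q : J n D, Gam s d k 0 y C q ∧ Bd s C y (dist x y) (R α - q) := by
    intro α hα
    obtain ⟨q, h1, -, h2⟩ := (hR α hα).1.1.transport hy
    exact ⟨q, h1, h2⟩
  choose! q hq1 hq2 using hq
  have hdδ : dist x y ≤ δ := hxy.trans (mul_le_of_le_one_left hδ.le hη1)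
  have hqS : ∀ α ∈ A, Sg s d k y δ (K0 n D * C + C) (q α) := by
    intro α hα
    refine ⟨(hq1 α hα).mono le_rfl (by nlinarith), ?_⟩
    have h1 := ((hR α hα).1.2.shift (K := 1) (y := y) hC0 hδ.le le_rfl (by linarith))
    have h2 := h1.sub ((hq2 α hα).mono_scale hC0 dist_nonneg hdδ)
    rw [show R α - (R α - q α) = q α by abel, one_pow, mul_one] at h2
    exact h2
  have hclose : ∀ α ∈ A, ∀ β ∈ A, |nc s y δ β (q α) - if β = α then 1 else 0| ≤ ε := by
    intro α hα β hβ
    have hβD := mem_mset.1 (hA hβ)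
    rw [← (hR α hα).2 β hβ]
    have h1 : |nc s y δ β (R α - q α)| ≤ C * η ^ (s - D) :=
      (bd_iff_nc y hδ _ _).1 (((hq2 α hα).mono_scale hC0 dist_nonneg hxy).shrink hC0 hη0 hη1 hδ.le)
        β hβD
    have h2 : |nc s y δ β (R α) - nc s x δ β (R α)| ≤ K0 n D * η * C := by
      have := (hR α hα).1.2.abs_co_sub_le hC0 hδ.le hη1 hxy hη0.le hβD
      rw [nc_apply, nc_apply, ← mul_sub, abs_mul, abs_of_pos (Real.rpow_pos_of_pos hδ _)]
      have h3 := mul_le_mul_of_nonneg_left this (Real.rpow_pos_of_pos hδ ((β.degree : ℝ) - s)).le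
      refine h3.trans (le_of_eq ?_)
      rw [mul_left_comm, ← Real.rpow_add hδ]; simp
    have e : nc s y δ β (q α) - nc s x δ β (R α) =
        (nc s y δ β (R α) - nc s x δ β (R α)) - nc s y δ β (R α - q α) := by
      rw [map_sub]; ring
    rw [e, hε]
    refine (abs_sub _ _).trans ?_
    linarith
  have hcard : (A.card : ℝ) ≤ K0 n D := by
    refine le_trans ?_ (card_le_K0 n D)
    refine le_trans ?_ (card_mset_le n D)
    exact_mod_cast Finset.card_le_card hA
  obtain ⟨H, hH1, hH2⟩ := exists_left_inverse (ι := A)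
    (Matrix.of fun i j => nc s y δ (j : MI n) (q i)) (ε := ε) (by
      intro i j
      have := hclose i i.2 j j.2
      rw [Matrix.one_apply, Matrix.of_apply]
      simp only [Subtype.ext_iff, eq_comm (a := (i : MI n))]
      exact this) (by
      rw [Fintype.card_coe]
      exact (mul_le_mul_of_nonneg_right hcard hεp).trans hη)
  refine ⟨fun α => if h : α ∈ A then ∑ j : A, H ⟨α, h⟩ j • q j else 0, ?_⟩
  intro α hα
  simp only [dif_pos hα]
  refine ⟨Sg.sum_le _ (by positivity) hδ.le (fun j _ => (hqS j j.2).smul_le hδ.le (by positivity)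
    (hH2 _ _)) (by rw [Finset.card_univ, Fintype.card_coe]; exact hcard), fun β hβ => ?_⟩
  have := congrFun (congrFun hH1 ⟨α, hα⟩) ⟨β, hβ⟩
  rw [Matrix.mul_apply, Matrix.one_apply] at this
  rw [map_sum]
  simp only [map_smul, smul_eq_mul]
  simp only [Matrix.of_apply, Subtype.mk.injEq, eq_comm (a := α)] at this
  exact this

/-- Separated subsets of bounded sets have bounded cardinality. -/
lemma exists_packing (n : ℕ) : ∃ N : ℕ, ∀ (Z : Finset (Pt n)) (x : Pt n) (t : ℝ), 0 < t →
    (∀ z ∈ Z, dist z x ≤ 5 * t) → (∀ z ∈ Z, ∀ w ∈ Z, z ≠ w → t ≤ dist z w) → Z.card ≤ N := by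
  classical
  obtain ⟨T, -, hTf, hT⟩ := (isCompact_closedBall (0 : Pt n) 5).finite_cover_balls
    (by norm_num : (0 : ℝ) < 1 / 2)
  lift T to Finset (Pt n) using hTf
  refine ⟨T.card, fun Z x t ht hZ hsep => ?_⟩
  have hd : ∀ z w : Pt n, dist (t⁻¹ • (z - x)) (t⁻¹ • (w - x)) = t⁻¹ * dist z w := by
    intro z w
    rw [dist_smul₀, dist_sub_right, Real.norm_of_nonneg (by positivity)]
  have hmem : ∀ z ∈ Z, ∃ c ∈ T, dist (t⁻¹ • (z - x)) c < 1 / 2 := by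
    intro z hz
    have h1 : t⁻¹ • (z - x) ∈ Metric.closedBall (0 : Pt n) 5 := by
      have := hd z x
      rw [sub_self, smul_zero] at this
      rw [Metric.mem_closedBall, this, inv_mul_le_iff₀ ht]
      linarith [hZ z hz]
    simpa using hT h1
  choose! c hcT hc using hmem
  refine Finset.card_le_card_of_injOn c hcT fun z hz w hw e => ?_
  by_contra hne
  have h1 := hsep z hz w hw hne
  have h2 := dist_triangle_right (t⁻¹ • (z - x)) (t⁻¹ • (w - x)) (c z)
  rw [hd] at h2
  have h3 := hc z hz
  have h4 := hc w hw
  rw [← e] at h4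
  have h5 : 1 ≤ t⁻¹ * dist z w := by rw [le_inv_mul_iff₀ ht]; linarith
  linarith

/-- Successive gluing of the fields `F z` with cut-offs `b z`. -/
def glue (b F : Pt n → Pt n → J n D) : List (Pt n) → Pt n → J n D
  | [], _ => 0
  | z :: L, x => jmul x (b z x) (F z x) + jmul x (jone - b z x) (glue b F L x)

lemma glue_cons_of_eq_one {b F : Pt n → Pt n → J n D} {z x : Pt n} (L : List (Pt n))
    (h : b z x = jone) : glue b F (z :: L) x = F z x := by
  rw [glue, h, sub_self, jmul_one_left, jmul_zero_left, add_zero]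

lemma glue_cons_of_eq_zero {b F : Pt n → Pt n → J n D} {z x : Pt n} (L : List (Pt n))
    (h : b z x = 0) : glue b F (z :: L) x = glue b F L x := by
  rw [glue, h, sub_zero, jmul_one_left, jmul_zero_left, zero_add]

open Classical in
/-- Induction principle for gluing. -/
lemma glue_induct {b F : Pt n → Pt n → J n D} {S : Set (Pt n)} {G : Pt n → J n D}
    (V : ℝ → (Pt n → J n D) → Prop) {a c₁ : ℝ} (ha : 1 ≤ a) (hc₁ : 0 ≤ c₁)
    (hcongr : ∀ c Q Q', (∀ x ∈ S, Q x = Q' x) → V c Q → V c Q')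
    (hadd : ∀ c c' Q Q', V c Q → V c' Q' → V (c + c') (fun x => Q x + Q' x))
    (hmono : ∀ c c' Q, c ≤ c' → V c Q → V c' Q)
    (L : List (Pt n))
    (hb : ∀ z ∈ L, (∃ x ∈ S, b z x ≠ 0) → ∀ c Q, 0 ≤ c → V c Q →
      V (a * c) (fun x => jmul x (b z x) (Q x)) ∧ V (a * c) (fun x => jmul x (jone - b z x) (Q x)))
    (hF : ∀ z ∈ L, (∃ x ∈ S, b z x ≠ 0) → V c₁ (fun x => F z x - G x))
    (hone : ∃ z ∈ L, ∀ x ∈ S, b z x = jone) (hS : S.Nonempty) (hne : (jone : J n D) ≠ 0) :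
    V ((2 * a) ^ (L.countP fun z => ∃ x ∈ S, b z x ≠ 0) * c₁) (fun x => glue b F L x - G x) := by
  induction L with
  | nil => simp at hone
  | cons z L ih =>
    by_cases h1 : ∀ x ∈ S, b z x = jone
    · obtain ⟨x, hx⟩ := hS
      refine hmono c₁ _ _ (le_mul_of_one_le_left hc₁ (one_le_pow₀ (by linarith)))
        (hcongr _ _ _ (fun y hy => ?_) (hF z (by simp) ⟨x, hx, by rw [h1 x hx]; exact hne⟩))
      rw [glue_cons_of_eq_one L (h1 y hy)]
    · have hone' : ∃ w ∈ L, ∀ x ∈ S, b w x = jone := by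
        obtain ⟨w, hw, hw1⟩ := hone
        rcases List.mem_cons.1 hw with rfl | hw
        · exact absurd hw1 h1
        · exact ⟨w, hw, hw1⟩
      have ih' := ih (fun w hw => hb w (by simp [hw])) (fun w hw => hF w (by simp [hw])) hone'
      by_cases h0 : ∃ x ∈ S, b z x ≠ 0
      · rw [List.countP_cons_of_pos (by simpa using h0)]
        set m := L.countP fun z => ∃ x ∈ S, b z x ≠ 0
        set B := (2 * a) ^ m * c₁ with hB
        have hB1 : c₁ ≤ B := le_mul_of_one_le_left hc₁ (one_le_pow₀ (by linarith))
        have hB0 : 0 ≤ B := hc₁.trans hB1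
        have e1 := (hb z (by simp) h0 B _ hB0 (hmono _ _ _ hB1 (hF z (by simp) h0))).1
        have e2 := (hb z (by simp) h0 B _ hB0 ih').2
        refine hmono _ _ _ (le_of_eq ?_) (hcongr _ _ _ (fun x _ => ?_) (hadd _ _ _ _ e1 e2))
        · rw [pow_succ, hB]; ring
        · rw [glue, jmul_sub_right, jmul_sub_right, jmul_sub_left x jone (b z x) (G x), jmul_one_left]
          abel
      · rw [List.countP_cons_of_neg (by simpa using h0)]
        push Not at h0
        refine hcongr _ _ _ (fun x hx => ?_) ih'
        rw [glue_cons_of_eq_zero L (h0 x hx)]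

lemma jone_ne_zero : (jone : J n D) ≠ 0 := by
  intro h
  have := co_jone (D := D) (0 : Pt n) 0
  rw [h, map_zero, if_pos rfl] at this
  exact zero_ne_one this

lemma bf_jone [Ord D s] {ρ : ℝ} (hρ : 0 < ρ) (S : Set (Pt n)) :
    BF s (ρ ^ (-s)) ρ S (fun _ => (jone : J n D)) := by
  refine ⟨fun x _ α hα => ?_, fun x _ y _ => ?_⟩
  · rw [co_jone, ← Real.rpow_add hρ]
    split_ifs with h
    · subst h; simp
    · simp; positivity
  · rw [sub_self]; exact Bd.zero (by positivity) dist_nonneg x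

lemma BF.rescale [Ord D s] {M ρ ρ' : ℝ} {S : Set (Pt n)} {P : Pt n → J n D}
    (h : BF s M ρ' S P) (hM : 0 ≤ M) (hρ' : 0 ≤ ρ') (hρ : 0 ≤ ρ) (hle : ρ' ≤ 2 * ρ) :
    BF s (M * 2 ^ s) ρ S P := by
  refine ⟨fun x hx => ((h.1 x hx).mono_scale hM hρ' hle).of_mul_scale hM (by norm_num) hρ,
    fun x hx y hy => (h.2 x hx y hy).mono dist_nonneg ?_⟩
  exact le_mul_of_one_le_right hM (Real.one_le_rpow (by norm_num) (Ord.pos D s).le)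

/-- Maximal separated subsets. -/
lemma exists_net (X : Finset (Pt n)) (ρ : Pt n → ℝ) (hρ : ∀ x ∈ X, 0 < ρ x) {x₀ : Pt n}
    (hx₀ : x₀ ∈ X) : ∃ Z ⊆ X, x₀ ∈ Z ∧
      (∀ z ∈ Z, ∀ w ∈ Z, z ≠ w → min (ρ z) (ρ w) ≤ dist z w) ∧
      ∀ x ∈ X, ∃ z ∈ Z, dist x z < min (ρ x) (ρ z) := by
  classical
  let Φ := X.powerset.filter fun Z => x₀ ∈ Z ∧
    ∀ z ∈ Z, ∀ w ∈ Z, z ≠ w → min (ρ z) (ρ w) ≤ dist z w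
  have hΦ : Φ.Nonempty := ⟨{x₀}, by simp [Φ, hx₀]⟩
  obtain ⟨Z, hZ, hmax⟩ := Finset.exists_max_image Φ Finset.card hΦ
  simp only [Φ, Finset.mem_filter, Finset.mem_powerset] at hZ hmax
  refine ⟨Z, hZ.1, hZ.2.1, hZ.2.2, fun x hx => ?_⟩
  by_contra hcon
  push Not at hcon
  have hxZ : x ∉ Z := fun h => by
    have := hcon x h
    rw [dist_self, min_self] at this
    exact absurd (hρ x hx) this.not_gt
  have := hmax (insert x Z) ⟨Finset.insert_subset hx hZ.1, by simp [hZ.2.1], by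
    intro z hz w hw hne
    rcases Finset.mem_insert.1 hz with h1 | h1 <;> rcases Finset.mem_insert.1 hw with h2 | h2
    · exact absurd (h1.trans h2.symm) hne
    · rw [h1]; exact hcon w h2
    · rw [h2, min_comm, dist_comm]; exact hcon z h1
    · exact hZ.2.2 z h1 w h2 hne⟩
  rw [Finset.card_insert_of_notMem hxZ] at this
  omega

/-- The cut-offs `b z`, `z ∈ L`, behave like a Whitney partition near `x` at scale `lam x`. -/
def WhitneyAt (s C : ℝ) (N : ℕ) (X₀ : Finset (Pt n)) (lam : Pt n → ℝ)
    (b : Pt n → Pt n → J n D) (L : List (Pt n)) (x : Pt n) (S : Set (Pt n)) : Prop :=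
  (∃ z ∈ L, ∀ y ∈ S, b z y = jone) ∧
  (open Classical in L.countP (fun z => ∃ y ∈ S, b z y ≠ 0) ≤ N) ∧
  ∀ z ∈ L, (∃ y ∈ S, b z y ≠ 0) → z ∈ X₀ ∧ lam z ≤ 9 / 8 * lam x ∧ dist x z ≤ lam x / 8 ∧
    S ⊆ Metric.ball z (lam z) ∧
    BF s (C * (lam x / 32) ^ (-s)) (lam x / 32) S (b z) ∧
    BF s (C * (lam x / 32) ^ (-s)) (lam x / 32) S (fun y => jone - b z y) ∧
    ∀ y, 0 ≤ co y 0 (b z y) ∧ co y 0 (b z y) ≤ 1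

lemma exists_partition [Ord D s] : ∃ (C : ℝ) (N : ℕ), 1 ≤ C ∧
    ∀ (X₀ : Finset (Pt n)) (lam : Pt n → ℝ) (x₀ : Pt n), x₀ ∈ X₀ → (∀ x ∈ X₀, 0 < lam x) →
      (∀ x ∈ X₀, ∀ y ∈ X₀, lam x ≤ lam y + dist x y) →
      ∃ (b : Pt n → Pt n → J n D) (L : List (Pt n)), b x₀ x₀ = jone ∧
        ∀ x ∈ X₀, ∀ S : Set (Pt n), x ∈ S → S ⊆ X₀ → (∀ y ∈ S, dist x y ≤ lam x / 64) →
          WhitneyAt s C N X₀ lam b (x₀ :: L) x S := by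
  classical
  obtain ⟨Cb, hCb, hbump⟩ := exists_bump n D s
  obtain ⟨N, hN⟩ := exists_packing n
  have hs := Ord.pos D s
  refine ⟨1 + Cb * 4 ^ s, N, by have : (0 : ℝ) < 4 ^ s := by positivity
                                nlinarith, fun X₀ lam x₀ hx₀ hpos hlip => ?_⟩
  obtain ⟨Z, hZX, hx₀Z, hsep, hnet⟩ := exists_net X₀ (fun z => lam z / 32)
    (fun x hx => by have := hpos x hx; positivity) hx₀
  have hb : ∀ z, ∃ b : Pt n → J n D, 0 < lam z →
      BF s (Cb * (lam z / 32) ^ (-s)) (lam z / 32) univ b ∧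
      (∀ x, dist x z ≤ 2 * (lam z / 32) → b x = jone) ∧
      (∀ x, 3 * (lam z / 32) ≤ dist x z → b x = 0) ∧
      ∀ x, 0 ≤ co x 0 (b x) ∧ co x 0 (b x) ≤ 1 := by
    intro z
    by_cases h : 0 < lam z
    · obtain ⟨b, hb⟩ := hbump z (lam z / 32) (by positivity)
      exact ⟨b, fun _ => hb⟩
    · exact ⟨0, fun h' => absurd h' h⟩
  choose b hb using hb
  have hmem : ∀ z, z ∈ x₀ :: (Z.erase x₀).toList ↔ z ∈ Z := by
    intro z
    simp only [List.mem_cons, Finset.mem_toList, Finset.mem_erase]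
    constructor
    · rintro (rfl | h)
      exacts [hx₀Z, h.2]
    · intro h
      by_cases e : z = x₀
      exacts [Or.inl e, Or.inr ⟨e, h⟩]
  have hnd : (x₀ :: (Z.erase x₀).toList).Nodup :=
    List.nodup_cons.2 ⟨by simp, Finset.nodup_toList _⟩
  refine ⟨b, (Z.erase x₀).toList, (hb x₀ (hpos x₀ hx₀)).2.1 x₀ ?_, fun x hx S hxS hSX hSx => ?_⟩
  · rw [dist_self]; have := hpos x₀ hx₀; positivity
  have hlx := hpos x hx
  have hgeo : ∀ z ∈ Z, (∃ y ∈ S, b z y ≠ 0) → lam z ≤ 9 / 8 * lam x ∧ 7 / 8 * lam x ≤ lam z ∧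
      dist z x ≤ 7 / 58 * lam x := by
    rintro z hz ⟨y, hy, hby⟩
    have hzX := hZX hz
    have h1 : dist y z < 3 * (lam z / 32) := by
      by_contra h
      exact hby ((hb z (hpos z hzX)).2.2.1 y (not_lt.1 h))
    have h2 := hSx y hy
    have h3 := dist_triangle x y z
    have h4 := hlip x hx z hzX
    have h5 := hlip z hzX x hx
    rw [dist_comm z x] at h5 ⊢
    refine ⟨by linarith, by linarith, by linarith⟩
  refine ⟨?_, ?_, ?_⟩
  · obtain ⟨z, hz, hxz⟩ := hnet x hx
    refine ⟨z, (hmem z).2 hz, fun y hy => (hb z (hpos z (hZX hz))).2.1 y ?_⟩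
    have h1 := hSx y hy
    have h2 := hlip x hx z (hZX hz)
    have h3 := dist_triangle y x z
    have h4 := lt_min_iff.1 hxz
    rw [dist_comm y x] at h3
    linarith [h4.1, h4.2]
  · rw [List.countP_eq_length_filter, ← List.toFinset_card_of_nodup (hnd.filter _)]
    refine hN _ x (7 / 8 * lam x / 32) (by positivity) (fun z hz => ?_) fun z hz w hw hne => ?_
    · simp only [List.mem_toFinset, List.mem_filter, hmem, decide_eq_true_eq] at hz
      have := (hgeo z hz.1 hz.2).2.2
      linarith
    · simp only [List.mem_toFinset, List.mem_filter, hmem, decide_eq_true_eq] at hz hw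
      refine le_trans (le_min ?_ ?_) (hsep z hz.1 w hw.1 hne)
      · have := (hgeo z hz.1 hz.2).2.1; linarith
      · have := (hgeo w hw.1 hw.2).2.1; linarith
  · intro z hz hact
    have hzZ := (hmem z).1 hz
    have hzX := hZX hzZ
    obtain ⟨g1, g2, g3⟩ := hgeo z hzZ hact
    have hlz := hpos z hzX
    have hB : BF s (Cb * 4 ^ s * (lam x / 32) ^ (-s)) (lam x / 32) S (b z) := by
      refine ((hb z hlz).1.rescale (ρ := lam x / 32) (by positivity) (by positivity)
        (by positivity) (by linarith)).mono (by positivity) ?_ (subset_univ S)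
      have h1 : (lam z / 32) ^ (-s) ≤ (lam x / 32 / 2) ^ (-s) :=
        Real.rpow_le_rpow_of_nonpos (by positivity) (by linarith) (by linarith)
      have h2 : (lam x / 32 / 2) ^ (-s) = 2 ^ s * (lam x / 32) ^ (-s) := by
        rw [Real.div_rpow (by positivity) (by norm_num), Real.rpow_neg (by norm_num : (0:ℝ) ≤ 2)]
        field_simp
      have h3 : (4 : ℝ) ^ s = 2 ^ s * 2 ^ s := by
        rw [← Real.mul_rpow (by norm_num) (by norm_num)]; norm_num
      calc Cb * (lam z / 32) ^ (-s) * 2 ^ s ≤ Cb * (2 ^ s * (lam x / 32) ^ (-s)) * 2 ^ s := by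
            rw [← h2]; gcongr
        _ = _ := by rw [h3]; ring
    refine ⟨hzX, g1, ?_, ?_, ?_, ?_, (hb z hlz).2.2.2⟩
    · rw [dist_comm]; linarith
    · intro y hy
      rw [Metric.mem_ball]
      have h1 := hSx y hy
      have h3 := dist_triangle y x z
      rw [dist_comm y x, dist_comm x z] at h3
      linarith
    · refine hB.mono (by positivity) ?_ subset_rfl
      have : 0 < (lam x / 32) ^ (-s) := by positivity
      nlinarith
    · have h1 := (bf_jone (D := D) (s := s) (show 0 < lam x / 32 by positivity) S).add (hB.smul (-1))
      have e : (fun y => (jone : J n D) + (-1 : ℝ) • b z y) = fun y => jone - b z y := by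
        funext y; rw [neg_one_smul, sub_eq_add_neg]
      rw [e] at h1
      refine h1.mono (by positivity) ?_ subset_rfl
      rw [abs_neg, abs_one, one_mul]
      exact le_of_eq (by ring)

lemma K0_le_K1 (n D : ℕ) : K0 n D ≤ K1 n D := by
  have := one_le_K0 n D
  unfold K1; nlinarith

/-- Data for gluing local fields. -/
structure GlueData (s : ℝ) (d : Dat n) (f : Pt n → ℝ) (M : ℝ) (X₀ : Finset (Pt n)) (lam : Pt n → ℝ)
    (F : Pt n → Pt n → J n D) : Prop where
  pos : ∀ x ∈ X₀, 0 < lam x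
  lip : ∀ x ∈ X₀, ∀ y ∈ X₀, lam x ≤ lam y + dist x y
  field : ∀ x ∈ X₀, IsField s d (X₀ ∩ Metric.ball x (lam x)) f M (F x)
  cons : ∀ x ∈ X₀, ∀ y ∈ X₀, Bd s M x (dist x y + lam x + lam y) (F x x - F y y)

section
variable {d : Dat n} {f : Pt n → ℝ} {M : ℝ} {X₀ : Finset (Pt n)} {lam : Pt n → ℝ}
  {F : Pt n → Pt n → J n D} {b : Pt n → Pt n → J n D} {L : List (Pt n)} {C : ℝ} {N : ℕ}

open Classical in
lemma GlueData.bf_sub [Ord D s] (H : GlueData s d f M X₀ lam F) (hM : 0 ≤ M) (hC : 1 ≤ C)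
    {x : Pt n} (hx : x ∈ X₀) {S : Set (Pt n)} (hxS : x ∈ S) (hS : S ⊆ X₀)
    (hSx : ∀ y ∈ S, dist x y ≤ lam x / 64) (hW : WhitneyAt s C N X₀ lam b L x S) :
    BF s ((2 * (K1 n D * C)) ^ N * ((2 + K0 n D) * 128 ^ s) * M) (lam x / 32) S
      (fun y => glue b F L y - F x y) := by
  have hlx := H.pos x hx
  have hK1 := one_le_K1 n D
  have hK0 := one_le_K0 n D
  have ha : 1 ≤ K1 n D * C := one_le_mul_of_one_le_of_one_le hK1 hC
  obtain ⟨hone, hcount, hact⟩ := hW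
  set ρ := lam x / 32 with hρ
  have hρ0 : 0 < ρ := by positivity
  have hpow : ρ ^ (-s) * ρ ^ s = 1 := by
    rw [← Real.rpow_add hρ0, neg_add_cancel, Real.rpow_zero]
  have hmul : ∀ (m Q : Pt n → J n D) (c : ℝ), 0 ≤ c → BF s (C * ρ ^ (-s)) ρ S m → BF s c ρ S Q →
      BF s (K1 n D * C * c) ρ S (fun y => jmul y (m y) (Q y)) := by
    intro m Q c hc hm hQ
    refine (hm.jmul hQ (by positivity) hc hρ0.le).mono hρ0.le (le_of_eq ?_) subset_rfl
    calc _ = K1 n D * C * c * (ρ ^ (-s) * ρ ^ s) := by ring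
      _ = _ := by rw [hpow, mul_one]
  have key := glue_induct (b := b) (F := F) (S := S) (G := F x) (fun c Q => BF s c ρ S Q)
    ha (c₁ := (2 + K0 n D) * 128 ^ s * M) (by positivity)
    (fun c Q Q' hQ h => ⟨fun y hy => hQ y hy ▸ h.1 y hy, fun y hy w hw => hQ y hy ▸ hQ w hw ▸ h.2 y hy w hw⟩)
    (fun c c' Q Q' h h' => h.add h') (fun c c' Q hc h => h.mono hρ0.le hc subset_rfl) L
    (fun z hz hz' c Q hc hQ => ⟨hmul _ _ c hc (hact z hz hz').2.2.2.2.1 hQ,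
      hmul _ _ c hc (hact z hz hz').2.2.2.2.2.1 hQ⟩)
    (fun z hz hz' => ?_) hone ⟨x, hxS⟩ jone_ne_zero
  · refine key.mono hρ0.le ?_ subset_rfl
    rw [mul_assoc ((2 * (K1 n D * C)) ^ N)]
    exact mul_le_mul_of_nonneg_right
      (pow_le_pow_right₀ (a := 2 * (K1 n D * C)) (by linarith) hcount) (by positivity)
  · obtain ⟨hzX, h1, h2, h3, -⟩ := hact z hz hz'
    have hlz := H.pos z hzX
    have hFz := H.field z hzX
    have hFx := H.field x hx
    have hSx' : ∀ y ∈ S, y ∈ (X₀ : Set (Pt n)) ∩ Metric.ball x (lam x) := fun y hy => ⟨hS hy, by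
      rw [Metric.mem_ball, dist_comm]; linarith [hSx y hy]⟩
    have hSz' : ∀ y ∈ S, y ∈ (X₀ : Set (Pt n)) ∩ Metric.ball z (lam z) := fun y hy => ⟨hS hy, h3 hy⟩
    have hzz : z ∈ (X₀ : Set (Pt n)) ∩ Metric.ball z (lam z) := ⟨hzX, Metric.mem_ball_self hlz⟩
    refine ⟨fun y hy => ?_, fun y hy w hw => ?_⟩
    · have hyx := hSx y hy
      have hyz : dist y z ≤ lam x / 4 := by
        have := dist_triangle y x z
        rw [dist_comm y x] at this
        linarith
      have e1 : Bd s M y (4 * lam x) (F z y - F z z) :=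
        (hFz.2.2 y (hSz' y hy) z hzz).mono_scale hM dist_nonneg (by linarith)
      have e2 : Bd s (K0 n D * M) y (4 * lam x) (F z z - F x x) := by
        have := ((H.cons z hzX x hx).mono_scale hM (by positivity)
          (δ' := 4 * lam x) (by rw [dist_comm]; linarith)).shift (K := 1) (y := y) hM (by positivity)
          le_rfl (by rw [dist_comm]; linarith)
        simpa using this
      have e3 : Bd s M y (4 * lam x) (F x x - F x y) := by
        refine ((hFx.2.2 y (hSx' y hy) x (hSx' x hxS)).mono_scale hM dist_nonneg ?_).symm
        rw [dist_comm]; linarith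
      have e4 := (e1.add e2).add e3
      rw [show F z y - F z z + (F z z - F x x) + (F x x - F x y) = F z y - F x y by abel,
        show 4 * lam x = 128 * ρ by rw [hρ]; ring] at e4
      refine (e4.of_mul_scale (by positivity) (by norm_num) hρ0.le).mono hρ0.le (le_of_eq (by ring))
    · have e1 := (hFz.2.2 y (hSz' y hy) w (hSz' w hw)).sub (hFx.2.2 y (hSx' y hy) w (hSx' w hw))
      rw [show F z y - F z w - (F x y - F x w) = F z y - F x y - (F z w - F x w) by abel] at e1
      refine e1.mono dist_nonneg ?_
      have : (1 : ℝ) ≤ 128 ^ s := Real.one_le_rpow (by norm_num) (Ord.pos D s).le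
      have : 2 ≤ (2 + K0 n D) * 128 ^ s := by nlinarith
      nlinarith

open Classical in
lemma GlueData.bd_r [Ord D s] (H : GlueData s d f M X₀ lam F) (hM : 0 ≤ M) (hC : 1 ≤ C)
    {x : Pt n} (hx : x ∈ X₀) (hW : WhitneyAt s C N X₀ lam b L x {x}) (hr : d.r x ≤ lam x / 32) :
    Bd s ((2 * (K1 n D * C)) ^ N * M) x (d.r x) (glue b F L x) := by
  have hlx := H.pos x hx
  have hK1 := one_le_K1 n D
  have hK0 := K0_pos n D
  have ha : 1 ≤ K1 n D * C := one_le_mul_of_one_le_of_one_le hK1 hC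
  obtain ⟨hone, hcount, hact⟩ := hW
  set ρ := lam x / 32 with hρ
  have hρ0 : 0 < ρ := by positivity
  have hr0 := d.r_nonneg x
  have hpow : ρ ^ (-s) * ρ ^ s = 1 := by
    rw [← Real.rpow_add hρ0, neg_add_cancel, Real.rpow_zero]
  have hmul : ∀ (m q : J n D) (c : ℝ), 0 ≤ c → Bd s (C * ρ ^ (-s)) x ρ m → Bd s c x (d.r x) q →
      Bd s (K1 n D * C * c) x (d.r x) (jmul x m q) := by
    intro m Q c hc hm hQ
    refine (hm.jmul hQ (by positivity) hc hr0 hr).mono hr0 ?_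
    calc _ = K0 n D * C * c * (ρ ^ (-s) * ρ ^ s) := by ring
      _ ≤ _ := by rw [hpow, mul_one]; gcongr; exact K0_le_K1 n D
  have key := glue_induct (b := b) (F := F) (S := {x}) (G := fun _ => 0)
    (fun c Q => Bd s c x (d.r x) (Q x)) ha hM
    (fun c Q Q' hQ h => by rw [← hQ x rfl]; exact h)
    (fun c c' Q Q' h h' => h.add h') (fun c c' Q hc h => h.mono hr0 hc) L
    (fun z hz hz' c Q hc hQ => ⟨hmul _ _ c hc ((hact z hz hz').2.2.2.2.1.1 x rfl) hQ,
      hmul _ _ c hc ((hact z hz hz').2.2.2.2.2.1.1 x rfl) hQ⟩)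
    (fun z hz hz' => ?_) hone ⟨x, rfl⟩ jone_ne_zero
  · beta_reduce at key
    rw [sub_zero] at key
    exact key.mono hr0
      (mul_le_mul_of_nonneg_right (pow_le_pow_right₀ (by linarith) hcount) hM)
  · beta_reduce
    rw [sub_zero]
    obtain ⟨hzX, h1, h2, h3, -⟩ := hact z hz hz'
    exact (H.field z hzX).1 x ⟨hx, h3 rfl⟩

lemma GlueData.co_eq (H : GlueData s d f M X₀ lam F) 
    {x : Pt n} (hx : x ∈ X₀) (hW : WhitneyAt s C N X₀ lam b L x {x}) (hE : x ∈ d.E) :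
    co x 0 (glue b F L x) = f x := by
  classical
  obtain ⟨hone, hcount, hact⟩ := hW
  have key := glue_induct (b := b) (F := F) (S := {x}) (G := fun _ => f x • jone)
    (fun _ Q => co x 0 (Q x) = 0) le_rfl le_rfl
    (fun c Q Q' hQ h => by rw [← hQ x rfl]; exact h)
    (fun c c' Q Q' h h' => by beta_reduce; rw [map_add, h, h', add_zero])
    (fun c c' Q hc h => h) L
    (fun z hz hz' c Q hc hQ => by
      beta_reduce; rw [co_zero_jmul, co_zero_jmul, hQ, mul_zero, mul_zero]; exact ⟨rfl, rfl⟩)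
    (fun z hz hz' => ?_) hone ⟨x, rfl⟩ jone_ne_zero
  · beta_reduce at key
    rw [map_sub, map_smul, co_jone, if_pos rfl, smul_eq_mul, mul_one] at key
    linarith
  · beta_reduce
    obtain ⟨hzX, h1, h2, h3, -⟩ := hact z hz hz'
    rw [map_sub, map_smul, co_jone, if_pos rfl, smul_eq_mul, mul_one,
      (H.field z hzX).2.1 x ⟨hx, h3 rfl⟩ hE, sub_self]

lemma GlueData.le_co {x : Pt n} (hW : WhitneyAt s C N X₀ lam b L x {x}) {t : ℝ}
    (ht : ∀ z ∈ X₀, dist x z < lam z → t ≤ co x 0 (F z x)) :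
    t ≤ co x 0 (glue b F L x) := by
  classical
  obtain ⟨hone, hcount, hact⟩ := hW
  have key := glue_induct (b := b) (F := F) (S := {x}) (G := fun _ => t • jone)
    (fun _ Q => 0 ≤ co x 0 (Q x)) le_rfl le_rfl
    (fun c Q Q' hQ h => by rw [← hQ x rfl]; exact h)
    (fun c c' Q Q' h h' => by beta_reduce; rw [map_add]; exact add_nonneg h h')
    (fun c c' Q hc h => h) L
    (fun z hz hz' c Q hc hQ => by
      have h01 := (hact z hz hz').2.2.2.2.2.2 x
      beta_reduce; rw [co_zero_jmul, co_zero_jmul, map_sub, co_jone, if_pos rfl]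
      exact ⟨mul_nonneg h01.1 hQ, mul_nonneg (by linarith) hQ⟩)
    (fun z hz hz' => ?_) hone ⟨x, rfl⟩ jone_ne_zero
  · beta_reduce at key
    rw [map_sub, map_smul, co_jone, if_pos rfl, smul_eq_mul, mul_one] at key
    linarith
  · beta_reduce
    obtain ⟨hzX, h1, h2, h3, -⟩ := hact z hz hz'
    rw [map_sub, map_smul, co_jone, if_pos rfl, smul_eq_mul, mul_one]
    linarith [ht z hzX (h3 rfl)]

end

/-- Gluing of consistent local fields. -/
lemma exists_glue [Ord D s] : ∃ C : ℝ, 1 ≤ C ∧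
    ∀ (d : Dat n) (f : Pt n → ℝ) (X₀ : Finset (Pt n)) (lam : Pt n → ℝ) (F : Pt n → Pt n → J n D)
      (M : ℝ) (x₀ : Pt n), 0 ≤ M → x₀ ∈ X₀ → GlueData s d f M X₀ lam F →
      ∃ P, IsField s d X₀ f (C * M) P ∧ P x₀ = F x₀ x₀ ∧
        ∀ x ∈ X₀, ∀ t, (∀ z ∈ X₀, dist x z < lam z → t ≤ co x 0 (F z x)) → t ≤ co x 0 (P x) := by
  obtain ⟨C, N, hC, hpart⟩ := exists_partition (n := n) (D := D) (s := s)
  have hK1 := one_le_K1 n D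
  have hK0 := one_le_K0 n D
  set A : ℝ := (2 * (K1 n D * C)) ^ N with hA
  have hA1 : 1 ≤ A := one_le_pow₀ (by nlinarith [one_le_mul_of_one_le_of_one_le hK1 hC])
  set B : ℝ := A * ((2 + K0 n D) * 128 ^ s) with hB
  have hB0 : 0 < B := by positivity
  refine ⟨A + (B + 1) + K0 n D * (B + 1) + (B + 1 + K0 n D * B) * 129 ^ s, ?_,
    fun d f X₀ lam F M x₀ hM hx₀ H => ?_⟩
  · have : 0 ≤ (B + 1) + K0 n D * (B + 1) + (B + 1 + K0 n D * B) * 129 ^ s := by positivity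
    linarith
  obtain ⟨b, L, hb₀, hW⟩ := hpart X₀ lam x₀ hx₀ H.pos H.lip
  have hW1 : ∀ x ∈ X₀, WhitneyAt s C N X₀ lam b (x₀ :: L) x {x} := fun x hx =>
    hW x hx {x} rfl (by simpa using hx) (by
      intro y hy; rw [mem_singleton_iff.1 hy, dist_self]; have := H.pos x hx; positivity)
  set P := glue b F (x₀ :: L) with hP
  have hx1 : ∀ x ∈ X₀, Bd s (B * M) x (lam x / 32) (P x - F x x) := fun x hx =>
    (H.bf_sub hM hC hx (mem_singleton x) (by simpa using hx) (by
      intro y hy; rw [mem_singleton_iff.1 hy, dist_self]; have := H.pos x hx; positivity)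
      (hW1 x hx)).1 x rfl
  have hclose : ∀ x ∈ X₀, ∀ y ∈ X₀, dist x y ≤ lam x / 64 →
      Bd s ((B + 1) * M) x (dist x y) (P x - P y) := by
    intro x hx y hy hxy
    have hlx := H.pos x hx
    have hS : ({x, y} : Set (Pt n)) ⊆ X₀ := by
      intro z hz
      rcases hz with rfl | hz
      · exact hx
      · rw [mem_singleton_iff.1 hz]; exact hy
    have hSx : ∀ z ∈ ({x, y} : Set (Pt n)), dist x z ≤ lam x / 64 := by
      intro z hz
      rcases hz with rfl | hz
      · rw [dist_self]; positivity
      · rw [mem_singleton_iff.1 hz]; exact hxy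
    have h1 := (H.bf_sub hM hC hx (by simp) hS hSx (hW x hx _ (by simp) hS hSx)).2 x (by simp)
      y (by simp)
    have h2 := (H.field x hx).2.2 x ⟨hx, Metric.mem_ball_self hlx⟩ y ⟨hy, by
      rw [Metric.mem_ball, dist_comm]; linarith⟩
    have h3 := h1.add h2
    rw [show glue b F (x₀ :: L) x - F x x - (glue b F (x₀ :: L) y - F x y) + (F x x - F x y) =
      P x - P y by rw [hP]; abel] at h3
    exact h3.mono dist_nonneg (le_of_eq (by ring))
  refine ⟨P, ⟨fun x hx => ?_, fun x hx hE => H.co_eq hx (hW1 x hx) hE, fun x hx y hy => ?_⟩,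
    glue_cons_of_eq_one L hb₀, fun x hx t ht => GlueData.le_co (hW1 x hx) ht⟩
  · have hr0 := d.r_nonneg x
    have hlx := H.pos x hx
    rcases le_total (d.r x) (lam x / 32) with hr | hr
    · refine (H.bd_r hM hC hx (hW1 x hx) hr).mono hr0 ?_
      refine mul_le_mul_of_nonneg_right ?_ hM
      have : 0 ≤ (B + 1) + K0 n D * (B + 1) + (B + 1 + K0 n D * B) * 129 ^ s := by positivity
      linarith
    · have h1 := ((hx1 x hx).mono_scale (by positivity) (by positivity) hr).add
        ((H.field x hx).1 x ⟨hx, Metric.mem_ball_self hlx⟩)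
      rw [sub_add_cancel] at h1
      refine h1.mono hr0 ?_
      rw [show B * M + M = (B + 1) * M by ring]
      refine mul_le_mul_of_nonneg_right ?_ hM
      have : 0 ≤ K0 n D * (B + 1) + (B + 1 + K0 n D * B) * 129 ^ s := by positivity
      linarith
  · by_cases h1 : dist x y ≤ lam x / 64
    · refine (hclose x hx y hy h1).mono dist_nonneg (mul_le_mul_of_nonneg_right ?_ hM)
      have : 0 ≤ K0 n D * (B + 1) + (B + 1 + K0 n D * B) * 129 ^ s := by positivity
      linarith
    by_cases h2 : dist x y ≤ lam y / 64
    · have h3 := (hclose y hy x hx (by rwa [dist_comm])).symm.shift (K := 1) (y := x) (by positivity)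
        dist_nonneg le_rfl (by rw [one_mul])
      rw [dist_comm y x] at h3
      refine h3.mono dist_nonneg ?_
      rw [one_pow, mul_one, ← mul_assoc]
      refine mul_le_mul_of_nonneg_right ?_ hM
      have : 0 ≤ (B + 1) + (B + 1 + K0 n D * B) * 129 ^ s := by positivity
      linarith
    push Not at h1 h2
    have hlx := H.pos x hx
    have hly := H.pos y hy
    have hd : 0 ≤ dist x y := dist_nonneg
    have e1 : Bd s (B * M) x (129 * dist x y) (P x - F x x) :=
      (hx1 x hx).mono_scale (by positivity) (by positivity) (by linarith)
    have e2 : Bd s M x (129 * dist x y) (F x x - F y y) :=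
      (H.cons x hx y hy).mono_scale hM (by positivity) (by linarith)
    have e3 : Bd s (K0 n D * (B * M)) x (129 * dist x y) (P y - F y y) := by
      have := ((hx1 y hy).mono_scale (by positivity) (by positivity)
        (δ' := 129 * dist x y) (by linarith)).shift (K := 1) (y := x) (by positivity) (by positivity)
        le_rfl (by rw [dist_comm]; linarith)
      simpa using this
    have e4 := (e1.add e2).sub e3
    rw [show P x - F x x + (F x x - F y y) - (P y - F y y) = P x - P y by abel] at e4
    refine (e4.of_mul_scale (by positivity) (by norm_num) hd).mono hd ?_
    rw [show (B * M + M + K0 n D * (B * M)) * 129 ^ s = (B + 1 + K0 n D * B) * 129 ^ s * M by ring]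
    refine mul_le_mul_of_nonneg_right ?_ hM
    have : 0 ≤ (B + 1) + K0 n D * (B + 1) := by positivity
    linarith

/-- A dual system whose labels cannot be improved at the scales in `[δ₁, δ₀]` persists at the
smaller scale `δ₁`. -/
lemma IsDual.persist [Ord D s] {d : Dat n} {k : ℕ} {x : Pt n} {δ₀ δ₁ Ca C₂ : ℝ}
    {A : Finset (MI n)} {R : MI n → J n D} (hR : IsDual s d k x δ₀ A Ca R) (hCa : 1 ≤ Ca)
    (hA : A ⊆ mset n D) (hC₂ : C₂ = (mset n D).card ^ 2 * (Ca + 1)) (hδ₁ : 0 < δ₁) (hδ : δ₁ ≤ δ₀)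
    (hno : ∀ δ, δ₁ ≤ δ → δ ≤ δ₀ → ∀ A' ⊆ mset n D, ews D A < ews D A' →
      ¬ IsBasis D s d k x δ A' (C₂ + C₂ * C₂ + C₂)) :
    IsBasis D s d k x δ₁ A C₂ := by
  classical
  have hδ₀ : 0 < δ₀ := hδ₁.trans_le hδ
  have hm : (1 : ℝ) ≤ (mset n D).card := by exact_mod_cast one_le_card_mset n D
  have hm2 : (1 : ℝ) ≤ (mset n D).card ^ 2 := one_le_pow₀ hm
  have hCaC : Ca + 1 ≤ C₂ := by rw [hC₂]; nlinarith
  let R' : ℝ → MI n → J n D := fun δ α => (δ / δ₀) ^ (s - (α.degree : ℝ)) • R α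
  have hnc : ∀ δ, 0 < δ → ∀ α β, nc s x δ β (R' δ α) =
      (δ / δ₀) ^ (s - (α.degree : ℝ)) * ((δ₀ / δ) ^ (s - (β.degree : ℝ)) * nc s x δ₀ β (R α)) := by
    intro δ hδ α β
    simp only [R', map_smul, smul_eq_mul]
    rw [nc_rescale x hδ₀ hδ]
  have hnc' : ∀ δ, 0 < δ → ∀ α β, nc s x δ β (R' δ α) =
      (δ₀ / δ) ^ ((α.degree : ℝ) - β.degree) * nc s x δ₀ β (R α) := by
    intro δ hδ α β
    have h0 : 0 < δ₀ / δ := by positivity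
    rw [hnc δ hδ, ← mul_assoc, ← inv_div δ₀ δ, Real.inv_rpow h0.le, ← Real.rpow_neg h0.le,
      ← Real.rpow_add h0]
    congr 2; ring
  have hdual : ∀ δ, δ₁ ≤ δ → δ ≤ δ₀ →
      (∀ α ∈ A, ∀ β ∈ mset n D, |nc s x δ β (R' δ α)| ≤ C₂) → IsDual s d k x δ A C₂ (R' δ) := by
    intro δ h1 h2 h α hα
    have hδp : 0 < δ := hδ₁.trans_le h1
    refine ⟨⟨?_, ?_⟩, fun β hβ => ?_⟩
    · refine ((hR α hα).1.1.smul_sig _).mono le_rfl ?_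
      have hle : (δ / δ₀) ^ (s - (α.degree : ℝ)) ≤ 1 :=
        Real.rpow_le_one (by positivity) ((div_le_one hδ₀).2 h2)
          (sub_degree_pos (s := s) (mem_mset.1 (hA hα))).le
      rw [abs_of_nonneg (by positivity)]
      nlinarith
    · rw [bd_iff_nc x hδp]
      exact fun β hβ => h α hα β (mem_mset.2 hβ)
    · rw [hnc' δ hδp, (hR α hα).2 β hβ]
      split_ifs with e
      · rw [e, sub_self, Real.rpow_zero, one_mul]
      · rw [mul_zero]
  let g : ℝ → ℝ := fun δ => ∑ α ∈ A, ∑ β ∈ mset n D, |nc s x δ β (R' δ α)|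
  have hg : ContinuousOn g (Icc δ₁ δ₀) := by
    refine continuousOn_finsetSum _ fun α _ => continuousOn_finsetSum _ fun β _ =>
      ContinuousOn.abs ?_
    have : ContinuousOn (fun δ : ℝ => (δ₀ / δ) ^ ((α.degree : ℝ) - β.degree) *
        nc s x δ₀ β (R α)) (Icc δ₁ δ₀) := by
      refine ContinuousOn.mul (ContinuousOn.rpow_const ?_ fun δ hδ => Or.inl ?_) continuousOn_const
      · exact continuousOn_const.div continuousOn_id fun δ hδ => (hδ₁.trans_le hδ.1).ne'
      · have := hδ₁.trans_le hδ.1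
        positivity
    exact this.congr fun δ hδ => hnc' δ (hδ₁.trans_le hδ.1) α β
  have hgt : ∀ δ, ∀ α ∈ A, ∀ β ∈ mset n D, |nc s x δ β (R' δ α)| ≤ g δ := by
    intro δ α hα β hβ
    refine le_trans ?_ (Finset.single_le_sum (f := fun α => ∑ β ∈ mset n D, |nc s x δ β (R' δ α)|)
      (fun α _ => Finset.sum_nonneg fun β _ => abs_nonneg _) hα)
    exact Finset.single_le_sum (f := fun β => |nc s x δ β (R' δ α)|) (fun β _ => abs_nonneg _) hβ
  have hgle : ∀ δ, (∀ α ∈ A, ∀ β ∈ mset n D, |nc s x δ β (R' δ α)| ≤ Ca) → g δ < C₂ := by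
    intro δ h
    have h1 : g δ ≤ ∑ α ∈ A, ∑ β ∈ mset n D, Ca :=
      Finset.sum_le_sum fun α hα => Finset.sum_le_sum fun β hβ => h α hα β hβ
    simp only [Finset.sum_const, nsmul_eq_mul] at h1
    have h2 : (A.card : ℝ) ≤ (mset n D).card := by exact_mod_cast Finset.card_le_card hA
    have h3 : (A.card : ℝ) * ((mset n D).card * Ca) ≤ (mset n D).card ^ 2 * Ca := by
      rw [pow_two, mul_assoc]
      exact mul_le_mul_of_nonneg_right h2 (by positivity)
    rw [hC₂]; nlinarith
  by_contra hcon
  have h1 : C₂ < g δ₁ := by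
    by_contra h
    exact hcon ⟨_, hdual δ₁ le_rfl hδ fun α hα β hβ => (hgt δ₁ α hα β hβ).trans (not_lt.1 h)⟩
  have h0 : g δ₀ < C₂ := by
    refine hgle δ₀ fun α hα β hβ => ?_
    rw [hnc' δ₀ hδ₀, div_self hδ₀.ne', Real.one_rpow, one_mul]
    exact (hR α hα).1.abs_nc_le hδ₀ (mem_mset.1 hβ)
  obtain ⟨δ, hδI, hgδ⟩ := intermediate_value_Icc' hδ hg ⟨h0.le, h1.le⟩
  have hδp : 0 < δ := hδ₁.trans_le hδI.1
  have hdδ := hdual δ hδI.1 hδI.2 fun α hα β hβ => hgδ ▸ hgt δ α hα β hβ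
  have : ∃ α ∈ A, ∃ β ∈ mset n D, Ca < |nc s x δ β (R' δ α)| := by
    by_contra h
    push Not at h
    exact absurd hgδ (hgle δ h).ne
  obtain ⟨α, hα, β, hβ, hlt⟩ := this
  have hβA : β ∉ A := by
    intro hβA
    rw [(hdδ α hα).2 β hβA] at hlt
    split_ifs at hlt <;> simp at hlt <;> linarith
  have hdeg : β.degree < α.degree := by
    by_contra h
    have h2 := (hR α hα).1.abs_nc_le hδ₀ (mem_mset.1 hβ)
    rw [hnc' δ hδp, abs_mul, abs_of_nonneg (by positivity)] at hlt
    have h3 : (δ₀ / δ) ^ ((α.degree : ℝ) - β.degree) ≤ 1 := by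
      refine Real.rpow_le_one_of_one_le_of_nonpos ((one_le_div hδp).2 hδI.2) ?_
      have : (α.degree : ℝ) ≤ β.degree := by exact_mod_cast not_lt.1 h
      linarith
    have := mul_le_mul h3 h2 (abs_nonneg _) zero_le_one
    linarith
  have hsw := hdδ.swap hδp (by linarith) one_pos hα (mem_mset.1 hβ) hβA (hCa.trans hlt.le)
  rw [div_one] at hsw
  refine hno δ hδI.1 hδI.2 _ ?_ (ews_swap hα hβA (mem_mset.1 hβ) (toDegLex_lt_of_degree_lt hdeg)) hsw
  exact Finset.insert_subset hβ ((Finset.erase_subset _ _).trans hA)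

/-- If labels cannot be improved at scale `δ`, jets annihilated by the labels are controlled. -/
lemma IsBasis.confine [Ord D s] {d : Dat n} {k : ℕ} {x : Pt n} {δ C₂ B : ℝ}
    {A : Finset (MI n)} (hb : IsBasis D s d k x δ A C₂) (hC₂ : 1 ≤ C₂)
    (hA : A ⊆ mset n D) (hδ : 0 < δ)
    (hno : ∀ A' ⊆ mset n D, ews D A < ews D A' → ¬ IsBasis D s d k x δ A' (C₂ + C₂ * C₂ + C₂))
    (hB : 0 ≤ B) {p : J n D} (hp : Gam s d k 0 x B p) (hpA : ∀ α ∈ A, co x α p = 0) :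
    Bd s B x δ p := by
  classical
  obtain ⟨R, hR⟩ := hb
  by_contra hcon
  rw [bd_iff_nc x hδ] at hcon
  push Not at hcon
  obtain ⟨β₀, hβ₀, hlt₀⟩ := hcon
  obtain ⟨β, hβ, hmax⟩ := Finset.exists_max_image (mset n D) (fun β => |nc s x δ β p|)
    ⟨β₀, mem_mset.2 hβ₀⟩
  have hlt : B < |nc s x δ β p| := hlt₀.trans_le (hmax β₀ (mem_mset.2 hβ₀))
  set m := |nc s x δ β p| with hm
  have hm0 : 0 < m := hB.trans_lt hlt
  have hβA : β ∉ A := by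
    intro h
    rw [(nc_eq_zero_iff x hδ β p).2 (hpA β h), abs_zero] at hm
    linarith
  have hq : Sg s d k x δ 1 (m⁻¹ • p) := by
    have hb : Bd s m x δ p := (bd_iff_nc x hδ p m).2 fun γ hγ => hmax γ (mem_mset.2 hγ)
    have := Sg.smul (d := d) (k := k) ⟨hp.mono le_rfl hlt.le, hb⟩ m⁻¹
    rwa [abs_of_pos (by positivity), inv_mul_cancel₀ hm0.ne'] at this
  have := hR.add hδ (by linarith) zero_le_one one_pos (mem_mset.1 hβ) hβA hq
    (fun γ hγ => by rw [map_smul, (nc_eq_zero_iff x hδ γ p).2 (hpA γ hγ), smul_zero])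
    (by rw [map_smul, smul_eq_mul, abs_mul, ← hm, abs_of_pos (by positivity),
      inv_mul_cancel₀ hm0.ne'])
  refine hno _ (Finset.insert_subset hβ hA) (ews_insert hβA (mem_mset.1 hβ))
    (this.mono hδ.le le_rfl ?_)
  nlinarith

/-- The largest scale, at most `δ₀`, at which a hereditary local property holds. -/
lemma exists_scale (X : Finset (Pt n)) (good : Pt n → ℝ → Prop) {δ₀ : ℝ} (hδ₀ : 0 < δ₀)
    (hshift : ∀ x y ρ ρ', good x ρ → ρ' + dist x y ≤ ρ → good y ρ')
    (hsmall : ∀ x ∈ X, ∃ ρ > 0, good x ρ) :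
    ∃ δ : Pt n → ℝ, ∀ x ∈ X, 0 < δ x ∧ (∀ ρ < δ x, good x ρ) ∧
      (∀ ρ ≤ δ₀, good x ρ → ρ ≤ δ x) ∧ ∀ y ∈ X, δ x ≤ δ y + dist x y := by
  have hbdd : ∀ x, BddAbove {ρ | ρ ≤ δ₀ ∧ good x ρ} := fun x => ⟨δ₀, fun ρ hρ => hρ.1⟩
  have hmin : ∀ x ∈ X, ∃ ρ > 0, ρ ≤ δ₀ ∧ good x ρ := by
    intro x hx
    obtain ⟨ρ, hρ, h⟩ := hsmall x hx
    exact ⟨min ρ δ₀, lt_min hρ hδ₀, min_le_right _ _, hshift x x ρ _ h (by simp)⟩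
  refine ⟨fun x => sSup {ρ | ρ ≤ δ₀ ∧ good x ρ}, fun x hx => ?_⟩
  obtain ⟨ρ₁, hρ₁, hρ₁'⟩ := hmin x hx
  refine ⟨hρ₁.trans_le (le_csSup (hbdd x) hρ₁'), fun ρ hρ => ?_,
    fun ρ hρ h => le_csSup (hbdd x) ⟨hρ, h⟩, fun y hy => csSup_le ⟨ρ₁, hρ₁'⟩ fun ρ hρ => ?_⟩
  · obtain ⟨ρ', hρ', hlt⟩ := exists_lt_of_lt_csSup ⟨ρ₁, hρ₁'⟩ hρ
    exact hshift x x ρ' ρ hρ'.2 (by rw [dist_self]; linarith)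
  · have : ρ - dist x y ≤ sSup {ρ | ρ ≤ δ₀ ∧ good y ρ} :=
      le_csSup (hbdd y) ⟨by linarith [hρ.1, dist_nonneg (x := x) (y := y)],
        hshift x y ρ _ hρ.2 (by linarith)⟩
    linarith

/-- Transport of a jet to a nearby point, corrected so as not to change the coefficients
labelled by `A`. -/
lemma IsBasis.adjust [Ord D s] {d : Dat n} {k : ℕ} {x y : Pt n} {δ C M : ℝ}
    {A : Finset (MI n)} {f : Pt n → ℝ} {p : J n D} (hb : IsBasis D s d k y δ A C)
    (hA : A ⊆ mset n D) (hδ : 0 < δ) (hC : 0 ≤ C) (hM : 0 ≤ M)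
    (hp : Gam s d (lev n D k) f x M p) (hy : y ∈ d.X) (hxy : dist x y ≤ δ) :
    ∃ q, Gam s d k f y ((1 + K0 n D * C) * M) q ∧ (∀ α ∈ A, co y α (q - p) = 0) ∧
      Bd s ((1 + K0 n D * C) * M) y δ (q - p) := by
  obtain ⟨R, hR⟩ := hb
  obtain ⟨q, hq, -, hpq⟩ := hp.transport hy
  have h1 : Bd s M y δ (q - p) := (hpq.mono_scale hM dist_nonneg hxy).symm
  obtain ⟨h2, h3⟩ := hR.correct hA hδ hC h1 hM
  set w := ∑ α ∈ A, nc s y δ α (q - p) • R α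
  have e : (1 + K0 n D * C) * M = M + K0 n D * (M * C) := by ring
  refine ⟨q - w, ?_, fun α hα => ?_, ?_⟩
  · have := hq.sub h2.1
    rwa [sub_zero, ← e] at this
  · rw [show q - w - p = q - p - w by abel]
    exact (nc_eq_zero_iff y hδ α _).1 (h3 α hα)
  · rw [show q - w - p = q - p - w by abel, e]
    exact h1.sub h2.2

lemma IsBasis.consistent [Ord D s] {d : Dat n} {k : ℕ} {x y : Pt n} {δ C₂ M : ℝ}
    {A : Finset (MI n)} {f : Pt n → ℝ} {p q : J n D} (hb : IsBasis D s d k y δ A C₂)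
    (hC₂ : 1 ≤ C₂) (hA : A ⊆ mset n D) (hδ : 0 < δ)
    (hno : ∀ A' ⊆ mset n D, ews D A < ews D A' → ¬ IsBasis D s d k y δ A' (C₂ + C₂ * C₂ + C₂))
    (hM : 0 ≤ M) (hp : Gam s d (lev n D k) f x M p) (hq : Gam s d k f y M q)
    (hpq : ∀ α ∈ A, co y α (p - q) = 0) (hy : y ∈ d.X) (hxy : dist x y ≤ δ) :
    Bd s (K0 n D * ((3 + 2 * (K0 n D * C₂)) * M)) x δ (p - q) := by
  have hK := K0_pos n D
  obtain ⟨t, ht, htA, htp⟩ := hb.adjust hA hδ (by linarith) hM hp hy hxy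
  have h1 := hb.confine hC₂ hA hδ hno (by positivity) (ht.sub_same hq) (fun α hα => by
    rw [show t - q = (t - p) + (p - q) by abel, map_add, htA α hα, hpq α hα, add_zero])
  have h2 := h1.sub htp
  rw [show t - q - (t - p) = p - q by abel] at h2
  have h3 := h2.shift (K := 1) (y := x) (by positivity) hδ.le le_rfl (by rw [dist_comm, one_mul]; exact hxy)
  exact h3.mono hδ.le (le_of_eq (by ring))

/-- Local extension of jets near points carrying a dual system with labels `A`. -/
def LocalExt (D : ℕ) (s : ℝ) (A : Finset (MI n)) (C : ℝ) (k : ℕ) (c C' : ℝ) : Prop :=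
  ∀ (d : Dat n) (x₀ : Pt n) (δ₀ : ℝ) (f : Pt n → ℝ) (M : ℝ) (P₀ : J n D), x₀ ∈ d.X → 0 < δ₀ →
    0 < M → IsBasis D s d k x₀ δ₀ A C → Gam s d k f x₀ M P₀ →
    ∃ P : Pt n → J n D, IsField s d (d.X ∩ Metric.ball x₀ (c * δ₀)) f (C' * M) P ∧ P x₀ = P₀

lemma LocalExt.mono {A : Finset (MI n)} {C c c' C' C'' : ℝ} {k k' : ℕ}
    (h : LocalExt D s A C k c C') (hk : k ≤ k') (hc : c' ≤ c) (hC : C' ≤ C'') :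
    LocalExt D s A C k' c' C'' := by
  intro d x₀ δ₀ f M P₀ hx₀ hδ₀ hM hb hG
  obtain ⟨P, hP, hP₀⟩ := h d x₀ δ₀ f M P₀ hx₀ hδ₀ hM (hb.mono hδ₀.le hk le_rfl) (hG.mono hk le_rfl)
  refine ⟨P, hP.mono ?_ (mul_le_mul_of_nonneg_right hC hM.le), hP₀⟩
  exact inter_subset_inter_right _ (Metric.ball_subset_ball (mul_le_mul_of_nonneg_right hc hδ₀.le))

lemma LocalExt.uniform {C : ℝ} (T : Finset (Finset (MI n)))
    (h : ∀ A ∈ T, ∃ (k : ℕ) (c C' : ℝ), 0 < c ∧ c ≤ 1 ∧ 1 ≤ C' ∧ LocalExt D s A C k c C') :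
    ∃ (k : ℕ) (c C' : ℝ), 0 < c ∧ c ≤ 1 ∧ 1 ≤ C' ∧ ∀ A ∈ T, LocalExt D s A C k c C' := by
  classical
  induction T using Finset.induction_on with
  | empty => exact ⟨0, 1, 1, one_pos, le_rfl, le_rfl, by simp⟩
  | insert A T _ ih =>
    obtain ⟨k, c, C', h1, h2, h3, h4⟩ := ih fun B hB => h B (Finset.mem_insert_of_mem hB)
    obtain ⟨k', c', C'', h1', h2', h3', h4'⟩ := h A (Finset.mem_insert_self _ _)
    refine ⟨max k k', min c c', max C' C'', lt_min h1 h1', (min_le_left _ _).trans h2,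
      h3.trans (le_max_left _ _), fun B hB => ?_⟩
    rcases Finset.mem_insert.1 hB with rfl | hB
    · exact h4'.mono (le_max_right _ _) (min_le_right _ _) (le_max_right _ _)
    · exact (h4 B hB).mono (le_max_left _ _) (min_le_left _ _) (le_max_left _ _)

set_option maxHeartbeats 1000000 in
/-- Inductive step for labels closed under multiplication. -/
lemma LocalExt.of_isUp [Ord D s] {A : Finset (MI n)} (hA : A ⊆ mset n D) (hup : IsUp D A)
    {C : ℝ} (hC : 1 ≤ C)
    (ih : ∀ C₁ : ℝ, 1 ≤ C₁ → ∃ (k : ℕ) (c C' : ℝ), 0 < c ∧ c ≤ 1 ∧ 1 ≤ C' ∧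
      ∀ A' ⊆ mset n D, ews D A < ews D A' → LocalExt D s A' C₁ k c C') :
    ∃ (k : ℕ) (c C' : ℝ), 0 < c ∧ c ≤ 1 ∧ 1 ≤ C' ∧ LocalExt D s A C k c C' := by
  classical
  have hs := Ord.pos D s
  have hK := one_le_K0 n D
  obtain ⟨Cg, hCg, hglue⟩ := exists_glue (n := n) (D := D) (s := s)
  obtain ⟨Ca, η₀, hCa, hη₀, hη₀1, htr₀⟩ := IsBasis.transport (n := n) (D := D) (s := s) hC
  obtain ⟨C₂, hC₂⟩ : ∃ C₂ : ℝ, C₂ = (mset n D).card ^ 2 * (Ca + 1) := ⟨_, rfl⟩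
  have hC₂1 : 1 ≤ C₂ := by
    have hm : (1 : ℝ) ≤ (mset n D).card := by exact_mod_cast one_le_card_mset n D
    have hm2 : (1 : ℝ) ≤ (mset n D).card ^ 2 := one_le_pow₀ hm
    rw [hC₂]; nlinarith
  obtain ⟨C₁, η₁, hC₁, hη₁, hη₁1, htr₁⟩ := IsBasis.transport (n := n) (D := D) (s := s)
    (C := C₂ + C₂ * C₂ + C₂) (by nlinarith)
  obtain ⟨ks, c', Cs, hc', hc'1, hCs, hloc⟩ := ih C₁ hC₁
  obtain ⟨cs, hcs⟩ : ∃ cs, cs = min c' η₁ := ⟨_, rfl⟩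
  have hcs0 : 0 < cs := hcs ▸ lt_min hc' hη₁
  have hcsc : cs ≤ c' := hcs ▸ min_le_left _ _
  have hcsη : cs ≤ η₁ := hcs ▸ min_le_right _ _
  have hcs1 : cs ≤ 1 := hcsc.trans hc'1
  set m₁ := 1 + K0 n D * Ca with hm₁
  have hm₁0 : 1 ≤ m₁ := by have : 0 ≤ K0 n D * Ca := by positivity
                           linarith
  set C₄ := (K0 n D * (3 + 2 * (K0 n D * C₂)) + (1 + K0 n D)) * m₁ * (4 / cs) ^ s with hC₄
  have hC₄0 : 0 ≤ C₄ := by positivity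
  refine ⟨lev n D (lev n D (lev n D ks)), η₀, Cg * (Cs * m₁ + C₄), hη₀, hη₀1, ?_, ?_⟩
  · refine one_le_mul_of_one_le_of_one_le hCg ?_
    nlinarith
  intro d x₀ δ₀ f M P₀ hx₀ hδ₀ hM hb hG
  set M₁ := m₁ * M with hM₁
  have hM₁0 : 0 < M₁ := by positivity
  have hMM₁ : M ≤ M₁ := le_mul_of_one_le_left hM.le hm₁0
  let good : Pt n → ℝ → Prop := fun x ρ => ∀ y ∈ d.X, dist x y < ρ → ∀ p : J n D,
    Gam s d ks f y M₁ p → ∃ P : Pt n → J n D,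
      IsField s d (d.X ∩ Metric.ball y ρ) f (Cs * M₁) P ∧ P y = p
  obtain ⟨δ, hδ⟩ := exists_scale d.X good hδ₀
    (fun x y ρ ρ' hx hρ z hz hyz p hp => by
      have h0 := dist_nonneg (x := x) (y := y)
      obtain ⟨P, hP, hPz⟩ := hx z hz (by linarith [dist_triangle x y z]) p hp
      exact ⟨P, hP.mono (inter_subset_inter_right _ (Metric.ball_subset_ball (by linarith))) le_rfl,
        hPz⟩)
    (fun x hx => by
      obtain ⟨ρ, hρ, hsep⟩ : ∃ ρ > 0, ∀ y ∈ d.X, dist x y < ρ → y = x := by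
        by_cases he : (d.X.erase x).Nonempty
        · obtain ⟨y, hy, hmin⟩ := Finset.exists_min_image (d.X.erase x) (fun y => dist x y) he
          refine ⟨dist x y, dist_pos.2 (Finset.ne_of_mem_erase hy).symm, fun z hz hlt => ?_⟩
          by_contra hne
          exact absurd (hmin z (Finset.mem_erase.2 ⟨hne, hz⟩)) hlt.not_ge
        · refine ⟨1, one_pos, fun y hy _ => ?_⟩
          by_contra hne
          exact he ⟨y, Finset.mem_erase.2 ⟨hne, hy⟩⟩
      refine ⟨ρ, hρ, fun y hy hxy p hp => ?_⟩
      obtain ⟨P, hP, hPy⟩ := hp ∅ (by simp) (by simp)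
      refine ⟨P, hP.mono (fun z hz => ?_) (le_mul_of_one_le_left hM₁0.le hCs), hPy⟩
      rw [hsep y hy hxy] at hz ⊢
      left
      exact hsep z hz.1 (by rw [dist_comm]; exact hz.2))
  have hno : ∀ x ∈ d.X, ∀ δ', 0 < δ' → δ x < cs * δ' → δ' ≤ δ₀ → ∀ A' ⊆ mset n D,
      ews D A < ews D A' → ¬ IsBasis D s d (lev n D ks) x δ' A' (C₂ + C₂ * C₂ + C₂) := by
    intro x hx δ' hδ' hlt hle A' hA' hew hbas
    refine absurd ((hδ x hx).2.2.1 (cs * δ') (by nlinarith) fun y hy hxy p hp => ?_) hlt.not_ge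
    have h1 := htr₁ d ks x y δ' A' hδ' hA' hbas hy (by nlinarith)
    obtain ⟨P, hP, hPy⟩ := hloc A' hA' hew d y δ' f M₁ p hy hδ' hM₁0 h1 hp
    exact ⟨P, hP.mono (inter_subset_inter_right _ (Metric.ball_subset_ball (by nlinarith))) le_rfl,
      hPy⟩
  set X₀ : Finset (Pt n) := d.X.filter fun x => dist x x₀ < η₀ * δ₀ with hX₀
  have hX₀X : ∀ x ∈ X₀, x ∈ d.X := fun x hx => (Finset.mem_filter.1 hx).1
  have hx₀X : x₀ ∈ X₀ := Finset.mem_filter.2 ⟨hx₀, by rw [dist_self]; positivity⟩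
  have hbas : ∀ x ∈ X₀, IsBasis D s d (lev n D (lev n D ks)) x δ₀ A Ca := fun x hx =>
    htr₀ d _ x₀ x δ₀ A hδ₀ hA hb (hX₀X x hx) (by
      rw [dist_comm]; exact (Finset.mem_filter.1 hx).2.le)
  have hjet : ∀ x, ∃ p : J n D, (x = x₀ → p = P₀) ∧ (x ∈ X₀ →
      Gam s d (lev n D (lev n D ks)) f x M₁ p ∧ (∀ α ∈ A, co x α (p - P₀) = 0) ∧
      Bd s M₁ x δ₀ (p - P₀)) := by
    intro x
    by_cases e : x = x₀
    · subst e
      refine ⟨P₀, fun _ => rfl, fun _ => ⟨hG.mono (le_lev _ _ _) hMM₁, ?_, ?_⟩⟩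
      · simp
      · rw [sub_self]; exact Bd.zero hM₁0.le hδ₀.le _
    by_cases hx : x ∈ X₀
    · obtain ⟨q, h1, h2, h3⟩ := (hbas x hx).adjust hA hδ₀ (by linarith) hM.le hG (hX₀X x hx) (by
        have := (Finset.mem_filter.1 hx).2
        rw [dist_comm]; nlinarith)
      exact ⟨q, fun h => absurd h e, fun _ => ⟨h1, h2, h3⟩⟩
    · exact ⟨0, fun h => absurd h e, fun h => absurd h hx⟩
  choose pj hpj₀ hpj using hjet
  have hfld : ∀ x, ∃ F : Pt n → J n D, x ∈ X₀ →
      IsField s d (d.X ∩ Metric.ball x (δ x / 2)) f (Cs * M₁) F ∧ F x = pj x := by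
    intro x
    by_cases hx : x ∈ X₀
    · have h0 := (hδ x (hX₀X x hx)).1
      obtain ⟨P, hP⟩ := (hδ x (hX₀X x hx)).2.1 (δ x / 2) (by linarith) x (hX₀X x hx)
        (by rw [dist_self]; positivity) (pj x)
        ((hpj x hx).1.mono ((le_lev _ _ _).trans (le_lev _ _ _)) le_rfl)
      exact ⟨P, fun _ => hP⟩
    · exact ⟨0, fun h => absurd h hx⟩
  choose F hF using hfld
  have hcons : ∀ x ∈ X₀, ∀ y ∈ X₀, ∀ t, 0 < t → dist x y ≤ t → δ y < cs * t →
      Bd s ((K0 n D * (3 + 2 * (K0 n D * C₂)) + (1 + K0 n D)) * M₁) x t (pj x - pj y) := by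
    intro x hx y hy t ht hxy hty
    obtain ⟨gx, vx, bx⟩ := hpj x hx
    obtain ⟨gy, vy, by'⟩ := hpj y hy
    rcases le_total δ₀ t with hle | hle
    · have h1 := bx.mono_scale hM₁0.le hδ₀.le hle
      have h2 := (by'.mono_scale hM₁0.le hδ₀.le hle).shift (K := 1) (y := x) hM₁0.le ht.le le_rfl
        (by rw [dist_comm, one_mul]; exact hxy)
      have h3 := h1.sub h2
      rw [show pj x - P₀ - (pj y - P₀) = pj x - pj y by abel] at h3
      refine h3.mono ht.le ?_
      have : 0 ≤ K0 n D * (3 + 2 * (K0 n D * C₂)) * M₁ := by positivity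
      rw [one_pow, mul_one, add_mul, add_mul 1, one_mul]
      linarith only [this]
    · have hyX := hX₀X y hy
      have hno' : ∀ t', t ≤ t' → t' ≤ δ₀ → ∀ A' ⊆ mset n D, ews D A < ews D A' →
          ¬ IsBasis D s d (lev n D ks) y t' A' (C₂ + C₂ * C₂ + C₂) := fun t' h1 h2 =>
        hno y hyX t' (ht.trans_le h1) (hty.trans_le (by nlinarith)) h2
      obtain ⟨R, hR⟩ := (hbas y hy).mono hδ₀.le (le_lev n D (lev n D ks)) le_rfl
      have hby := hR.persist hCa hA hC₂ ht hle hno'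
      have h1 := hby.consistent hC₂1 hA ht (hno' t le_rfl hle) hM₁0.le gx
        (gy.mono (le_lev _ _ _) le_rfl) (fun α hα => by
          rw [show pj x - pj y = (pj x - P₀) - (pj y - P₀) by abel, map_sub,
            hup.co_eq_zero vx y α hα, vy α hα, sub_zero]) hyX hxy
      refine h1.mono ht.le ?_
      have : 0 ≤ (1 + K0 n D) * M₁ := by positivity
      linarith only [this]
  have H : GlueData s d f ((Cs * m₁ + C₄) * M) X₀ (fun x => δ x / 2) F := by
    refine ⟨fun x hx => half_pos (hδ x (hX₀X x hx)).1, fun x hx y hy => ?_, fun x hx => ?_,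
      fun x hx y hy => ?_⟩
    · have := (hδ x (hX₀X x hx)).2.2.2 y (hX₀X y hy)
      have h0 := dist_nonneg (x := x) (y := y)
      linarith
    · refine (hF x hx).1.mono (inter_subset_inter_left _ fun y hy => hX₀X y hy) ?_
      rw [hM₁, ← mul_assoc]
      exact mul_le_mul_of_nonneg_right (by linarith) hM.le
    · rw [(hF x hx).2, (hF y hy).2]
      have h0 := dist_nonneg (x := x) (y := y)
      have hx0 := (hδ x (hX₀X x hx)).1
      have hy0 := (hδ y (hX₀X y hy)).1
      set u := dist x y + δ x / 2 + δ y / 2 with hu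
      have hu0 : 0 < u := by positivity
      have h4 : 4 ≤ 4 / cs := (le_div_iff₀ hcs0).2 (by linarith)
      have h1 := hcons x hx y hy (4 / cs * u) (by positivity) (by nlinarith) (by
        rw [← mul_assoc, mul_div_cancel₀ _ hcs0.ne']; linarith)
      refine (h1.of_mul_scale (by positivity) (by linarith) hu0.le).mono hu0.le ?_
      rw [hC₄, hM₁]
      have : 0 ≤ Cs * m₁ * M := by positivity
      linarith only [this]
  obtain ⟨P, hP, hPx₀, -⟩ := hglue d f X₀ _ F _ x₀ (by positivity) hx₀X H
  refine ⟨P, hP.mono (fun x hx => ?_) (le_of_eq (by ring)), ?_⟩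
  · exact Finset.mem_coe.2 (Finset.mem_filter.2 ⟨hx.1, hx.2⟩)
  · rw [hPx₀, (hF x₀ hx₀X).2, hpj₀ x₀ rfl]

lemma exists_localExt [Ord D s] (A : Finset (MI n)) (hA : A ⊆ mset n D) {C : ℝ} (hC : 1 ≤ C) :
    ∃ (k : ℕ) (c C' : ℝ), 0 < c ∧ c ≤ 1 ∧ 1 ≤ C' ∧ LocalExt D s A C k c C' := by
  classical
  induction hm : ews D (mset n D) - ews D A using Nat.strong_induction_on generalizing A C with
  | _ m ih =>
  have ih' : ∀ C₁ : ℝ, 1 ≤ C₁ → ∃ (k : ℕ) (c C' : ℝ), 0 < c ∧ c ≤ 1 ∧ 1 ≤ C' ∧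
      ∀ A' ⊆ mset n D, ews D A < ews D A' → LocalExt D s A' C₁ k c C' := by
    intro C₁ hC₁
    obtain ⟨k, c, C', h1, h2, h3, h4⟩ := LocalExt.uniform (D := D) (s := s) (C := C₁)
      ((mset n D).powerset.filter fun A' => ews D A < ews D A') (fun A' hA' => by
        obtain ⟨hA1, hA2⟩ := Finset.mem_filter.1 hA'
        have hA3 := Finset.mem_powerset.1 hA1
        have := ews_le hA3
        exact ih _ (by omega) A' hA3 hC₁ rfl)
    exact ⟨k, c, C', h1, h2, h3, fun A' hA' hlt =>
      h4 A' (Finset.mem_filter.2 ⟨Finset.mem_powerset.2 hA', hlt⟩)⟩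
  by_cases hup : IsUp D A
  · exact LocalExt.of_isUp hA hup hC ih'
  · obtain ⟨C₁, hC₁, hrel⟩ := exists_better_labels (n := n) (D := D) (s := s) hC
    obtain ⟨k, c, C', h1, h2, h3, h4⟩ := ih' C₁ hC₁
    refine ⟨k, c, C', h1, h2, h3, fun d x₀ δ₀ f M P₀ hx₀ hδ₀ hM hb hG => ?_⟩
    obtain ⟨A', hA', hlt, hb'⟩ := hrel d k x₀ δ₀ A hδ₀ hA hb hup
    exact h4 A' hA' hlt d x₀ δ₀ f M P₀ hx₀ hδ₀ hM hb' hG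

/-- Finiteness principle for Whitney fields on finite sets. -/
lemma exists_field_of_small [Ord D s] : ∃ (k : ℕ) (C : ℝ), 1 ≤ C ∧
    ∀ (d : Dat n) (f : Pt n → ℝ) (M : ℝ), 0 < M →
      (∀ S ⊆ d.X, S.card ≤ k → ∃ P : Pt n → J n D, IsField s d S f M P) →
      ∃ P : Pt n → J n D, IsField s d d.X f (C * M) P := by
  obtain ⟨k, c, C, hc, -, hC, hloc⟩ := exists_localExt (n := n) (D := D) (s := s) ∅ (by simp)
    (le_refl (1 : ℝ))
  refine ⟨lev n D k, C, hC, fun d f M hM h => ?_⟩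
  rcases d.X.eq_empty_or_nonempty with he | ⟨x₀, hx₀⟩
  · exact ⟨0, by simp [IsField, he]⟩
  obtain ⟨p, hp⟩ := Gam.nonempty_of_fields hx₀ h
  set B := ∑ x ∈ d.X, dist x x₀ with hB
  have hB0 : 0 ≤ B := Finset.sum_nonneg fun _ _ => dist_nonneg
  obtain ⟨P, hP, -⟩ := hloc d x₀ ((B + 1) / c) f M p hx₀ (by positivity) hM ⟨0, by simp [IsDual]⟩ hp
  refine ⟨P, hP.mono (fun x hx => ⟨hx, ?_⟩) le_rfl⟩
  rw [mul_div_cancel₀ _ hc.ne', Metric.mem_ball]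
  have := Finset.single_le_sum (f := fun x => dist x x₀) (fun _ _ => dist_nonneg) hx
  beta_reduce at this
  linarith

/-- Compactness: fields on all finite sets yield a field on the whole space. -/
lemma exists_limit_field {M : ℝ} {r : Pt n → ℝ} {V : Pt n → Set ℝ} (hV : ∀ z, IsClosed (V z))
    (h : ∀ T : Finset (Pt n), ∃ P : Pt n → J n D,
      (∀ z ∈ T, Bd s M z (r z) (P z) ∧ co z 0 (P z) ∈ V z) ∧
        ∀ z ∈ T, ∀ w ∈ T, Bd s M z (dist z w) (P z - P w)) :
    ∃ P : Pt n → J n D, (∀ z, Bd s M z (r z) (P z) ∧ co z 0 (P z) ∈ V z) ∧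
      ∀ z w, Bd s M z (dist z w) (P z - P w) := by
  choose P hP hP' using h
  set U : Ultrafilter (Finset (Pt n)) := Ultrafilter.of Filter.atTop
  have hU : ∀ z : Pt n, ∀ᶠ T in (U : Filter (Finset (Pt n))), z ∈ T := fun z =>
    Ultrafilter.of_le _ ((Filter.eventually_ge_atTop {z}).mono fun T hT => hT (by simp))
  have hlim : ∀ (z : Pt n) (α : MI n), ∃ L : ℝ, α.degree ≤ D →
      Filter.Tendsto (fun T => co z α (P T z)) U (nhds L) := by
    intro z α
    by_cases hα : α.degree ≤ D
    · have hK : IsCompact (Icc (-(M * r z ^ (s - α.degree))) (M * r z ^ (s - α.degree))) :=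
        isCompact_Icc
      obtain ⟨L, -, hL⟩ := hK.ultrafilter_le_nhds (U.map fun T => co z α (P T z)) (by
        rw [Filter.le_principal_iff]
        exact (hU z).mono fun T hT => abs_le.1 ((hP T z hT).1 α hα))
      exact ⟨L, fun _ => hL⟩
    · exact ⟨0, fun hh => absurd hh hα⟩
  choose L hL using hlim
  have key : ∀ z w (α : MI n), α.degree ≤ D →
      Filter.Tendsto (fun T => co z α (P T w)) U (nhds (co z α (ofCo (D := D) w (L w)))) := by
    intro z w α hα
    simp_rw [co_shift w z α]
    refine tendsto_finsetSum _ fun β hβ => Filter.Tendsto.const_mul _ ?_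
    rw [co_ofCo _ _ (mem_mset.1 hβ)]
    exact hL w β (mem_mset.1 hβ)
  refine ⟨fun w => ofCo w (L w), fun z => ⟨fun α hα => ?_, ?_⟩, fun z w α hα => ?_⟩
  · exact le_of_tendsto (key z z α hα).abs ((hU z).mono fun T hT => (hP T z hT).1 α hα)
  · exact (hV z).mem_of_tendsto (key z z 0 (by simp)) ((hU z).mono fun T hT => (hP T z hT).2)
  · rw [map_sub]
    refine le_of_tendsto ((key z z α hα).sub (key z w α hα)).abs ?_
    filter_upwards [hU z, hU w] with T hz hw
    rw [← map_sub]
    exact hP' T z hz w hw α hα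

lemma bd_smul_jone {M δ c : ℝ} (hM : 0 ≤ M) (hδ : 0 ≤ δ) (x : Pt n) (h : |c| ≤ M * δ ^ s) :
    Bd s M x δ (c • (jone : J n D)) := by
  intro α _
  rw [map_smul, co_jone, smul_eq_mul]
  split_ifs with h0
  · subst h0; simpa using h
  · rw [mul_zero, abs_zero]; positivity

/-- A regularisation of the power `δ ^ s` of a Lipschitz function. -/
lemma exists_regularised_power [Ord D s] : ∃ C : ℝ, 1 ≤ C ∧ ∀ δ : Pt n → ℝ, (∀ z, 0 ≤ δ z) →
    (∀ z w, δ z ≤ δ w + dist z w) → ∃ Φ : Pt n → J n D,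
      (∀ z, Bd s C z (δ z) (Φ z) ∧ (δ z / 2) ^ s ≤ co z 0 (Φ z)) ∧
        ∀ z w, Bd s C z (dist z w) (Φ z - Φ w) := by
  classical
  obtain ⟨C, hC, hglue⟩ := exists_glue (n := n) (D := D) (s := s)
  have hs := Ord.pos D s
  have h2s : (1 : ℝ) ≤ 2 ^ s := Real.one_le_rpow (by norm_num) hs.le
  have hK0 := one_le_K0 n D
  have hC2 : 1 ≤ C * 2 ^ s := one_le_mul_of_one_le_of_one_le hC h2s
  refine ⟨K0 n D * (C * 2 ^ s), one_le_mul_of_one_le_of_one_le hK0 hC2, fun δ hδ hlip => ?_⟩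
  have hCC : C * 2 ^ s ≤ K0 n D * (C * 2 ^ s) := le_mul_of_one_le_left (by linarith) hK0
  refine exists_limit_field (V := fun z => Ici ((δ z / 2) ^ s)) (fun z => isClosed_Ici) fun T => ?_
  set X₀ := T.filter fun z => 0 < δ z with hX₀
  have hmem : ∀ z, z ∈ X₀ ↔ z ∈ T ∧ 0 < δ z := fun z => Finset.mem_filter
  have hglued : ∃ P : Pt n → J n D, (∀ z ∈ X₀, Bd s (C * 2 ^ s) z (δ z) (P z) ∧
      (δ z / 2) ^ s ≤ co z 0 (P z)) ∧
      ∀ z ∈ X₀, ∀ w ∈ X₀, Bd s (C * 2 ^ s) z (dist z w) (P z - P w) := by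
    rcases X₀.eq_empty_or_nonempty with h0 | ⟨x₀, hx₀⟩
    · exact ⟨0, by simp [h0]⟩
    have H : GlueData s ⟨X₀, ∅, δ, hδ⟩ 0 (2 ^ s) X₀ (fun z => δ z / 2)
        (fun z _ => δ z ^ s • (jone : J n D)) := by
      refine ⟨fun x hx => half_pos ((hmem x).1 hx).2, fun x _ y _ => ?_, fun x hx => ⟨?_, ?_, ?_⟩,
        fun x hx y hy => ?_⟩
      · have := hlip x y
        have := dist_nonneg (x := x) (y := y)
        linarith
      · rintro z ⟨-, hz⟩
        have hz' : dist z x < δ x / 2 := hz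
        refine bd_smul_jone (by linarith) (hδ z) z ?_
        rw [abs_of_nonneg (Real.rpow_nonneg (hδ x) s), ← Real.mul_rpow (by norm_num) (hδ z)]
        have := hlip x z
        rw [dist_comm] at this
        exact Real.rpow_le_rpow (hδ x) (by linarith) hs.le
      · rintro z _ ⟨⟩
      · intro z _ w _
        rw [sub_self]
        exact Bd.zero (by linarith) dist_nonneg z
      · beta_reduce
        rw [← sub_smul]
        have h0 := dist_nonneg (x := x) (y := y)
        refine bd_smul_jone (by linarith) (by linarith [hδ x, hδ y]) x ?_
        rw [← Real.mul_rpow (by norm_num) (by linarith [hδ x, hδ y])]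
        exact abs_sub_le_of_nonneg_of_le (Real.rpow_nonneg (hδ x) s)
          (Real.rpow_le_rpow (hδ x) (by linarith [hδ y]) hs.le) (Real.rpow_nonneg (hδ y) s)
          (Real.rpow_le_rpow (hδ y) (by linarith [hδ x]) hs.le)
    obtain ⟨P, hP, -, hlow⟩ := hglue _ _ X₀ _ _ _ x₀ (by linarith) hx₀ H
    refine ⟨P, fun z hz => ⟨hP.1 z hz, hlow z hz _ fun w hw hzw => ?_⟩, hP.2.2⟩
    rw [map_smul, co_jone, if_pos rfl, smul_eq_mul, mul_one]
    exact Real.rpow_le_rpow (by linarith [hδ z]) (by linarith [hlip z w, hδ w]) hs.le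
  obtain ⟨P, hP, hP'⟩ := hglued
  refine ⟨fun z => if 0 < δ z then P z else 0, fun z hz => ?_, fun z hz w hw => ?_⟩
  · by_cases hz0 : 0 < δ z
    · have := hP z ((hmem z).2 ⟨hz, hz0⟩)
      simp only [if_pos hz0]
      exact ⟨this.1.mono (hδ z) hCC, this.2⟩
    · have e : δ z = 0 := le_antisymm (not_lt.1 hz0) (hδ z)
      simp only [if_neg hz0, map_zero]
      refine ⟨Bd.zero (by linarith) (hδ z) z, ?_⟩
      rw [e, mem_Ici, zero_div, Real.zero_rpow hs.ne']
  · by_cases hz0 : 0 < δ z <;> by_cases hw0 : 0 < δ w <;> simp only [hz0, hw0, if_true, if_false]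
    · exact (hP' z ((hmem z).2 ⟨hz, hz0⟩) w ((hmem w).2 ⟨hw, hw0⟩)).mono dist_nonneg hCC
    · rw [sub_zero]
      refine ((hP z ((hmem z).2 ⟨hz, hz0⟩)).1.mono_scale (by linarith) (hδ z) ?_).mono dist_nonneg hCC
      linarith [hlip z w]
    · rw [zero_sub]
      have h1 := (hP w ((hmem w).2 ⟨hw, hw0⟩)).1.mono_scale (δ' := dist z w) (by linarith) (hδ w)
        (by rw [dist_comm]; linarith [hlip w z])
      have h2 := h1.shift (K := 1) (y := z) (by linarith) dist_nonneg le_rfl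
        (by rw [dist_comm, one_mul])
      rw [one_pow, mul_one] at h2
      exact h2.neg
    · rw [sub_zero]
      exact Bd.zero (by linarith) dist_nonneg z

lemma Bd.of_forall_gt [Ord D s] {M δ : ℝ} {x : Pt n} {p : J n D}
    (h : ∀ t, δ < t → Bd s M x t p) : Bd s M x δ p := by
  intro α hα
  have hc : Continuous fun t : ℝ => M * t ^ (s - (α.degree : ℝ)) :=
    continuous_const.mul (Real.continuous_rpow_const (sub_degree_pos (s := s) hα).le)
  exact ge_of_tendsto (hc.continuousWithinAt (s := Ioi δ) (x := δ))
    (eventually_mem_nhdsWithin.mono fun t ht => h t ht α hα)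

lemma exists_small_param (hs : 0 < s) {a b ε : ℝ} (hε : 0 < ε) :
    ∃ c : ℝ, 0 < c ∧ c ≤ 1 / 2 ∧ a * c + b * c ^ s ≤ ε := by
  have hc : Continuous fun t : ℝ => a * t + b * t ^ s :=
    (continuous_const.mul continuous_id).add
      (continuous_const.mul (Real.continuous_rpow_const hs.le))
  have h1 : ∀ᶠ t in nhdsWithin (0 : ℝ) (Ioi 0), a * t + b * t ^ s < ε :=
    (hc.continuousWithinAt (s := Ioi 0) (x := 0)).eventually_lt_const
      (by simpa [Real.zero_rpow hs.ne'] using hε)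
  have h2 : ∀ᶠ t in nhdsWithin (0 : ℝ) (Ioi 0), t ∈ Ioc (0 : ℝ) (1 / 2) :=
    Ioc_mem_nhdsGT (by norm_num)
  obtain ⟨c, h, hc⟩ := (h1.and h2).exists
  exact ⟨c, hc.1, hc.2, h.le⟩

/-- A Whitney field with flat nonnegative values on `E` can be modified off `E` to become flat and
nonnegative everywhere. -/
lemma exists_flat_field [Ord D s] {A : ℝ} (hA : 1 ≤ A) : ∃ C c : ℝ, 1 ≤ C ∧ 0 < c ∧ c ≤ 1 ∧
    ∀ (E : Set (Pt n)) (r : Pt n → ℝ) (P : Pt n → J n D), E.Nonempty → (∀ z, 0 ≤ r z) →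
      (∀ z, r z ≤ 1) → (∀ z, Bd s A z (r z) (P z)) → (∀ z ∈ E, co z 0 (P z) = r z ^ s) →
      (∀ z w, Bd s A z (dist z w) (P z - P w)) →
      ∃ (Q : Pt n → J n D) (R : Pt n → ℝ), (∀ z, 0 ≤ R z) ∧ (∀ z, R z ≤ 1) ∧
        (∀ z, Bd s C z (R z) (Q z)) ∧ (∀ z, c * R z ^ s ≤ co z 0 (Q z)) ∧
        (∀ z ∈ E, co z 0 (Q z) = r z ^ s) ∧ ∀ z w, Bd s C z (dist z w) (Q z - Q w) := by
  obtain ⟨CΦ, hCΦ, hreg⟩ := exists_regularised_power (n := n) (D := D) (s := s)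
  have hs := Ord.pos D s
  have hK0 := one_le_K0 n D
  set A₂ : ℝ := A + K0 n D * A with hA₂
  have hA₂A : A ≤ A₂ := by have : 0 ≤ K0 n D * A := by positivity
                           linarith
  set c : ℝ := (1 / 2) ^ s / 2 with hc
  have hc0 : 0 < c := by positivity
  obtain ⟨c₁, hc₁, hc₁2, hsm⟩ := exists_small_param hs (a := K0 n D * A₂) (b := A) hc0
  have hcle : c ≤ 1 := by
    have : (1 / 2 : ℝ) ^ s ≤ 1 := Real.rpow_le_one (by norm_num) (by norm_num) hs.le
    rw [hc]; linarith
  set K : ℝ := (A₂ + 1) / (c₁ / 2) ^ s with hK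
  have hKpos : 0 < K := by positivity
  have hKc : K * (c₁ / 2) ^ s = A₂ + 1 := div_mul_cancel₀ _ (by positivity)
  refine ⟨A₂ + K * CΦ, c, ?_, hc0, hcle, fun E r P hE hr0 hr1 hP hval hP' => ?_⟩
  · have : 0 ≤ K * CΦ := by positivity
    linarith
  have : Nonempty E := hE.to_subtype
  set R : Pt n → ℝ := fun x => min 1 (⨅ w : E, (r w + dist x w)) with hR
  have hbdd : ∀ x, BddBelow (range fun w : E => r w + dist x (w : Pt n)) := fun x =>
    ⟨0, by rintro _ ⟨w, rfl⟩; exact add_nonneg (hr0 _) dist_nonneg⟩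
  have hR0 : ∀ x, 0 ≤ R x := fun x =>
    le_min zero_le_one (le_ciInf fun w => add_nonneg (hr0 _) dist_nonneg)
  have hR1 : ∀ x, R x ≤ 1 := fun x => min_le_left _ _
  have hRle : ∀ x, ∀ w ∈ E, R x ≤ r w + dist x w := fun x w hw =>
    (min_le_right _ _).trans (ciInf_le (hbdd x) ⟨w, hw⟩)
  have hRlt : ∀ x t, R x < t → 1 < t ∨ ∃ w ∈ E, r w + dist x w < t := by
    intro x t ht
    refine (min_lt_iff.1 ht).imp_right fun h => ?_
    obtain ⟨w, hw⟩ := exists_lt_of_ciInf_lt h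
    exact ⟨w, w.2, hw⟩
  have hPR : ∀ x, Bd s A₂ x (R x) (P x) := by
    refine fun x => Bd.of_forall_gt fun t ht => ?_
    have ht0 : 0 ≤ t := (hR0 x).trans ht.le
    rcases hRlt x t ht with h | ⟨w, -, h⟩
    · exact ((hP x).mono_scale (by linarith) (hr0 x) ((hr1 x).trans h.le)).mono ht0 hA₂A
    · have hd := dist_nonneg (x := x) (y := w)
      have h1 := (hP' x w).mono_scale (δ' := t) (by linarith) dist_nonneg (by linarith [hr0 w])
      have h2 := ((hP w).mono_scale (δ' := t) (by linarith) (hr0 w) (by linarith)).shift (K := 1)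
        (y := x) (by linarith) ht0 le_rfl (by rw [dist_comm]; linarith [hr0 w])
      have h3 := h1.add h2
      rwa [sub_add_cancel, one_pow, mul_one] at h3
  set δ : Pt n → ℝ := fun x => min 1 (Metric.infDist x E) with hδ
  have hδ0 : ∀ x, 0 ≤ δ x := fun x => le_min zero_le_one Metric.infDist_nonneg
  have hδR : ∀ x, δ x ≤ R x := fun x => min_le_min_left _ (le_ciInf fun w =>
    (Metric.infDist_le_dist_of_mem w.2).trans (le_add_of_nonneg_left (hr0 _)))
  have hδE : ∀ x ∈ E, δ x = 0 := fun x hx => by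
    simp [hδ, Metric.infDist_zero_of_mem hx]
  obtain ⟨Φ, hΦ, hΦ'⟩ := hreg δ hδ0 fun z w => by
    have h1 : Metric.infDist z E ≤ Metric.infDist w E + dist z w := Metric.infDist_le_infDist_add_dist
    have h2 := dist_nonneg (x := z) (y := w)
    rw [hδ]
    beta_reduce
    rcases le_total 1 (Metric.infDist w E) with h | h
    · rw [min_eq_left h]; exact (min_le_left _ _).trans (by linarith)
    · rw [min_eq_right h]; exact (min_le_right _ _).trans h1
  have hKabs : |K| = K := abs_of_pos hKpos
  refine ⟨fun x => P x + K • Φ x, R, hR0, hR1, fun x => ?_, fun x => ?_, fun x hx => ?_,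
    fun x y => ?_⟩
  · have h1 := (((hΦ x).1.mono_scale (by linarith) (hδ0 x) (hδR x)).smul K)
    rw [hKabs] at h1
    exact (hPR x).add h1
  · rw [map_add, map_smul, smul_eq_mul]
    have hRs : 0 ≤ R x ^ s := Real.rpow_nonneg (hR0 x) s
    rcases le_or_gt (c₁ * R x) (δ x) with h | h
    · have h1 := abs_le.1 (hPR x 0 (by simp))
      simp only [map_zero, Nat.cast_zero, sub_zero] at h1
      have h2 : (c₁ / 2) ^ s * R x ^ s ≤ co x 0 (Φ x) := by
        rw [← Real.mul_rpow (by positivity) (hR0 x)]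
        refine le_trans (Real.rpow_le_rpow ?_ ?_ hs.le) (hΦ x).2
        · have := hR0 x; positivity
        · linarith
      have h3 := mul_le_mul_of_nonneg_left h2 hKpos.le
      rw [← mul_assoc, hKc] at h3
      have h4 := mul_le_mul_of_nonneg_right hcle hRs
      linarith [h1.1]
    · have hlt : c₁ * R x < 1 := by nlinarith [hR1 x, hR0 x]
      have hinf : Metric.infDist x E < c₁ * R x := by
        rcases min_lt_iff.1 h with h' | h'
        · linarith
        · exact h'
      obtain ⟨z, hz, hxz⟩ := (Metric.infDist_lt_iff hE).1 hinf
      have h1 := abs_le.1 ((hPR x).abs_co_sub_le (by linarith) (hR0 x) (by linarith) hxz.le hc₁.le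
        (α := 0) (by simp))
      have h2 := abs_le.1 ((hP' z x).mono_scale (δ' := c₁ * R x) (by linarith) dist_nonneg
        (by rw [dist_comm]; exact hxz.le) 0 (by simp))
      simp only [map_zero, Nat.cast_zero, sub_zero, map_sub] at h1 h2
      rw [Real.mul_rpow hc₁.le (hR0 x), hval z hz] at h2
      have h3 : (1 / 2) ^ s * R x ^ s ≤ r z ^ s := by
        rw [← Real.mul_rpow (by norm_num) (hR0 x)]
        refine Real.rpow_le_rpow (by linarith [hR0 x]) ?_ hs.le
        nlinarith [hRle x z hz, hR0 x]
      have h4 : 0 ≤ K * co x 0 (Φ x) :=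
        mul_nonneg hKpos.le (le_trans (Real.rpow_nonneg (by linarith [hδ0 x]) s) (hΦ x).2)
      have h5 := mul_le_mul_of_nonneg_right hsm hRs
      have h6 : (1 / 2 : ℝ) ^ s * R x ^ s = 2 * (c * R x ^ s) := by rw [hc]; ring
      have h7 : (K0 n D * A₂ * c₁ + A * c₁ ^ s) * R x ^ s =
        K0 n D * c₁ * A₂ * R x ^ s + A * (c₁ ^ s * R x ^ s) := by ring
      linarith [h1.2, h2.2]
  · have h0 : Φ x = 0 := Bd.eq_zero (s := s) (M := CΦ) (x := x) (by simpa [hδE x hx] using (hΦ x).1)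
    beta_reduce
    rw [h0, smul_zero, add_zero, hval x hx]
  · have h1 := (hΦ' x y).smul K
    rw [hKabs] at h1
    have h2 := ((hP' x y).mono dist_nonneg hA₂A).add h1
    rwa [smul_sub, show P x - P y + (K • Φ x - K • Φ y) = P x + K • Φ x - (P y + K • Φ y) by abel]
      at h2

lemma le_of_flat_le {a : ℝ≥0} {M t : ℝ} {m : ℕ} (hM : 0 < M) (ht : 0 ≤ t) (hm : 1 ≤ m)
    (hms : (m : ℝ) < s)
    (h : ((a : ℝ≥0∞) ^ s / ENNReal.ofReal (M * t ^ s) ^ (s - (m : ℝ))) ^ (1 / (m : ℝ)) ≤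
      ENNReal.ofReal M) : (a : ℝ) ≤ M * t ^ (s - (m : ℝ)) := by
  have hm0 : (0 : ℝ) < m := by exact_mod_cast hm
  have hs : 0 < s := hm0.trans hms
  have hsm : 0 ≤ s - (m : ℝ) := by linarith
  have hts : 0 ≤ t ^ (s - (m : ℝ)) := Real.rpow_nonneg ht _
  rw [one_div, ENNReal.rpow_inv_le_iff hm0, ENNReal.ofReal_rpow_of_pos hM,
    ENNReal.ofReal_rpow_of_nonneg (by positivity) hsm,
    ENNReal.div_le_iff_le_mul (.inr ENNReal.ofReal_ne_top) (.inl ENNReal.ofReal_ne_top),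
    ← ENNReal.ofReal_mul (by positivity)] at h
  have e : M ^ (m : ℝ) * (M * t ^ s) ^ (s - (m : ℝ)) = (M * t ^ (s - (m : ℝ))) ^ s := by
    rw [Real.mul_rpow hM.le (by positivity), Real.mul_rpow hM.le hts, ← mul_assoc,
      ← Real.rpow_add hM, ← Real.rpow_mul ht, ← Real.rpow_mul ht, mul_comm s]
    congr 2; ring
  rw [e, ← ENNReal.ofReal_rpow_of_nonneg (by positivity) hs.le,
    ENNReal.rpow_le_rpow_iff hs] at h
  rwa [← ENNReal.ofReal_coe_nnreal, ENNReal.ofReal_le_ofReal_iff (by positivity)] at h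

lemma flat_le_of_le {a : ℝ≥0} {C c M R v : ℝ} {m : ℕ} (hM : 0 < M) (hR : 0 ≤ R) (hC : 1 ≤ C)
    (hc : 0 < c) (hc1 : c ≤ 1) (hm : 1 ≤ m) (hms : (m : ℝ) < s)
    (ha : (a : ℝ) ≤ C * M * R ^ (s - (m : ℝ))) (hv : c * M * R ^ s ≤ v) :
    ((a : ℝ≥0∞) ^ s / ENNReal.ofReal v ^ (s - (m : ℝ))) ^ (1 / (m : ℝ)) ≤
      ENNReal.ofReal ((C / c) ^ s * M) := by
  have hm0 : (0 : ℝ) < m := by exact_mod_cast hm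
  have hs : 0 < s := hm0.trans hms
  have hsm : 0 ≤ s - (m : ℝ) := by linarith
  have hts : 0 ≤ R ^ (s - (m : ℝ)) := Real.rpow_nonneg hR _
  have hCc : 1 ≤ (C / c) ^ s := Real.one_le_rpow ((one_le_div hc).2 (hc1.trans hC)) hs.le
  have hv0 : 0 ≤ v := le_trans (by positivity) hv
  rw [one_div, ENNReal.rpow_inv_le_iff hm0, ENNReal.ofReal_rpow_of_nonneg (by positivity) hm0.le,
    ENNReal.ofReal_rpow_of_nonneg hv0 hsm, ← ENNReal.ofReal_coe_nnreal,
    ENNReal.ofReal_rpow_of_nonneg a.coe_nonneg hs.le]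
  refine ENNReal.div_le_of_le_mul ?_
  rw [← ENNReal.ofReal_mul (by positivity)]
  refine ENNReal.ofReal_le_ofReal ?_
  calc (a : ℝ) ^ s ≤ (C * M * R ^ (s - (m : ℝ))) ^ s := Real.rpow_le_rpow a.coe_nonneg ha hs.le
    _ = C ^ s * (M ^ s * (R ^ s) ^ (s - (m : ℝ))) := by
        rw [Real.mul_rpow (by positivity) hts, Real.mul_rpow (by positivity) hM.le,
          ← Real.rpow_mul hR, ← Real.rpow_mul hR, mul_comm s, mul_assoc]
    _ ≤ (((C / c) ^ s) ^ (m : ℝ) * c ^ (s - (m : ℝ))) * (M ^ s * (R ^ s) ^ (s - (m : ℝ))) := by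
        refine mul_le_mul_of_nonneg_right ?_ (by positivity)
        calc C ^ s = (C / c) ^ s * c ^ s := by
              rw [← Real.mul_rpow (by positivity) hc.le, div_mul_cancel₀ _ hc.ne']
          _ ≤ _ := mul_le_mul (Real.self_le_rpow_of_one_le hCc (by exact_mod_cast hm))
              (Real.rpow_le_rpow_of_exponent_ge hc hc1 (by linarith)) (by positivity)
              (by positivity)
    _ = ((C / c) ^ s * M) ^ (m : ℝ) * (c * M * R ^ s) ^ (s - (m : ℝ)) := by
        have e : M ^ s = M ^ (m : ℝ) * M ^ (s - (m : ℝ)) := by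
          rw [← Real.rpow_add hM]; congr 1; ring
        rw [Real.mul_rpow (by positivity) hM.le, Real.mul_rpow (by positivity) (by positivity),
          Real.mul_rpow hc.le hM.le, e]
        ring
    _ ≤ _ := mul_le_mul_of_nonneg_left (Real.rpow_le_rpow (by positivity) hv hsm) (by positivity)

section
variable {F : Pt n → ℝ} {M : ℝ}

lemma norm_iteratedFDeriv_le_of_fsNorm (hM : 0 ≤ M) (h : fsNorm s univ F ≤ ENNReal.ofReal M) {m : ℕ}
    (hm : m ≤ lowFloor s) (x : Pt n) : ‖iteratedFDeriv ℝ m F x‖ ≤ M := by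
  have h1 : (‖iteratedFDerivWithin ℝ m F univ x‖₊ : ℝ≥0∞) ≤ derivSup s univ F :=
    le_iSup₂_of_le m hm (le_iSup₂_of_le x (mem_univ x) le_rfl)
  have h2 := h1.trans ((le_self_add.trans le_self_add).trans h)
  rw [iteratedFDerivWithin_univ, ← ENNReal.ofReal_coe_nnreal, ENNReal.ofReal_le_ofReal_iff hM] at h2
  exact h2

lemma norm_iteratedFDeriv_sub_le_of_fsNorm (hM : 0 ≤ M) (h : fsNorm s univ F ≤ ENNReal.ofReal M)
    (x y : Pt n) : ‖iteratedFDeriv ℝ (lowFloor s) F x - iteratedFDeriv ℝ (lowFloor s) F y‖ ≤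
      M * dist x y ^ (s - (lowFloor s : ℝ)) := by
  rcases eq_or_ne x y with rfl | hxy
  · rw [sub_self, norm_zero]; positivity
  have h1 := (le_iSup₂_of_le (f := fun (x : Pt n) (_ : x ∈ univ) => ⨆ (y : Pt n) (_ : y ∈ univ)
      (_ : x ≠ y), (‖iteratedFDerivWithin ℝ (lowFloor s) F univ x
        - iteratedFDerivWithin ℝ (lowFloor s) F univ y‖₊ : ℝ≥0∞)
      / ENNReal.ofReal (‖x - y‖ ^ (s - (lowFloor s : ℝ)))) x (mem_univ x)
    (le_iSup₂_of_le y (mem_univ y) (le_iSup_of_le hxy le_rfl)))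
  have h2 := h1.trans (((le_add_self (a := holderSemi s univ F)).trans le_self_add).trans h)
  have hpos : 0 < dist x y ^ (s - (lowFloor s : ℝ)) := Real.rpow_pos_of_pos (dist_pos.2 hxy) _
  rw [iteratedFDerivWithin_univ, ← dist_eq_norm, ENNReal.div_le_iff_le_mul
    (.inl (by simpa using hpos)) (.inl ENNReal.ofReal_ne_top), ← ENNReal.ofReal_mul hM,
    ← ENNReal.ofReal_coe_nnreal, ENNReal.ofReal_le_ofReal_iff (by positivity)] at h2
  exact h2

lemma norm_iteratedFDeriv_le_of_flat (hM : 0 < M) (h : fsNorm s univ F ≤ ENNReal.ofReal M) {m : ℕ}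
    (hm1 : 1 ≤ m) (hm : m ≤ lowFloor s) (hms : (m : ℝ) < s) {x : Pt n} {t : ℝ} (ht : 0 ≤ t)
    (hx : F x = M * t ^ s) : ‖iteratedFDeriv ℝ m F x‖ ≤ M * t ^ (s - (m : ℝ)) := by
  have h1 := (le_iSup₂_of_le (f := fun (m : ℕ) (_ : 1 ≤ m) => ⨆ (_ : m ≤ lowFloor s) (x : Pt n)
      (_ : x ∈ univ), ((‖iteratedFDerivWithin ℝ m F univ x‖₊ : ℝ≥0∞) ^ s
      / ENNReal.ofReal (F x) ^ (s - (m : ℝ))) ^ (1 / (m : ℝ))) m hm1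
    (le_iSup_of_le hm (le_iSup₂_of_le x (mem_univ x) le_rfl)))
  have h2 := h1.trans ((le_add_self (a := flatSemi s univ F)).trans h)
  rw [hx, iteratedFDerivWithin_univ] at h2
  exact le_of_flat_le hM ht hm1 hms h2

end

/-- The Taylor field of a function in the cone. -/
lemma isField_jsField [Ord D s] (hD : lowFloor s = D) {F : Pt n → ℝ} {M : ℝ} (hM : 0 < M)
    (hF : ContDiff ℝ (D : ℕ∞) F) (hn : fsNorm s univ F ≤ ENNReal.ofReal M) {d : Dat n}
    {S : Set (Pt n)} {f : Pt n → ℝ} (hE : ∀ z ∈ S, z ∈ d.E → F z = f z ∧ f z = M * d.r z ^ s)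
    (hE' : ∀ z ∈ S, z ∉ d.E → d.r z = 1) :
    IsField s d S f (KT n D ^ D * M) (jsField D (jsOf F)) := by
  have hK : 1 ≤ KT n D ^ D := one_le_pow₀ (one_le_KT n D)
  have hcd : ∀ α : MI n, α.degree ≤ D → ContDiff ℝ (α.degree : ℕ∞) F := fun α hα =>
    hF.of_le (by exact_mod_cast hα)
  refine ⟨fun z hz => ?_, fun z hz hzE => ?_, fun z _ w _ => ?_⟩
  · refine Bd.mono (M := M) (fun α hα => ?_) (d.r_nonneg z) (le_mul_of_one_le_left hM.le hK)
    rw [co_jsField _ _ hα]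
    refine (abs_jsOf_le α (hcd α hα) z).trans ?_
    by_cases hzE : z ∈ d.E
    · rcases Nat.eq_zero_or_pos α.degree with h0 | h1
      · rw [h0, norm_iteratedFDeriv_zero, Nat.cast_zero, sub_zero, (hE z hz hzE).1,
          (hE z hz hzE).2, Real.norm_of_nonneg (mul_nonneg hM.le (Real.rpow_nonneg (d.r_nonneg z) s))]
      · exact norm_iteratedFDeriv_le_of_flat hM hn h1 (by omega)
          (by linarith [sub_degree_pos (s := s) hα]) (d.r_nonneg z)
          ((hE z hz hzE).1.trans (hE z hz hzE).2)
    · rw [hE' z hz hzE, Real.one_rpow, mul_one]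
      exact norm_iteratedFDeriv_le_of_fsNorm hM.le hn (by omega) z
  · rw [co_jsField _ _ (by simp), jsOf_zero, (hE z hz hzE).1]
  · refine (isJS_jsOf hF).bd_sub hM.le (fun α hα x y => ?_) z w
    refine (abs_jsOf_sub_le α (hcd α hα.le) x y).trans ?_
    have := norm_iteratedFDeriv_sub_le_of_fsNorm hM.le hn x y
    rw [hD] at this
    rwa [hα]

/-- A flat nonnegative field on the whole space defines a function in the cone. -/
lemma memFs_of_field [Ord D s] (hD : lowFloor s = D) {Q : Pt n → J n D} {R : Pt n → ℝ}
    {M C c : ℝ} (hM : 0 < M) (hC : 1 ≤ C) (hc : 0 < c) (hc1 : c ≤ 1) (hR0 : ∀ z, 0 ≤ R z)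
    (hR1 : ∀ z, R z ≤ 1) (hQ : ∀ z, Bd s (C * M) z (R z) (Q z))
    (hlow : ∀ z, c * M * R z ^ s ≤ co z 0 (Q z))
    (hQ' : ∀ z w, Bd s (C * M) z (dist z w) (Q z - Q w)) :
    MemFs s univ (fun x => co x 0 (Q x)) ∧ fsNorm s univ (fun x => co x 0 (Q x)) ≤
      ENNReal.ofReal ((2 * ((1 + KD n D) * C) + ((1 + KD n D) * C / c) ^ s) * M) := by
  have hK := KD_pos n D
  have hs := Ord.pos D s
  set C₁ := (1 + KD n D) * C with hC₁
  have hC₁1 : 1 ≤ C₁ := one_le_mul_of_one_le_of_one_le (by linarith) hC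
  have hKC : KD n D * (C * M) ≤ C₁ * M := by
    rw [hC₁]; nlinarith [mul_pos (show 0 < C by linarith) hM]
  have hJ : IsJS D (fun α x => co x α (Q x)) := isJS_of_field hQ'
  have htop : ∀ α : MI n, α.degree = D → ∀ x y,
      |co x α (Q x) - co y α (Q y)| ≤ C * M * dist x y ^ (s - D) := fun α hα x y =>
    abs_co_sub_le_of_field hQ' hα x y
  have hsD : 0 < s - D := by linarith [Ord.lt (D := D) (s := s)]
  have hcont : ∀ α : MI n, α.degree = D → Continuous fun x => co x α (Q x) := by
    intro α hα
    rw [continuous_iff_continuousAt]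
    intro x
    rw [ContinuousAt, tendsto_iff_dist_tendsto_zero]
    refine squeeze_zero (fun _ => dist_nonneg) (fun y => (Real.dist_eq _ _).trans_le (htop α hα y x)) ?_
    have h1 : Continuous fun y => C * M * dist y x ^ (s - D) :=
      continuous_const.mul ((Real.continuous_rpow_const hsD.le).comp
        (continuous_id.dist continuous_const))
    have h2 := h1.tendsto x
    rwa [dist_self, Real.zero_rpow hsD.ne', mul_zero] at h2
  have hcd : ContDiff ℝ (D : ℕ∞) (fun x => co x 0 (Q x)) :=
    hJ.contDiff hcont D 0 (by simp)
  have hnorm : ∀ m ≤ D, ∀ x, ‖iteratedFDeriv ℝ m (fun x => co x 0 (Q x)) x‖ ≤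
      C₁ * M * R x ^ (s - (m : ℝ)) := by
    intro m hm x
    have hRx : 0 ≤ R x ^ (s - (m : ℝ)) := Real.rpow_nonneg (hR0 x) _
    refine (hJ.norm_iteratedFDeriv_le hcd hm x (B := C * M * R x ^ (s - (m : ℝ)))
      (by positivity) fun α hα => ?_).trans ?_
    · have := hQ x α (by omega)
      rwa [hα] at this
    · rw [← mul_assoc]
      exact mul_le_mul_of_nonneg_right hKC hRx
  have hderiv : derivSup s univ (fun x => co x 0 (Q x)) ≤ ENNReal.ofReal (C₁ * M) := by
    refine iSup₂_le fun m hm => iSup₂_le fun x _ => ?_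
    rw [iteratedFDerivWithin_univ, ← ENNReal.ofReal_coe_nnreal]
    refine ENNReal.ofReal_le_ofReal ((hnorm m (by omega) x).trans ?_)
    have hms : (m : ℝ) ≤ D := by exact_mod_cast hD ▸ hm
    exact mul_le_of_le_one_right (by positivity) (Real.rpow_le_one (hR0 x) (hR1 x) (by linarith))
  have hhol : holderSemi s univ (fun x => co x 0 (Q x)) ≤ ENNReal.ofReal (C₁ * M) := by
    refine iSup₂_le fun x _ => iSup₂_le fun y _ => iSup_le fun hxy => ?_
    refine ENNReal.div_le_of_le_mul ?_
    rw [iteratedFDerivWithin_univ, ← dist_eq_norm, ← ENNReal.ofReal_mul (by positivity),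
      ← ENNReal.ofReal_coe_nnreal, hD]
    refine ENNReal.ofReal_le_ofReal ((hJ.norm_iteratedFDeriv_sub_le hcd le_rfl x y
      (B := C * M * dist x y ^ (s - D)) (by positivity) fun α hα => htop α hα x y).trans ?_)
    rw [← mul_assoc]
    exact mul_le_mul_of_nonneg_right hKC (by positivity)
  have hflat : flatSemi s univ (fun x => co x 0 (Q x)) ≤ ENNReal.ofReal ((C₁ / c) ^ s * M) := by
    refine iSup₂_le fun m hm => iSup_le fun hmD => iSup₂_le fun x _ => ?_
    rw [iteratedFDerivWithin_univ]
    have hms : (m : ℝ) ≤ D := by exact_mod_cast hD ▸ hmD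
    exact flat_le_of_le hM (hR0 x) hC₁1 hc hc1 hm (by linarith) (hnorm m (by omega) x) (hlow x)
  have hcs : csNorm s univ (fun x => co x 0 (Q x)) ≤ ENNReal.ofReal (2 * C₁ * M) := by
    refine (add_le_add hderiv hhol).trans_eq ?_
    rw [← ENNReal.ofReal_add (by positivity) (by positivity)]
    congr 1; ring
  refine ⟨⟨⟨?_, ne_top_of_le_ne_top ENNReal.ofReal_ne_top hcs⟩, fun x _ => ?_,
    ne_top_of_le_ne_top ENNReal.ofReal_ne_top hflat⟩, ?_⟩
  · rw [hD]; exact hcd.contDiffOn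
  · have := Real.rpow_nonneg (hR0 x) s
    exact le_trans (by positivity) (hlow x)
  · refine (add_le_add hcs hflat).trans_eq ?_
    rw [← ENNReal.ofReal_add (by positivity) (by positivity)]
    congr 1; ring

/-- The quantitative extension theorem. -/
lemma exists_extension [Ord D s] (hD : lowFloor s = D) (n : ℕ) : ∃ (k : ℕ) (C : ℝ), 0 < C ∧
    ∀ (E : Set (Pt n)) (f : Pt n → ℝ) (M : ℝ), E.Nonempty → 0 < M → (∀ x ∈ E, 0 ≤ f x) →
      (∀ S : Set (Pt n), S ⊆ E → S.Finite → S.ncard ≤ k →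
        ∃ F : Pt n → ℝ, MemFs s univ F ∧ (∀ x ∈ S, F x = f x) ∧
          fsNorm s univ F ≤ ENNReal.ofReal M) →
      ∃ F : Pt n → ℝ, MemFs s univ F ∧ (∀ x ∈ E, F x = f x) ∧
        fsNorm s univ F ≤ ENNReal.ofReal (C * M) := by
  classical
  obtain ⟨k, C₀, hC₀, hsmall⟩ := exists_field_of_small (n := n) (D := D) (s := s)
  have hKT : 1 ≤ KT n D ^ D := one_le_pow₀ (one_le_KT n D)
  have hs := Ord.pos D s
  obtain ⟨C, c, hC, hc, hc1, hflat⟩ := exists_flat_field (n := n) (D := D) (s := s)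
    (A := C₀ * KT n D ^ D) (one_le_mul_of_one_le_of_one_le hC₀ hKT)
  have hK := KD_pos n D
  refine ⟨max k 1, 2 * ((1 + KD n D) * C) + ((1 + KD n D) * C / c) ^ s, by positivity,
    fun E f M hE hM hf hS => ?_⟩
  have hfM : ∀ z ∈ E, f z ≤ M := by
    intro z hz
    obtain ⟨F, -, hFz, hFM⟩ := hS {z} (by simpa using hz) (finite_singleton z) (by simp)
    have := norm_iteratedFDeriv_le_of_fsNorm hM.le hFM (Nat.zero_le _) z
    rw [norm_iteratedFDeriv_zero, hFz z rfl] at this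
    exact (le_abs_self _).trans this
  set r : Pt n → ℝ := fun z => if z ∈ E then (f z / M) ^ (1 / s) else 1 with hr
  have hrE : ∀ z ∈ E, r z = (f z / M) ^ (1 / s) := fun z hz => if_pos hz
  have hrE' : ∀ z, z ∉ E → r z = 1 := fun z hz => if_neg hz
  have hr0 : ∀ z, 0 ≤ r z := fun z => by
    by_cases hz : z ∈ E
    · rw [hrE z hz]; exact Real.rpow_nonneg (div_nonneg (hf z hz) hM.le) _
    · rw [hrE' z hz]; exact zero_le_one
  have hr1 : ∀ z, r z ≤ 1 := fun z => by
    by_cases hz : z ∈ E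
    · rw [hrE z hz]
      exact Real.rpow_le_one (div_nonneg (hf z hz) hM.le) ((div_le_one hM).2 (hfM z hz))
        (by positivity)
    · exact (hrE' z hz).le
  have hrs : ∀ z ∈ E, r z ^ s = f z / M := fun z hz => by
    rw [hrE z hz, ← Real.rpow_mul (div_nonneg (hf z hz) hM.le), one_div_mul_cancel hs.ne',
      Real.rpow_one]
  have hfr : ∀ z ∈ E, f z = M * r z ^ s := fun z hz => by
    rw [hrs z hz, mul_div_cancel₀ _ hM.ne']
  have hfin : ∀ T : Finset (Pt n), ∃ P : Pt n → J n D,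
      (∀ z ∈ T, Bd s (C₀ * KT n D ^ D) z (r z) (P z) ∧ co z 0 (P z) ∈ {t | z ∈ E → t = r z ^ s}) ∧
        ∀ z ∈ T, ∀ w ∈ T, Bd s (C₀ * KT n D ^ D) z (dist z w) (P z - P w) := by
    intro T
    obtain ⟨P, hP⟩ := hsmall ⟨T, E, r, hr0⟩ f (KT n D ^ D * M) (by positivity) fun S _ hSk => by
      obtain ⟨F, hF, hFS, hFM⟩ := hS (↑(S.filter fun z => z ∈ E))
        (fun z hz => (Finset.mem_filter.1 hz).2) (Finset.finite_toSet _) (by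
          rw [ncard_coe_finset]
          exact (Finset.card_filter_le _ _).trans (hSk.trans (le_max_left _ _)))
      have hcd := hF.1.1
      rw [hD, contDiffOn_univ] at hcd
      exact ⟨_, isField_jsField hD hM hcd hFM (fun z hz hzE =>
        ⟨hFS z (Finset.mem_filter.2 ⟨hz, hzE⟩), hfr z hzE⟩) fun z _ hzE => hrE' z hzE⟩
    have e : |M⁻¹| * (C₀ * (KT n D ^ D * M)) = C₀ * KT n D ^ D := by
      rw [abs_of_pos (inv_pos.2 hM)]; field_simp
    have hP' := hP.smul M⁻¹
    rw [e] at hP'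
    refine ⟨M⁻¹ • P, fun z hz => ⟨hP'.1 z hz, fun hzE => ?_⟩, hP'.2.2⟩
    rw [hP'.2.1 z hz hzE, Pi.smul_apply, smul_eq_mul, hrs z hzE, div_eq_inv_mul]
  obtain ⟨P, hP, hP'⟩ := exists_limit_field (fun z => by
    by_cases hz : z ∈ E
    · simpa [hz] using isClosed_singleton (x := r z ^ s)
    · simp [hz]) hfin
  obtain ⟨Q, R, hR0, hR1, hQ, hlow, hval, hQ'⟩ := hflat E r P hE hr0 hr1 (fun z => (hP z).1)
    (fun z hz => (hP z).2 hz) hP'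
  obtain ⟨h1, h2⟩ := memFs_of_field (M := M) (Q := fun z => M • Q z) hD hM hC hc hc1 hR0 hR1
    (fun z => by have := (hQ z).smul M; rwa [abs_of_pos hM, mul_comm M] at this)
    (fun z => by
      rw [map_smul, smul_eq_mul, mul_comm c, mul_assoc]
      exact mul_le_mul_of_nonneg_left (hlow z) hM.le)
    (fun z w => by
      have := (hQ' z w).smul M
      rwa [abs_of_pos hM, mul_comm M, smul_sub] at this)
  refine ⟨_, h1, fun x hx => ?_, h2⟩
  rw [map_smul, hval x hx, smul_eq_mul, hfr x hx]

lemma ord_lowFloor (hs : 0 < s) : Ord (lowFloor s) s := by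
  have h1 : 1 ≤ ⌈s⌉₊ := Nat.one_le_iff_ne_zero.2 (Nat.ceil_pos.2 hs).ne'
  have h2 : ((lowFloor s : ℕ) : ℝ) = ⌈s⌉₊ - 1 := by rw [lowFloor, Nat.cast_sub h1, Nat.cast_one]
  refine ⟨?_, ?_⟩
  · rw [h2]; linarith [Nat.ceil_lt_add_one hs.le]
  · rw [h2]; linarith [Nat.le_ceil s]

lemma memFs_zero (hs : 0 < s) : MemFs s univ (fun _ : Pt n => (0 : ℝ)) ∧
    fsNorm s univ (fun _ : Pt n => (0 : ℝ)) = 0 := by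
  have h0 : ∀ m, iteratedFDerivWithin ℝ m (fun _ : Pt n => (0 : ℝ)) univ = 0 := fun m => by
    rw [iteratedFDerivWithin_univ]; exact iteratedFDeriv_fun_zero
  have h1 : csNorm s univ (fun _ : Pt n => (0 : ℝ)) = 0 := by
    simp [csNorm, derivSup, holderSemi, h0]
  have h2 : flatSemi s univ (fun _ : Pt n => (0 : ℝ)) = 0 := by
    simp only [flatSemi, h0, Pi.zero_apply, nnnorm_zero, ENNReal.coe_zero, ENNReal.zero_rpow_of_pos hs,
      ENNReal.zero_div, iSup_eq_zero]
    intro m hm _ _ _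
    exact ENNReal.zero_rpow_of_pos (one_div_pos.2 (by exact_mod_cast hm))
  refine ⟨⟨⟨contDiffOn_const, ?_⟩, fun _ _ => le_rfl, ?_⟩, ?_⟩
  · rw [h1]; exact ENNReal.zero_ne_top
  · rw [h2]; exact ENNReal.zero_ne_top
  · rw [fsNorm, h1, h2, add_zero]

lemma traceNorm_mono {S T : Set (Pt n)} (h : S ⊆ T) (f : Pt n → ℝ) :
    traceNorm s S f ≤ traceNorm s T f :=
  le_iInf₂ fun F hF => iInf₂_le_of_le F ⟨hF.1, fun x hx => hF.2 x (h hx)⟩ le_rfl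

end FlatExt

/-- Theorem `fp-arbitrary`, Finiteness Principle for
`F^s(ℝⁿ)`: there exist `k♯ = k♯(n,s)` and `C♯ = C♯(n,s)` such that for every
set `E ⊆ ℝⁿ` and `f : E → [0,∞)`: `f` extends to an `F^s(ℝⁿ)` function iff
`sup_{S ⊆ E, #S ≤ k♯} ‖f‖_{F^s(S)} < ∞`; moreover
`sup_{S, #S ≤ k♯} ‖f‖_{F^s(S)} ≤ ‖f‖_{F^s(E)} ≤ C♯ sup_{S, #S ≤ k♯} ‖f‖_{F^s(S)}`. -/
theorem statement18 (n : ℕ) (hn : 1 ≤ n) (s : ℝ) (hs : 0 < s) :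
    ∃ (k : ℕ) (C : ℝ), 0 < C ∧
      ∀ (Eset : Set (EuclideanSpace ℝ (Fin n))),
      ∀ f : EuclideanSpace ℝ (Fin n) → ℝ, (∀ x ∈ Eset, 0 ≤ f x) →
        ((∃ F : EuclideanSpace ℝ (Fin n) → ℝ,
            MemFs s (Set.univ : Set (EuclideanSpace ℝ (Fin n))) F ∧
            ∀ x ∈ Eset, F x = f x) ↔
          (⨆ (S : Set (EuclideanSpace ℝ (Fin n)))
              (_ : S ⊆ Eset ∧ S.Finite ∧ S.ncard ≤ k), traceNorm s S f) ≠ ∞) ∧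
        (⨆ (S : Set (EuclideanSpace ℝ (Fin n)))
            (_ : S ⊆ Eset ∧ S.Finite ∧ S.ncard ≤ k), traceNorm s S f) ≤
          traceNorm s Eset f ∧
        traceNorm s Eset f ≤ ENNReal.ofReal C *
          ⨆ (S : Set (EuclideanSpace ℝ (Fin n)))
            (_ : S ⊆ Eset ∧ S.Finite ∧ S.ncard ≤ k), traceNorm s S f := by
  have := FlatExt.ord_lowFloor hs
  obtain ⟨k, C, hC, hext⟩ := FlatExt.exists_extension (s := s) rfl n
  refine ⟨k, C, hC, fun Eset f hf => ?_⟩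
  set τ := ⨆ (S : Set (EuclideanSpace ℝ (Fin n))) (_ : S ⊆ Eset ∧ S.Finite ∧ S.ncard ≤ k),
    traceNorm s S f with hτ
  have hle : τ ≤ traceNorm s Eset f := iSup₂_le fun S hS => FlatExt.traceNorm_mono hS.1 f
  have main : ∀ M : ℝ, 0 < M → τ < ENNReal.ofReal M → ∃ F : EuclideanSpace ℝ (Fin n) → ℝ,
      MemFs s univ F ∧ (∀ x ∈ Eset, F x = f x) ∧ fsNorm s univ F ≤ ENNReal.ofReal (C * M) := by
    intro M hM hτM
    rcases Eset.eq_empty_or_nonempty with rfl | hE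
    · exact ⟨_, (FlatExt.memFs_zero hs).1, by simp, by rw [(FlatExt.memFs_zero hs).2]; exact zero_le⟩
    · refine hext Eset f M hE hM hf fun S hSE hSf hSk => ?_
      have h1 : traceNorm s S f < ENNReal.ofReal M :=
        (le_iSup₂ (f := fun (S : Set (EuclideanSpace ℝ (Fin n)))
          (_ : S ⊆ Eset ∧ S.Finite ∧ S.ncard ≤ k) => traceNorm s S f) S ⟨hSE, hSf, hSk⟩).trans_lt hτM
      obtain ⟨F, h2⟩ := iInf_lt_iff.1 h1
      obtain ⟨hF, h3⟩ := iInf_lt_iff.1 h2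
      exact ⟨F, hF.1, hF.2, h3.le⟩
  refine ⟨⟨?_, fun h => ?_⟩, hle, ?_⟩
  · rintro ⟨F, hF, hFE⟩
    refine ne_top_of_le_ne_top ?_ (hle.trans (iInf₂_le F ⟨hF, hFE⟩))
    exact ENNReal.add_ne_top.2 ⟨hF.1.2, hF.2.2⟩
  · obtain ⟨F, hF, hFE, -⟩ := main (τ.toReal + 1) (by positivity) (by
      rw [← ENNReal.ofReal_toReal h, ENNReal.toReal_ofReal ENNReal.toReal_nonneg]
      exact (ENNReal.ofReal_lt_ofReal_iff (by positivity)).2 (by linarith))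
    exact ⟨F, hF, hFE⟩
  · rcases eq_or_ne τ ∞ with h | h
    · rw [h, ENNReal.mul_top (by simpa using hC)]
      exact le_top
    · refine ENNReal.le_of_forall_pos_le_add fun ε hε _ => ?_
      have hM : 0 < τ.toReal + ε / C := by positivity
      obtain ⟨F, hF, hFE, hFM⟩ := main _ hM (by
        conv_lhs => rw [← ENNReal.ofReal_toReal h]
        exact (ENNReal.ofReal_lt_ofReal_iff hM).2 (by
          have : (0 : ℝ) < ε / C := by positivity
          linarith))
      refine (iInf₂_le F ⟨hF, hFE⟩).trans (hFM.trans_eq ?_)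
      rw [mul_add, mul_div_cancel₀ _ hC.ne', ENNReal.ofReal_add (by positivity) (by positivity),
        ENNReal.ofReal_mul hC.le, ENNReal.ofReal_toReal h, ENNReal.ofReal_coe_nnreal]

end
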